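/- arXiv:1411.0243 — 2 statements merged into one kernel-verified Lean document; each statement's English description precedes it below -/
import Mathlib

section
/- Assume ω(log² n) ≤ d ≤ n, and let M_± be a uniform random element of M^±_{n,d}, the set of n×n matrices with entries in {+1, 0, −1} such that for every index k ∈ {1,…,n} the sums Σᵢ |M_±(i,k)| and Σⱼ |M_±(k,j)| both equal d. Then P(det(M_±) = 0) = O(d^{−1/4}). -/
open scoped Classical

noncomputable section

/-- `M^±_{n,d}`: matrices with entries in `{+1, 0, -1}` (encoded via `SignType`) such
that, for every index `k`, the sum of the absolute values of the entries in the `k`-th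
row and in the `k`-th column both equal `d`. -/
def sregSet (n d : ℕ) : Finset (Matrix (Fin n) (Fin n) SignType) :=
  Finset.univ.filter fun A =>
    ∀ k, (∑ i, ((A i k : ℤ)).natAbs) = d ∧ (∑ j, ((A k j : ℤ)).natAbs) = d

/-- The real matrix associated to a `SignType`-valued matrix. -/
def s2r {n : ℕ} (A : Matrix (Fin n) (Fin n) SignType) : Matrix (Fin n) (Fin n) ℝ :=
  Matrix.of fun i j => ((A i j : ℤ) : ℝ)

/-- Probability of the event `p` for a uniform random element of the finite set `s`. -/
def cprob {α : Type*} [Fintype α] (s : Finset α) (p : α → Prop) : ℝ :=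
  ((s.filter p).card : ℝ) / (s.card : ℝ)

/-- The sign `+1` or `-1` encoded by a Boolean. -/
def boolSign (b : Bool) : SignType := if b then 1 else -1

theorem boolSign_mul_self (b : Bool) : boolSign b * boolSign b = 1 := by
  cases b <;> decide

theorem boolSign_ne_zero (b : Bool) : boolSign b ≠ 0 := by
  cases b <;> decide

theorem centralBinom_sq_mul_le (p : ℕ) : p.centralBinom ^ 2 * (2 * p + 1) ≤ 16 ^ p := by
  induction p with
  | zero => simp
  | succ p ih =>
    have h := Nat.succ_mul_centralBinom_succ p
    have h1 : 0 < (p + 1) ^ 2 := by positivity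
    refine Nat.le_of_mul_le_mul_left ?_ h1
    calc (p + 1) ^ 2 * ((p + 1).centralBinom ^ 2 * (2 * (p + 1) + 1))
        = ((p + 1) * (p + 1).centralBinom) ^ 2 * (2 * p + 3) := by ring
      _ = (p.centralBinom ^ 2 * (2 * p + 1)) * (4 * (2 * p + 1) * (2 * p + 3)) := by
        rw [h]; ring
      _ ≤ 16 ^ p * (16 * (p + 1) ^ 2) := by
        apply Nat.mul_le_mul ih; nlinarith
      _ = (p + 1) ^ 2 * 16 ^ (p + 1) := by ring

theorem choose_half_sq_mul_le (k : ℕ) : (k.choose (k / 2)) ^ 2 * k ≤ 4 ^ k := by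
  rcases Nat.even_or_odd' k with ⟨p, rfl | rfl⟩
  · have h := centralBinom_sq_mul_le p
    rw [Nat.centralBinom_eq_two_mul_choose] at h
    rw [Nat.mul_div_cancel_left _ (by norm_num : 0 < 2), pow_mul]
    norm_num at h ⊢
    nlinarith [Nat.zero_le ((2 * p).choose p ^ 2)]
  · have h := centralBinom_sq_mul_le (p + 1)
    have h2 : (p + 1).centralBinom = 2 * (2 * p + 1).choose p := by
      rw [Nat.centralBinom_eq_two_mul_choose, show 2 * (p + 1) = 2 * p + 1 + 1 by ring,
        Nat.choose_succ_succ, ← Nat.choose_symm_half p]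
      ring
    rw [show (2 * p + 1) / 2 = p by omega]
    rw [h2] at h
    have h3 : 4 ^ (2 * p + 1) * 4 = 16 ^ (p + 1) := by
      rw [← pow_succ, show 2 * p + 1 + 1 = 2 * (p + 1) by ring, pow_mul]
      norm_num
    nlinarith [Nat.zero_le ((2 * p + 1).choose p ^ 2)]

theorem card_signed_sum_eq_le {ι : Type*} [Fintype ι] (a : ι → ℤ) (ha : ∀ i, a i ≠ 0) (c : ℤ) :
    (Finset.univ.filter fun s : ι → Bool => ∑ i, (boolSign (s i) : ℤ) * a i = c).card
      ≤ (Fintype.card ι).choose (Fintype.card ι / 2) := by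
  set F := Finset.univ.filter fun s : ι → Bool => ∑ i, (boolSign (s i) : ℤ) * a i = c with hF
  let φ : (ι → Bool) → Finset ι := fun s => Finset.univ.filter fun i => (s i = true ↔ 0 < a i)
  have hinj : Function.Injective φ := by
    intro s t h
    funext i
    have := Finset.ext_iff.1 h i
    simp only [φ, Finset.mem_filter, Finset.mem_univ, true_and] at this
    cases hs : s i <;> cases ht : t i <;> simp_all <;> omega
  have hsum : ∀ s, ∑ i, (boolSign (s i) : ℤ) * a i = ∑ i, if i ∈ φ s then |a i| else -|a i| := by
    intro s
    refine Finset.sum_congr rfl fun i _ => ?_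
    simp only [φ, Finset.mem_filter, Finset.mem_univ, true_and]
    rcases lt_or_gt_of_ne (ha i) with h | h
    · cases hs : s i <;> simp [boolSign, abs_of_neg h, h.not_gt]
    · cases hs : s i <;> simp [boolSign, abs_of_pos h, h]
  have hanti : IsAntichain (· ⊆ ·) (SetLike.coe (F.image φ)) := by
    intro A hA B hB hne hsub
    simp only [SetLike.mem_coe, Finset.mem_image] at hA hB
    obtain ⟨s, hs, rfl⟩ := hA
    obtain ⟨t, ht, rfl⟩ := hB
    simp only [hF, Finset.mem_filter, Finset.mem_univ, true_and] at hs ht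
    rw [hsum] at hs ht
    obtain ⟨j, hj, hj'⟩ := Finset.exists_of_ssubset (hsub.ssubset_of_ne hne)
    have : (∑ i, if i ∈ φ s then |a i| else -|a i|) < ∑ i, if i ∈ φ t then |a i| else -|a i| := by
      refine Finset.sum_lt_sum (fun i _ => ?_) ⟨j, Finset.mem_univ _, ?_⟩
      · have := abs_nonneg (a i)
        by_cases h : i ∈ φ s
        · simp [h, hsub h]
        · rw [if_neg h]; split_ifs <;> linarith
      · have := abs_pos.2 (ha j)
        rw [if_neg hj', if_pos hj]; linarith
    linarith
  rw [← Finset.card_image_of_injective F hinj]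
  exact hanti.sperner

/-- The Erdős–Littlewood–Offord inequality. -/
theorem card_signed_sum_eq_zero_sq_mul_le {ι : Type*} [Fintype ι] (a : ι → ℤ) :
    (Finset.univ.filter fun s : ι → Bool => ∑ i, (boolSign (s i) : ℤ) * a i = 0).card ^ 2
      * (Finset.univ.filter fun i => a i ≠ 0).card ≤ 4 ^ Fintype.card ι := by
  set F := Finset.univ.filter fun s : ι → Bool => ∑ i, (boolSign (s i) : ℤ) * a i = 0 with hF
  set k := (Finset.univ.filter fun i => a i ≠ 0).card with hk
  have hk1 : Fintype.card {i // a i ≠ 0} = k := Fintype.card_subtype _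
  have hk2 : Fintype.card {i // ¬ a i ≠ 0} = Fintype.card ι - k := by
    rw [Fintype.card_subtype_compl, hk1]
  have hkle : k ≤ Fintype.card ι := Finset.card_le_univ _
  have key : F.card ≤ k.choose (k / 2) * (Finset.univ : Finset ({i // ¬ a i ≠ 0} → Bool)).card := by
    refine Finset.card_le_mul_card_image_of_maps_to (f := fun s i => s i.1)
      (fun _ _ => Finset.mem_univ _) _ fun τ _ => ?_
    have hLO := fun c => card_signed_sum_eq_le (fun i : {i // a i ≠ 0} => a i.1) (fun i => i.2) c
    rw [hk1] at hLO
    by_cases hne : (F.filter fun s => (fun i : {i // ¬ a i ≠ 0} => s i.1) = τ).Nonempty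
    · refine le_trans ?_ (hLO 0)
      refine Finset.card_le_card_of_injOn (fun s i => s i.1) ?_ ?_
      · intro s hs
        simp only [Finset.coe_filter, hF, Finset.mem_filter, Finset.mem_univ, true_and,
          Set.mem_ofPred_eq] at hs ⊢
        have h0 := hs.1
        rw [← Finset.sum_filter_add_sum_filter_not Finset.univ (fun i => a i ≠ 0)] at h0
        rw [Finset.sum_eq_zero (s := Finset.univ.filter fun i => ¬ a i ≠ 0), add_zero,
          ← Finset.sum_subtype_eq_sum_filter] at h0
        · simpa using h0
        · intro i hi
          simp only [Finset.mem_filter, Finset.mem_univ, true_and, not_not] at hi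
          simp [hi]
      · intro s hs t ht hst
        simp only [Finset.coe_filter, Set.mem_ofPred_eq] at hs ht
        funext i
        by_cases h : a i ≠ 0
        · exact congrFun hst ⟨i, h⟩
        · exact (congrFun (hs.2.trans ht.2.symm) ⟨i, h⟩)
    · rw [Finset.not_nonempty_iff_eq_empty.1 hne]; simp
  rw [Finset.card_univ, Fintype.card_fun, hk2, Fintype.card_bool] at key
  calc F.card ^ 2 * k ≤ (k.choose (k / 2) * 2 ^ (Fintype.card ι - k)) ^ 2 * k := by gcongr
    _ = (k.choose (k / 2) ^ 2 * k) * 4 ^ (Fintype.card ι - k) := by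
      rw [mul_pow, ← pow_mul, mul_comm _ 2, pow_mul]; norm_num; ring
    _ ≤ 4 ^ k * 4 ^ (Fintype.card ι - k) := by gcongr; exact choose_half_sq_mul_le k
    _ = 4 ^ Fintype.card ι := by rw [← pow_add, Nat.add_sub_cancel' hkle]

theorem sum_natAbs_signType {ι : Type*} [Fintype ι] (f : ι → SignType) :
    ∑ i, ((f i : ℤ)).natAbs = (Finset.univ.filter fun i => f i ≠ 0).card := by
  rw [Finset.card_filter]
  refine Finset.sum_congr rfl fun i _ => ?_
  generalize f i = x
  cases x <;> simp

theorem mem_sregSet_iff {n d : ℕ} {X : Matrix (Fin n) (Fin n) SignType} :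
    X ∈ sregSet n d ↔ (∀ j, (Finset.univ.filter fun i => X i j ≠ 0).card = d) ∧
      ∀ i, (Finset.univ.filter fun j => X i j ≠ 0).card = d := by
  simp only [sregSet, Finset.mem_filter, Finset.mem_univ, true_and]
  rw [forall_and]
  simp_rw [fun k => sum_natAbs_signType fun i => X i k, fun k => sum_natAbs_signType fun j => X k j]

theorem transpose_mem_sregSet {n d : ℕ} {X : Matrix (Fin n) (Fin n) SignType}
    (hX : X ∈ sregSet n d) : X.transpose ∈ sregSet n d := by
  rw [mem_sregSet_iff] at hX ⊢
  exact ⟨hX.2, hX.1⟩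

/-- The number of nonzero entries of `X` in the rectangle `B × T`. -/
def edgeCount {n : ℕ} (B T : Finset (Fin n)) (X : Matrix (Fin n) (Fin n) SignType) : ℕ :=
  ((B ×ˢ T).filter fun p => X p.1 p.2 ≠ 0).card

theorem edgeCount_eq_sum {n : ℕ} (B T : Finset (Fin n)) (X : Matrix (Fin n) (Fin n) SignType) :
    edgeCount B T X = ∑ i ∈ B, (T.filter fun j => X i j ≠ 0).card := by
  rw [edgeCount, Finset.card_filter, Finset.sum_product]
  simp_rw [Finset.card_filter]

theorem edgeCount_eq_sum' {n : ℕ} (B T : Finset (Fin n)) (X : Matrix (Fin n) (Fin n) SignType) :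
    edgeCount B T X = ∑ j ∈ T, (B.filter fun i => X i j ≠ 0).card := by
  rw [edgeCount, Finset.card_filter, Finset.sum_product_right]
  simp_rw [Finset.card_filter]

theorem edgeCount_univ_left {n d : ℕ} {X : Matrix (Fin n) (Fin n) SignType}
    (hX : X ∈ sregSet n d) (T : Finset (Fin n)) : edgeCount Finset.univ T X = d * T.card := by
  rw [edgeCount_eq_sum', Finset.sum_congr rfl fun j _ => (mem_sregSet_iff.1 hX).1 j]
  simp [mul_comm]

theorem edgeCount_univ_right {n d : ℕ} {X : Matrix (Fin n) (Fin n) SignType}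
    (hX : X ∈ sregSet n d) (B : Finset (Fin n)) : edgeCount B Finset.univ X = d * B.card := by
  rw [edgeCount_eq_sum, Finset.sum_congr rfl fun j _ => (mem_sregSet_iff.1 hX).2 j]
  simp [mul_comm]

theorem edgeCount_add_compl_left {n : ℕ} (B T : Finset (Fin n))
    (X : Matrix (Fin n) (Fin n) SignType) :
    edgeCount B T X + edgeCount Bᶜ T X = edgeCount Finset.univ T X := by
  simp_rw [edgeCount_eq_sum]
  exact Finset.sum_add_sum_compl B _

/-- Exchange two columns within two rows. -/
def switch {n : ℕ} (q : Fin n × Fin n × Fin n × Fin n) (X : Matrix (Fin n) (Fin n) SignType) :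
    Matrix (Fin n) (Fin n) SignType :=
  fun a b => if a = q.1 ∨ a = q.2.1 then X a (Equiv.swap q.2.2.1 q.2.2.2 b) else X a b

theorem switch_switch {n : ℕ} (q : Fin n × Fin n × Fin n × Fin n)
    (X : Matrix (Fin n) (Fin n) SignType) : switch q (switch q X) = X := by
  funext a b
  by_cases h : a = q.1 ∨ a = q.2.1 <;> simp [switch, h]

/-- The rows and columns `q` can be switched in `X` so as to add a nonzero entry to `B × T`. -/
def Switchable {n : ℕ} (B T : Finset (Fin n)) (X : Matrix (Fin n) (Fin n) SignType)
    (q : Fin n × Fin n × Fin n × Fin n) : Prop :=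
  q.1 ∈ B ∧ q.2.1 ∉ B ∧ q.2.2.1 ∈ T ∧ q.2.2.2 ∉ T ∧ X q.1 q.2.2.1 = 0 ∧ X q.2.1 q.2.2.2 = 0 ∧
    X q.1 q.2.2.2 ≠ 0 ∧ X q.2.1 q.2.2.1 ≠ 0

theorem switch_mem_sregSet {n d : ℕ} {B T : Finset (Fin n)} {X : Matrix (Fin n) (Fin n) SignType}
    {q : Fin n × Fin n × Fin n × Fin n} (hX : X ∈ sregSet n d) (hq : Switchable B T X q) :
    switch q X ∈ sregSet n d := by
  obtain ⟨i, i', j, j'⟩ := q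
  obtain ⟨h1, h2, h3, h4, h5, h6, h7, h8⟩ := hq
  simp only at *
  have hii : i ≠ i' := fun h => h2 (h ▸ h1)
  have hjj : j ≠ j' := fun h => h4 (h ▸ h3)
  rw [mem_sregSet_iff] at hX ⊢
  refine ⟨fun b => ?_, fun a => ?_⟩
  · by_cases hb : b = j ∨ b = j'
    · rw [← hX.1 b]
      refine Finset.card_equiv (Equiv.swap i i') fun a => ?_
      simp only [Finset.mem_filter, Finset.mem_univ, true_and, switch]
      by_cases ha : a = i
      · subst ha
        rcases hb with rfl | rfl <;> simp [h5, h6, h7, h8]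
      · by_cases ha' : a = i'
        · subst ha'
          rcases hb with rfl | rfl <;> simp [h5, h6, h7, h8]
        · rw [Equiv.swap_apply_of_ne_of_ne ha ha']
          simp [ha, ha']
    · push Not at hb
      rw [← hX.1 b]
      simp only [switch, Equiv.swap_apply_of_ne_of_ne hb.1 hb.2, ite_self]
  · by_cases ha : a = i ∨ a = i'
    · rw [← hX.2 a]
      refine Finset.card_equiv (Equiv.swap j j') fun b => ?_
      simp [switch, ha]
    · rw [← hX.2 a]
      simp [switch, ha]

theorem edgeCount_switch {n : ℕ} {B T : Finset (Fin n)} {X : Matrix (Fin n) (Fin n) SignType}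
    {q : Fin n × Fin n × Fin n × Fin n} (hq : Switchable B T X q) :
    edgeCount B T (switch q X) = edgeCount B T X + 1 := by
  obtain ⟨i, i', j, j'⟩ := q
  obtain ⟨h1, h2, h3, h4, h5, h6, h7, h8⟩ := hq
  simp only at *
  have hii : i ≠ i' := fun h => h2 (h ▸ h1)
  rw [edgeCount, edgeCount, ← Finset.card_insert_of_notMem (a := (i, j))]
  · congr 1
    ext ⟨a, b⟩
    simp only [Finset.mem_filter, Finset.mem_product, Finset.mem_insert, Prod.mk.injEq, switch]
    by_cases ha : a = i
    · subst ha
      by_cases hb : b = j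
      · subst hb; simp [h1, h3, h7]
      · by_cases hb' : b = j'
        · subst hb'; simp [h4, hb]
        · simp [hb, Equiv.swap_apply_of_ne_of_ne hb hb']
    · by_cases ha' : a = i'
      · subst ha'; simp [h2, ha]
      · simp [ha, ha']
  · simp [h5]

/-- The number of switchings adding a nonzero entry to `B × T`. -/
def switchCount {n : ℕ} (B T : Finset (Fin n)) (X : Matrix (Fin n) (Fin n) SignType) : ℕ :=
  (Finset.univ.filter (Switchable B T X)).card

theorem sum_switchCount_le {n d : ℕ} (B T : Finset (Fin n)) (k : ℕ) :
    ∑ X ∈ (sregSet n d).filter (fun X => edgeCount B T X = k), switchCount B T X ≤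
      ((sregSet n d).filter (fun X => edgeCount B T X = k + 1)).card * ((k + 1) * (d * n)) := by
  set P : Matrix (Fin n) (Fin n) SignType → Finset (Fin n × Fin n × Fin n × Fin n) := fun Y =>
    (((B ×ˢ T).filter fun p => Y p.1 p.2 ≠ 0) ×ˢ
      ((Finset.univ ×ˢ Finset.univ).filter fun p => Y p.1 p.2 ≠ 0)).map
      ⟨fun p => (p.1.1, p.2.1, p.1.2, p.2.2), by
        rintro ⟨⟨a, b⟩, c, e⟩ ⟨⟨a', b'⟩, c', e'⟩ h; simp_all⟩ with hP
  have hPcard : ∀ Y ∈ (sregSet n d).filter (fun X => edgeCount B T X = k + 1),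
      (P Y).card = (k + 1) * (d * n) := by
    intro Y hY
    rw [Finset.mem_filter] at hY
    rw [hP, Finset.card_map, Finset.card_product]
    have := edgeCount_univ_left hY.1 Finset.univ
    rw [Finset.card_univ, Fintype.card_fin] at this
    rw [← this, ← hY.2]
    rfl
  rw [← smul_eq_mul, ← Finset.sum_const, ← Finset.sum_congr rfl hPcard]
  simp only [switchCount]
  rw [← Finset.card_sigma, ← Finset.card_sigma]
  refine Finset.card_le_card_of_injOn (fun z => ⟨switch z.2 z.1, z.2⟩) ?_ ?_
  · rintro ⟨X, q⟩ hz
    simp only [Finset.coe_sigma, Set.mem_sigma_iff, Finset.mem_coe, Finset.mem_filter,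
      Finset.mem_univ, true_and] at hz ⊢
    obtain ⟨⟨hX, hk⟩, hq⟩ := hz
    refine ⟨⟨switch_mem_sregSet hX hq, by rw [edgeCount_switch hq, hk]⟩, ?_⟩
    obtain ⟨i, i', j, j'⟩ := q
    obtain ⟨h1, h2, h3, h4, h5, h6, h7, h8⟩ := hq
    simp only [hP, Finset.mem_map, Finset.mem_product, Finset.mem_filter,
      Finset.mem_univ, true_and]
    refine ⟨((i, j), (i', j')), ⟨⟨⟨h1, h3⟩, ?_⟩, ?_⟩, rfl⟩
    · simpa [switch] using h7
    · simpa [switch] using h8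
  · rintro ⟨X, q⟩ - ⟨X', q'⟩ - h
    simp only [Sigma.mk.injEq, heq_eq_eq] at h
    obtain ⟨h, rfl⟩ := h
    have := congrArg (switch q) h
    rw [switch_switch, switch_switch] at this
    rw [this]

/-- If matrices with few nonzero entries in `B × T` admit many switchings, there are few of them. -/
theorem card_edgeCount_eq_mul_le {n d : ℕ} (hd : 0 < d * n) (B T : Finset (Fin n)) (K : ℕ)
    (h : ∀ X ∈ sregSet n d, edgeCount B T X < K →
      2 * ((edgeCount B T X + 1) * (d * n)) ≤ switchCount B T X) (r : ℕ) :
    ∀ k, k + r = K →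
      ((sregSet n d).filter (fun X => edgeCount B T X = k)).card * 2 ^ r ≤ (sregSet n d).card := by
  induction r with
  | zero => intro k _; simpa using Finset.card_filter_le _ _
  | succ r ih =>
    intro k hk
    refine le_trans ?_ (ih (k + 1) (by omega))
    have h1 := sum_switchCount_le (d := d) B T k
    have h2 : ((sregSet n d).filter (fun X => edgeCount B T X = k)).card * (2 * ((k + 1) * (d * n)))
        ≤ ∑ X ∈ (sregSet n d).filter (fun X => edgeCount B T X = k), switchCount B T X := by
      rw [← smul_eq_mul, ← Finset.sum_const]
      refine Finset.sum_le_sum fun X hX => ?_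
      rw [Finset.mem_filter] at hX
      have := h X hX.1 (by omega)
      rwa [hX.2] at this
    have h3 := h2.trans h1
    rw [← mul_assoc] at h3
    rw [pow_succ', ← mul_assoc]
    exact Nat.mul_le_mul_right _ (Nat.le_of_mul_le_mul_right h3 (by positivity))

theorem card_edgeCount_lt_mul_le {n d : ℕ} (hd : 0 < d * n) (B T : Finset (Fin n)) (K : ℕ)
    (h : ∀ X ∈ sregSet n d, edgeCount B T X < 2 * K →
      2 * ((edgeCount B T X + 1) * (d * n)) ≤ switchCount B T X) :
    ((sregSet n d).filter (fun X => edgeCount B T X < K)).card * 2 ^ K ≤ (sregSet n d).card := by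
  have h1 := card_edgeCount_eq_mul_le hd B T (2 * K) h
  have h2 : ((sregSet n d).filter (fun X => edgeCount B T X < K)).card ≤
      ∑ k ∈ Finset.range K, ((sregSet n d).filter (fun X => edgeCount B T X = k)).card := by
    refine le_trans (Finset.card_le_card ?_) Finset.card_biUnion_le
    intro X hX
    simp only [Finset.mem_filter, Finset.mem_biUnion, Finset.mem_range] at hX ⊢
    exact ⟨_, hX.2, hX.1, rfl⟩
  have hind : ∀ M, M ≤ K → (∑ k ∈ Finset.range M,
      ((sregSet n d).filter (fun X => edgeCount B T X = k)).card) * 2 ^ (2 * K - M) ≤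
        (sregSet n d).card := by
    intro M
    induction M with
    | zero => simp
    | succ M ih =>
      intro hM
      have h3 := ih (by omega)
      have h4 := h1 (2 * K - M) M (by omega)
      rw [Finset.sum_range_succ]
      rw [show 2 * K - M = 2 * K - (M + 1) + 1 by omega, pow_succ] at h3 h4
      nlinarith
  have := hind K le_rfl
  rw [show 2 * K - K = K by omega] at this
  exact (Nat.mul_le_mul_right _ h2).trans this

theorem mul_le_switchCount {n d g : ℕ} {X : Matrix (Fin n) (Fin n) SignType}
    (hX : X ∈ sregSet n d) (B T : Finset (Fin n))
    (hg : g + d * T.card + 2 * (d * d) ≤ d * B.card) :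
    edgeCount Bᶜ T X * g ≤ switchCount B T X := by
  set G : Fin n × Fin n → Finset (Fin n × Fin n) := fun e => Finset.univ.filter fun p =>
    p.1 ∈ B ∧ p.2 ∉ T ∧ X p.1 p.2 ≠ 0 ∧ X p.1 e.2 = 0 ∧ X e.1 p.2 = 0 with hG
  have hGcard : ∀ e ∈ (Bᶜ ×ˢ T).filter fun p => X p.1 p.2 ≠ 0, g ≤ (G e).card := by
    rintro ⟨i', j⟩ -
    have h1 := edgeCount_univ_right hX B
    have h2 := edgeCount_univ_left hX T
    have h3 := edgeCount_univ_right hX (Finset.univ.filter fun i => X i j ≠ 0)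
    have h4 := edgeCount_univ_left hX (Finset.univ.filter fun j' => X i' j' ≠ 0)
    rw [(mem_sregSet_iff.1 hX).1 j] at h3
    rw [(mem_sregSet_iff.1 hX).2 i'] at h4
    simp only [edgeCount] at h1 h2 h3 h4
    have hsub : ((B ×ˢ Finset.univ).filter fun p => X p.1 p.2 ≠ 0) ⊆
        ((G (i', j) ∪ ((Finset.univ ×ˢ T).filter fun p => X p.1 p.2 ≠ 0)) ∪
        (((Finset.univ.filter fun i => X i j ≠ 0) ×ˢ Finset.univ).filter fun p => X p.1 p.2 ≠ 0)) ∪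
        ((Finset.univ ×ˢ (Finset.univ.filter fun j' => X i' j' ≠ 0)).filter
          fun p => X p.1 p.2 ≠ 0) := by
      rintro ⟨i, j'⟩ h
      simp only [hG, Finset.mem_union, Finset.mem_filter, Finset.mem_product, Finset.mem_univ,
        true_and, and_true] at h ⊢
      tauto
    have h5 := Finset.card_le_card hsub
    have h6 := h5.trans (Finset.card_union_le _ _)
    have h7 := Finset.card_union_le (G (i', j) ∪ ((Finset.univ ×ˢ T).filter fun p => X p.1 p.2 ≠ 0))
      (((Finset.univ.filter fun i => X i j ≠ 0) ×ˢ Finset.univ).filter fun p => X p.1 p.2 ≠ 0)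
    have h8 := Finset.card_union_le (G (i', j)) ((Finset.univ ×ˢ T).filter fun p => X p.1 p.2 ≠ 0)
    omega
  have h1 : edgeCount Bᶜ T X * g ≤
      ∑ e ∈ (Bᶜ ×ˢ T).filter fun p => X p.1 p.2 ≠ 0, (G e).card := by
    rw [edgeCount, ← smul_eq_mul, ← Finset.sum_const]
    exact Finset.sum_le_sum hGcard
  refine h1.trans ?_
  rw [← Finset.card_sigma]
  refine Finset.card_le_card_of_injOn (fun z => (z.2.1, z.1.1, z.1.2, z.2.2)) ?_ ?_
  · rintro ⟨⟨i', j⟩, ⟨i, j'⟩⟩ hz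
    simp only [hG, Finset.coe_sigma, Set.mem_sigma_iff, Finset.mem_coe, Finset.mem_filter,
      Finset.mem_univ, true_and, Finset.mem_product, Finset.mem_compl, Switchable] at hz ⊢
    tauto
  · rintro ⟨⟨i', j⟩, ⟨i, j'⟩⟩ - ⟨⟨i₂', j₂⟩, ⟨i₂, j₂'⟩⟩ - h
    simp only [Prod.mk.injEq] at h
    obtain ⟨rfl, rfl, rfl, rfl⟩ := h
    rfl

theorem switchCount_eq_sum {n : ℕ} (B T : Finset (Fin n)) (X : Matrix (Fin n) (Fin n) SignType) :
    switchCount B T X = ∑ i ∈ B, ∑ i' ∈ Bᶜ,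
      (T.filter fun j => X i j = 0 ∧ X i' j ≠ 0).card *
        (Tᶜ.filter fun j => X i j ≠ 0 ∧ X i' j = 0).card := by
  simp_rw [← Finset.card_product]
  rw [← Finset.sum_product (s := B) (t := Bᶜ)
    (f := fun p => ((T.filter fun j => X p.1 j = 0 ∧ X p.2 j ≠ 0) ×ˢ
      (Tᶜ.filter fun j => X p.1 j ≠ 0 ∧ X p.2 j = 0)).card), ← Finset.card_sigma, switchCount]
  refine Finset.card_bij (fun q _ => ⟨(q.1, q.2.1), (q.2.2.1, q.2.2.2)⟩) ?_ ?_ ?_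
  · rintro ⟨i, i', j, j'⟩ h
    simp only [Switchable, Finset.mem_sigma, Finset.mem_filter, Finset.mem_univ, true_and,
      Finset.mem_product, Finset.mem_compl] at h ⊢
    tauto
  · rintro ⟨i, i', j, j'⟩ - ⟨i₂, i₂', j₂, j₂'⟩ - h
    simpa [and_assoc] using h
  · rintro ⟨⟨i, i'⟩, ⟨j, j'⟩⟩ h
    refine ⟨(i, i', j, j'), ?_, rfl⟩
    simp only [Switchable, Finset.mem_sigma, Finset.mem_filter, Finset.mem_univ, true_and,
      Finset.mem_product, Finset.mem_compl] at h ⊢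
    tauto

theorem le_card_mul_card_of_rows {n d : ℕ} {X : Matrix (Fin n) (Fin n) SignType}
    (hX : X ∈ sregSet n d) (T : Finset (Fin n)) (i i' : Fin n) :
    ((T.filter fun j => X i' j ≠ 0).card : ℝ) ^ 2
        - 3 * (T.filter fun j => X i j ≠ 0).card * (T.filter fun j => X i' j ≠ 0).card ≤
      (T.filter fun j => X i j = 0 ∧ X i' j ≠ 0).card *
        (Tᶜ.filter fun j => X i j ≠ 0 ∧ X i' j = 0).card := by
  set y := (T.filter fun j => X i' j ≠ 0).card
  set x := (T.filter fun j => X i j ≠ 0).card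
  set a := (T.filter fun j => X i j = 0 ∧ X i' j ≠ 0).card with ha
  set c := (Tᶜ.filter fun j => X i j ≠ 0 ∧ X i' j = 0).card with hc
  have h1 : y ≤ a + x := by
    refine (Finset.card_le_card ?_).trans (Finset.card_union_le _ _)
    intro j
    simp only [Finset.mem_union, Finset.mem_filter]
    tauto
  have h2 : a ≤ c + x := by
    have r1 := (mem_sregSet_iff.1 hX).2 i
    have r2 := (mem_sregSet_iff.1 hX).2 i'
    have e1 := Finset.card_filter_add_card_filter_not
      (s := Finset.univ.filter fun j => X i j ≠ 0) (fun j => X i' j ≠ 0)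
    have e2 := Finset.card_filter_add_card_filter_not
      (s := Finset.univ.filter fun j => X i' j ≠ 0) (fun j => X i j ≠ 0)
    simp only [Finset.filter_filter] at e1 e2
    have e3 : (Finset.univ.filter fun j => X i j ≠ 0 ∧ X i' j ≠ 0) =
        (Finset.univ.filter fun j => X i' j ≠ 0 ∧ X i j ≠ 0) := by
      ext j; simp [and_comm]
    have e4 : a ≤ (Finset.univ.filter fun j => X i' j ≠ 0 ∧ ¬ X i j ≠ 0).card := by
      refine Finset.card_le_card fun j => ?_
      simp only [Finset.mem_filter, Finset.mem_univ, true_and]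
      tauto
    have e5 : (Finset.univ.filter fun j => X i j ≠ 0 ∧ ¬ X i' j ≠ 0).card ≤ c + x := by
      refine (Finset.card_le_card ?_).trans (Finset.card_union_le _ _)
      intro j
      simp only [Finset.mem_union, Finset.mem_filter, Finset.mem_univ, true_and, Finset.mem_compl]
      tauto
    rw [e3] at e1
    omega
  have h1' : (y : ℝ) ≤ a + x := by exact_mod_cast h1
  have h2' : (a : ℝ) ≤ c + x := by exact_mod_cast h2
  have hx : (0 : ℝ) ≤ x := by positivity
  have hy : (0 : ℝ) ≤ y := by positivity
  have ha0 : (0 : ℝ) ≤ a := by positivity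
  have hc0 : (0 : ℝ) ≤ c := by positivity
  rcases le_total (3 * (x : ℝ)) y with h | h
  · have : ((y : ℝ) - x) * (y - 2 * x) ≤ a * c := by
      apply mul_le_mul <;> linarith
    nlinarith
  · have : (0 : ℝ) ≤ a * c := by positivity
    nlinarith

theorem le_switchCount {n d : ℕ} {X : Matrix (Fin n) (Fin n) SignType} (hX : X ∈ sregSet n d)
    (B T : Finset (Fin n)) :
    (edgeCount Bᶜ T X : ℝ) * (B.card * edgeCount Bᶜ T X - 3 * n * edgeCount B T X) ≤
      n * switchCount B T X := by
  set y : Fin n → ℝ := fun i => ((T.filter fun j => X i j ≠ 0).card : ℝ) with hy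
  have hk : (edgeCount B T X : ℝ) = ∑ i ∈ B, y i := by
    rw [edgeCount_eq_sum]; push_cast; rfl
  have hY : (edgeCount Bᶜ T X : ℝ) = ∑ i ∈ Bᶜ, y i := by
    rw [edgeCount_eq_sum]; push_cast; rfl
  have h1 : ∑ i ∈ B, ∑ i' ∈ Bᶜ, (y i' ^ 2 - 3 * y i * y i') ≤
      (switchCount B T X : ℝ) := by
    rw [switchCount_eq_sum]
    push_cast
    exact Finset.sum_le_sum fun i _ => Finset.sum_le_sum fun i' _ =>
      le_card_mul_card_of_rows hX T i i'
  have h2 : ∑ i ∈ B, ∑ i' ∈ Bᶜ, (y i' ^ 2 - 3 * y i * y i') =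
      B.card * ∑ i' ∈ Bᶜ, y i' ^ 2 - 3 * edgeCount B T X * edgeCount Bᶜ T X := by
    rw [hk, hY, mul_assoc, Finset.sum_mul_sum, ← nsmul_eq_mul, ← Finset.sum_const,
      Finset.mul_sum, ← Finset.sum_sub_distrib]
    refine Finset.sum_congr rfl fun i _ => ?_
    rw [Finset.sum_sub_distrib, Finset.mul_sum]
    simp only [mul_assoc]
  have h3 : (edgeCount Bᶜ T X : ℝ) ^ 2 ≤ n * ∑ i' ∈ Bᶜ, y i' ^ 2 := by
    rw [hY]
    refine (sq_sum_le_card_mul_sum_sq).trans ?_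
    refine mul_le_mul_of_nonneg_right (Nat.cast_le.2 ?_) (Finset.sum_nonneg fun i _ => sq_nonneg _)
    exact (Finset.card_le_univ Bᶜ).trans_eq (Fintype.card_fin n)
  rw [h2] at h1
  have h4 := mul_le_mul_of_nonneg_left h1 (Nat.cast_nonneg (α := ℝ) n)
  have h5 := mul_le_mul_of_nonneg_left h3 (Nat.cast_nonneg (α := ℝ) B.card)
  clear h1 h2 h3 hk hY
  generalize ∑ i' ∈ Bᶜ, y i' ^ 2 = S at *
  linarith

theorem card_edgeCount_lt_of_large {n d m κ : ℕ} (hn : 0 < n) (hd : 0 < d) (hm : n ≤ 2048 * m)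
    (hκ : 2 ^ 40 * κ ≤ d) (B T : Finset (Fin n)) (hT : m ≤ T.card) (hB : m ≤ 2 * B.card) :
    ((sregSet n d).filter (fun X => edgeCount B T X < κ * n)).card * 2 ^ (κ * n) ≤
      (sregSet n d).card := by
  refine card_edgeCount_lt_mul_le (by positivity) B T _ fun X hX he => ?_
  have h1 := le_switchCount hX B T
  have h2 := edgeCount_add_compl_left B T X
  rw [edgeCount_univ_left hX] at h2
  have h2' : (edgeCount B T X : ℝ) + edgeCount Bᶜ T X = d * T.card := by exact_mod_cast h2
  have he' : (edgeCount B T X : ℝ) + 1 ≤ 2 * (κ * n) := by exact_mod_cast he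
  set e : ℝ := (edgeCount B T X : ℝ)
  set Y : ℝ := (edgeCount Bᶜ T X : ℝ)
  set f : ℝ := (switchCount B T X : ℝ) with hf
  have hm' : (n : ℝ) ≤ 2048 * m := by exact_mod_cast hm
  have hκ' : (2 : ℝ) ^ 40 * κ ≤ d := by exact_mod_cast hκ
  have hT' : (m : ℝ) ≤ T.card := by exact_mod_cast hT
  have hB' : (m : ℝ) ≤ 2 * B.card := by exact_mod_cast hB
  have hn' : (0 : ℝ) < n := by exact_mod_cast hn
  have hd' : (0 : ℝ) < d := by exact_mod_cast hd
  have hκn : (2 : ℝ) ^ 40 * (κ * n) ≤ d * n := by nlinarith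
  have hdT : (d : ℝ) * n ≤ 2 ^ 11 * (d * T.card) := by nlinarith
  have hdn : (0 : ℝ) < d * n := by positivity
  have hY : (d : ℝ) * n ≤ 2 ^ 12 * Y := by norm_num at *; linarith
  have hb : (n : ℝ) ≤ 2 ^ 12 * B.card := by norm_num at *; linarith
  have hbY : (d : ℝ) * n ^ 2 ≤ 2 ^ 24 * (B.card * Y) := by
    have := mul_le_mul hb hY hdn.le (by positivity)
    nlinarith
  have hen : 3 * n * e ≤ 6 * (κ * n ^ 2) := by nlinarith
  have hκnn : (2 : ℝ) ^ 40 * (κ * n ^ 2) ≤ d * n ^ 2 := by nlinarith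
  have hdnn : (0 : ℝ) < d * n ^ 2 := by positivity
  have hdiff : (d : ℝ) * n ^ 2 ≤ 2 ^ 25 * (B.card * Y - 3 * n * e) := by
    norm_num at *; linarith
  have hprod : ((d : ℝ) * n) * (d * n ^ 2) ≤ 2 ^ 37 * (n * f) := by
    have := mul_le_mul hY hdiff hdnn.le (by positivity)
    nlinarith
  have hfl : ((d : ℝ) * n) * (d * n) ≤ 2 ^ 37 * f := by
    refine le_of_mul_le_mul_left ?_ hn'
    nlinarith
  have hgoal : 2 * ((e + 1) * (d * n)) ≤ f := by
    have h3 : 2 ^ 40 * ((e + 1) * (d * n)) ≤ 2 * (d * n) * (d * n) := by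
      have := mul_le_mul_of_nonneg_right he' hdn.le
      nlinarith
    norm_num at *; linarith
  rw [← Nat.cast_le (α := ℝ)]
  push_cast
  exact hgoal

theorem card_edgeCount_eq_zero_of_small {n d : ℕ} (hn : 2 ≤ n) (hd : 0 < d) (hdn : 8 * d ≤ n)
    (R T : Finset (Fin n)) (hT : 16 * T.card ≤ n) (hR : 8 * R.card ≤ n) :
    ((sregSet n d).filter (fun X => edgeCount Rᶜ T X = 0)).card * 2 ^ (T.card * (d / 8)) ≤
      (sregSet n d).card := by
  refine card_edgeCount_eq_mul_le (by positivity) Rᶜ T _ (fun X hX he => ?_) _ 0 (zero_add _)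
  have h2 := edgeCount_add_compl_left Rᶜ T X
  rw [edgeCount_univ_left hX] at h2
  have hBc : Rᶜ.card = n - R.card := by rw [Finset.card_compl, Fintype.card_fin]
  have h1 : edgeCount Rᶜᶜ T X * (d * (n / 2)) ≤ switchCount Rᶜ T X := by
    refine mul_le_switchCount hX _ _ ?_
    have : n / 2 + T.card + 2 * d ≤ Rᶜ.card := by omega
    calc d * (n / 2) + d * T.card + 2 * (d * d) = d * (n / 2 + T.card + 2 * d) := by ring
      _ ≤ _ := Nat.mul_le_mul_left _ this
  refine le_trans ?_ h1
  have h3 : 8 * (T.card * (d / 8)) ≤ d * T.card := by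
    have := Nat.mul_div_le d 8
    nlinarith
  have h4 : 7 * (edgeCount Rᶜ T X + 1) ≤ edgeCount Rᶜᶜ T X := by omega
  have h5 : 2 * n ≤ 7 * (n / 2) := by omega
  calc 2 * ((edgeCount Rᶜ T X + 1) * (d * n)) = (edgeCount Rᶜ T X + 1) * d * (2 * n) := by ring
    _ ≤ (edgeCount Rᶜ T X + 1) * d * (7 * (n / 2)) := Nat.mul_le_mul_left _ h5
    _ = 7 * (edgeCount Rᶜ T X + 1) * (d * (n / 2)) := by ring
    _ ≤ _ := Nat.mul_le_mul_right _ h4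

theorem one_add_pow_sub_one_le {w : ℝ} {n : ℕ} (hw : 0 ≤ w) (hnw : n * w ≤ 1) :
    (1 + w) ^ n - 1 ≤ 2 * (n * w) := by
  have h0 : 0 ≤ n * w := by positivity
  have h1 : (1 + w) ^ n ≤ Real.exp (n * w) := by
    rw [Real.exp_nat_mul]
    exact pow_le_pow_left₀ (by positivity) (by linarith [Real.add_one_le_exp w]) n
  have h2 := Real.abs_exp_sub_one_le (x := n * w) (by rwa [abs_of_nonneg h0])
  rw [abs_of_nonneg h0] at h2
  linarith [le_abs_self (Real.exp (n * w) - 1)]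

theorem sum_pow_card_finset (n : ℕ) (w : ℝ) :
    ∑ T : Finset (Fin n), w ^ T.card = (1 + w) ^ n := by
  have := Finset.sum_pow_mul_eq_add_pow w 1 (Finset.univ : Finset (Fin n))
  rw [Finset.powerset_univ, Finset.card_univ, Fintype.card_fin, add_comm] at this
  simpa using this

theorem card_finset_card_le {n L : ℕ} (hL : n ≤ 2 ^ L) (s : ℕ) :
    ((Finset.univ.filter fun R : Finset (Fin n) => R.card ≤ s).card : ℝ) ≤ 3 * 2 ^ (L * s) := by
  set w : ℝ := (2 ^ L)⁻¹ with hw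
  have hw0 : 0 < w := by positivity
  have hw1 : w ≤ 1 := inv_le_one_of_one_le₀ (one_le_pow₀ (by norm_num))
  have hnw : n * w ≤ 1 := by
    rw [hw, mul_inv_le_iff₀ (by positivity), one_mul]
    exact_mod_cast hL
  have h1 := one_add_pow_sub_one_le hw0.le hnw
  have h2 : ((Finset.univ.filter fun R : Finset (Fin n) => R.card ≤ s).card : ℝ) * w ^ s ≤
      ∑ T : Finset (Fin n), w ^ T.card := by
    rw [← nsmul_eq_mul, ← Finset.sum_const]
    refine (Finset.sum_le_sum fun R hR => ?_).trans
      (Finset.sum_le_univ_sum_of_nonneg fun T => by positivity)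
    exact pow_le_pow_of_le_one hw0.le hw1 (Finset.mem_filter.1 hR).2
  rw [sum_pow_card_finset, hw, inv_pow, mul_inv_le_iff₀ (by positivity), ← pow_mul, ← hw] at h2
  refine h2.trans ?_
  gcongr
  linarith

/-- The rows with a nonzero entry in some column of `T`. -/
def rowNbhd {n : ℕ} (X : Matrix (Fin n) (Fin n) SignType) (T : Finset (Fin n)) : Finset (Fin n) :=
  Finset.univ.filter fun i => ∃ j ∈ T, X i j ≠ 0

/-- Small sets of columns have large neighbourhoods. -/
def Expands {n : ℕ} (m L : ℕ) (X : Matrix (Fin n) (Fin n) SignType) : Prop :=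
  ∀ T : Finset (Fin n), T.Nonempty → T.card ≤ m →
    4 * (L * T.card) ≤ (rowNbhd X T).card ∨ n ≤ 8 * (rowNbhd X T).card

/-- Every large rectangle contains many nonzero entries. -/
def Spread {n : ℕ} (m κ : ℕ) (X : Matrix (Fin n) (Fin n) SignType) : Prop :=
  ∀ B T : Finset (Fin n), m ≤ T.card → m ≤ 2 * B.card → κ * n ≤ edgeCount B T X

theorem card_not_spread_mul_le {n d m κ : ℕ} (hn : 0 < n) (hd : 0 < d) (hm : n ≤ 2048 * m)
    (hκ : 2 ^ 40 * κ ≤ d) :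
    ((sregSet n d).filter fun X => ¬ Spread m κ X).card * 2 ^ (κ * n) ≤
      4 ^ n * (sregSet n d).card := by
  set I := (Finset.univ : Finset (Finset (Fin n) × Finset (Fin n))).filter
    fun p => m ≤ p.2.card ∧ m ≤ 2 * p.1.card with hI
  have h1 : ((sregSet n d).filter fun X => ¬ Spread m κ X) ⊆
      I.biUnion fun p => (sregSet n d).filter fun X => edgeCount p.1 p.2 X < κ * n := by
    intro X hX
    simp only [Spread, Finset.mem_filter, not_forall, not_le] at hX
    obtain ⟨hX, B, T, hT, hB, h⟩ := hX
    simp only [hI, Finset.mem_biUnion, Finset.mem_filter, Finset.mem_univ, true_and]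
    exact ⟨(B, T), ⟨hT, hB⟩, hX, h⟩
  calc _ ≤ (∑ p ∈ I, ((sregSet n d).filter fun X => edgeCount p.1 p.2 X < κ * n).card)
        * 2 ^ (κ * n) :=
        Nat.mul_le_mul_right _ ((Finset.card_le_card h1).trans Finset.card_biUnion_le)
    _ = ∑ p ∈ I, ((sregSet n d).filter fun X => edgeCount p.1 p.2 X < κ * n).card
        * 2 ^ (κ * n) := Finset.sum_mul _ _ _
    _ ≤ ∑ p ∈ I, (sregSet n d).card := Finset.sum_le_sum fun p hp => by
        obtain ⟨hp1, hp2⟩ := (Finset.mem_filter.1 hp).2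
        exact card_edgeCount_lt_of_large hn hd hm hκ _ _ hp1 hp2
    _ = I.card * (sregSet n d).card := by rw [Finset.sum_const, smul_eq_mul]
    _ ≤ 4 ^ n * (sregSet n d).card := by
        refine Nat.mul_le_mul_right _ ((Finset.card_le_univ _).trans_eq ?_)
        simp [← mul_pow]

theorem edgeCount_compl_rowNbhd {n : ℕ} (X : Matrix (Fin n) (Fin n) SignType)
    (T : Finset (Fin n)) : edgeCount (rowNbhd X T)ᶜ T X = 0 := by
  rw [edgeCount, Finset.card_eq_zero, Finset.filter_eq_empty_iff]
  rintro ⟨i, j⟩ h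
  simp only [rowNbhd, Finset.mem_product, Finset.mem_compl, Finset.mem_filter, Finset.mem_univ,
    true_and, not_exists, not_and] at h
  exact h.1 j h.2

theorem le_card_rowNbhd {n d : ℕ} {X : Matrix (Fin n) (Fin n) SignType} (hX : X ∈ sregSet n d)
    {T : Finset (Fin n)} (hT : T.Nonempty) : d ≤ (rowNbhd X T).card := by
  obtain ⟨j, hj⟩ := hT
  rw [← (mem_sregSet_iff.1 hX).1 j]
  refine Finset.card_le_card fun i hi => ?_
  simp only [rowNbhd, Finset.mem_filter, Finset.mem_univ, true_and] at hi ⊢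
  exact ⟨j, hj, hi⟩

theorem card_not_expands_le {n d m L : ℕ} (hn : 2 ≤ n) (hd : 0 < d) (hm : 16 * m ≤ n)
    (hL : n ≤ 2 ^ L) (hdL : 4 * (L * L) + 2 * L ≤ d / 8) :
    (((sregSet n d).filter fun X => ¬ Expands m L X).card : ℝ) ≤
      6 / n * (sregSet n d).card := by
  have hn0 : (0 : ℝ) < n := by exact_mod_cast (by omega : 0 < n)
  by_cases hdn : n < 8 * d
  · have : ((sregSet n d).filter fun X => ¬ Expands m L X) = ∅ := by
      rw [Finset.filter_eq_empty_iff]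
      intro X hX
      rw [not_not]
      intro T hT _
      right
      have := le_card_rowNbhd hX hT
      omega
    rw [this]
    simp only [Finset.card_empty, Nat.cast_zero]
    positivity
  push Not at hdn
  set w : ℝ := 2 ^ (4 * (L * L)) / 2 ^ (d / 8) with hw
  have hw0 : 0 < w := by positivity
  set J := (Finset.univ : Finset (Finset (Fin n))).filter fun T => T.Nonempty ∧ T.card ≤ m with hJ
  set I : Finset (Fin n) → Finset (Finset (Fin n)) := fun T =>
    Finset.univ.filter fun R => R.card ≤ 4 * (L * T.card) ∧ 8 * R.card ≤ n with hI
  set bad : Finset (Fin n) → Finset (Fin n) → Finset (Matrix (Fin n) (Fin n) SignType) := fun T R =>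
    (sregSet n d).filter fun X => edgeCount Rᶜ T X = 0 with hbad
  have h1 : ((sregSet n d).filter fun X => ¬ Expands m L X) ⊆
      J.biUnion fun T => (I T).biUnion fun R => bad T R := by
    intro X hX
    simp only [Expands, Finset.mem_filter, not_forall, not_or, not_le] at hX
    obtain ⟨hX, T, hT, hTm, h3, h4⟩ := hX
    simp only [hJ, hI, hbad, Finset.mem_biUnion, Finset.mem_filter, Finset.mem_univ, true_and]
    exact ⟨T, ⟨hT, hTm⟩, rowNbhd X T, ⟨h3.le, h4.le⟩, hX, edgeCount_compl_rowNbhd X T⟩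
  have h2 : (((sregSet n d).filter fun X => ¬ Expands m L X).card : ℝ) ≤
      ∑ T ∈ J, ∑ R ∈ I T, ((bad T R).card : ℝ) := by
    have := ((Finset.card_le_card h1).trans Finset.card_biUnion_le).trans
      (Finset.sum_le_sum fun T _ => Finset.card_biUnion_le)
    exact_mod_cast this
  have h3 : ∀ T ∈ J, ∑ R ∈ I T, ((bad T R).card : ℝ) ≤ 3 * w ^ T.card * (sregSet n d).card := by
    intro T hT
    obtain ⟨-, hTm⟩ := (Finset.mem_filter.1 hT).2
    have h4 : ∀ R ∈ I T, ((bad T R).card : ℝ) ≤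
        (sregSet n d).card / 2 ^ (T.card * (d / 8)) := by
      intro R hR
      obtain ⟨-, hR⟩ := (Finset.mem_filter.1 hR).2
      rw [le_div_iff₀ (by positivity)]
      exact_mod_cast card_edgeCount_eq_zero_of_small hn hd hdn R T (by omega) hR
    refine (Finset.sum_le_sum h4).trans ?_
    rw [Finset.sum_const, nsmul_eq_mul]
    have h5 : ((I T).card : ℝ) ≤ 3 * 2 ^ (L * (4 * (L * T.card))) := by
      refine le_trans ?_ (card_finset_card_le hL _)
      refine Nat.cast_le.2 (Finset.card_le_card fun R hR => ?_)
      exact Finset.mem_filter.2 ⟨Finset.mem_univ _, (Finset.mem_filter.1 hR).2.1⟩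
    calc _ ≤ 3 * (2 : ℝ) ^ (L * (4 * (L * T.card))) *
          ((sregSet n d).card / 2 ^ (T.card * (d / 8))) := by gcongr
      _ = _ := by
        rw [hw, div_pow, ← pow_mul, ← pow_mul,
          show L * (4 * (L * T.card)) = 4 * (L * L) * T.card by ring, mul_comm (d / 8)]
        ring
  have hwn : n * w ≤ 1 / n := by
    have e1 : w ≤ 1 / (2 ^ (2 * L)) := by
      rw [hw, div_le_div_iff₀ (by positivity) (by positivity), one_mul, ← pow_add]
      exact pow_le_pow_right₀ (by norm_num) hdL
    have e2 : (n : ℝ) ≤ 2 ^ L := by exact_mod_cast hL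
    have e3 : (n : ℝ) * n ≤ 2 ^ (2 * L) := by
      rw [two_mul, pow_add]; gcongr
    rw [le_div_iff₀ hn0]
    calc (n : ℝ) * w * n = (n * n) * w := by ring
      _ ≤ 2 ^ (2 * L) * (1 / (2 ^ (2 * L))) := by gcongr
      _ = 1 := by field_simp
  have hwn1 : n * w ≤ 1 := hwn.trans (by
    rw [div_le_one hn0]; exact_mod_cast (by omega : 1 ≤ n))
  have h6 : ∑ T ∈ J, w ^ T.card ≤ 2 * (n * w) := by
    refine le_trans ?_ (one_add_pow_sub_one_le hw0.le hwn1)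
    rw [← sum_pow_card_finset, ← Finset.sum_erase_add _ _ (Finset.mem_univ (∅ : Finset (Fin n)))]
    simp only [Finset.card_empty, pow_zero, add_sub_cancel_right]
    refine Finset.sum_le_sum_of_subset_of_nonneg ?_ fun _ _ _ => by positivity
    intro T hT
    exact Finset.mem_erase.2 ⟨(Finset.mem_filter.1 hT).2.1.ne_empty, Finset.mem_univ _⟩
  calc _ ≤ _ := h2
    _ ≤ ∑ T ∈ J, 3 * w ^ T.card * (sregSet n d).card := Finset.sum_le_sum h3
    _ = 3 * (∑ T ∈ J, w ^ T.card) * (sregSet n d).card := by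
      rw [Finset.mul_sum, Finset.sum_mul]
    _ ≤ 3 * (2 * (1 / n)) * (sregSet n d).card := by
      gcongr
      linarith
    _ = _ := by ring

theorem card_not_expands_transpose {n d m L : ℕ} :
    ((sregSet n d).filter fun X => ¬ Expands m L X.transpose).card =
      ((sregSet n d).filter fun X => ¬ Expands m L X).card := by
  refine Finset.card_bij (fun X _ => X.transpose) ?_ ?_ ?_
  · intro X hX
    rw [Finset.mem_filter] at hX ⊢
    exact ⟨transpose_mem_sregSet hX.1, hX.2⟩
  · intro X _ Y _ h
    exact Matrix.transpose_injective h
  · intro X hX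
    rw [Finset.mem_filter] at hX
    exact ⟨X.transpose, Finset.mem_filter.2 ⟨transpose_mem_sregSet hX.1, hX.2⟩, rfl⟩

/-- Multiply the entries of `X` by the signs `ξ`. -/
def signed {n : ℕ} (ξ : Fin n → Fin n → Bool) (X : Matrix (Fin n) (Fin n) SignType) :
    Matrix (Fin n) (Fin n) SignType :=
  fun i j => boolSign (ξ i j) * X i j

theorem signed_signed {n : ℕ} (ξ : Fin n → Fin n → Bool) (X : Matrix (Fin n) (Fin n) SignType) :
    signed ξ (signed ξ X) = X := by
  funext i j
  rw [signed, signed, ← mul_assoc, boolSign_mul_self, one_mul]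

theorem signed_mem_sregSet {n d : ℕ} (ξ : Fin n → Fin n → Bool)
    {X : Matrix (Fin n) (Fin n) SignType} (hX : X ∈ sregSet n d) :
    signed ξ X ∈ sregSet n d := by
  rw [mem_sregSet_iff] at hX ⊢
  simpa [signed, boolSign_ne_zero] using hX

theorem card_filter_sregSet_mul {n d : ℕ} (p : Matrix (Fin n) (Fin n) SignType → Prop) :
    ((sregSet n d).filter p).card * (2 ^ n) ^ n =
      ∑ X ∈ sregSet n d, (Finset.univ.filter fun ξ => p (signed ξ X)).card := by
  simp_rw [Finset.card_filter]
  rw [Finset.sum_comm]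
  have : ∀ ξ : Fin n → Fin n → Bool, (∑ X ∈ sregSet n d, if p (signed ξ X) then 1 else 0) =
      ∑ X ∈ sregSet n d, if p X then 1 else 0 := fun ξ =>
    Finset.sum_nbij' (signed ξ) (signed ξ) (fun X hX => signed_mem_sregSet ξ hX)
      (fun X hX => signed_mem_sregSet ξ hX) (fun X _ => signed_signed ξ X)
      (fun X _ => signed_signed ξ X) (fun _ _ => rfl)
  rw [Finset.sum_congr rfl fun ξ _ => this ξ, Finset.sum_const, smul_eq_mul, mul_comm]
  congr 1
  simp

theorem two_mul_card_signed_sum_zmod_le {n : ℕ} (a : Fin n → ZMod 3) (ha : ∃ j, a j ≠ 0) :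
    2 * (Finset.univ.filter fun s : Fin n → Bool =>
      ∑ j, (boolSign (s j) : ZMod 3) * a j = 0).card ≤ 2 ^ n := by
  obtain ⟨j, hj⟩ := ha
  set F := Finset.univ.filter fun s : Fin n → Bool =>
      ∑ j, (boolSign (s j) : ZMod 3) * a j = 0 with hF
  set flip : (Fin n → Bool) → (Fin n → Bool) := fun s => Function.update s j (!s j) with hflip
  have hinv : Function.Involutive flip := by
    intro s
    simp [hflip]
  have hdisj : Disjoint F (F.image flip) := by
    rw [Finset.disjoint_left]
    intro s hs hs'
    obtain ⟨t, ht, rfl⟩ := Finset.mem_image.1 hs'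
    simp only [hF, Finset.mem_filter, Finset.mem_univ, true_and] at hs ht
    rw [← Finset.add_sum_erase _ _ (Finset.mem_univ j)] at hs ht
    have h1 : ∑ i ∈ Finset.univ.erase j, (boolSign (flip t i) : ZMod 3) * a i =
        ∑ i ∈ Finset.univ.erase j, (boolSign (t i) : ZMod 3) * a i := by
      refine Finset.sum_congr rfl fun i hi => ?_
      rw [hflip]
      simp only
      rw [Function.update_of_ne (Finset.ne_of_mem_erase hi)]
    have h2 : flip t j = !t j := by simp [hflip]
    rw [h1, h2] at hs
    have h3 := hs.trans ht.symm
    rw [add_left_inj] at h3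
    generalize a j = x at h3 hj
    generalize t j = b at h3
    revert h3 hj
    cases b <;> revert x <;> decide
  calc 2 * F.card = F.card + (F.image flip).card := by
        rw [Finset.card_image_of_injective _ hinv.injective, two_mul]
    _ = (F ∪ F.image flip).card := (Finset.card_union_of_disjoint hdisj).symm
    _ ≤ Fintype.card (Fin n → Bool) := Finset.card_le_univ _
    _ = 2 ^ n := by simp

theorem card_signed_null_le {n : ℕ} (X : Matrix (Fin n) (Fin n) SignType) (u : Fin n → ZMod 3) :
    ((Finset.univ.filter fun ξ : Fin n → Fin n → Bool =>
      ∀ i, ∑ j, (signed ξ X i j : ZMod 3) * u j = 0).card : ℝ) ≤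
      (2 ^ n) ^ n * (1 / 2) ^ (rowNbhd X (Finset.univ.filter fun j => u j ≠ 0)).card := by
  set N := rowNbhd X (Finset.univ.filter fun j => u j ≠ 0) with hN
  set t : Fin n → Finset (Fin n → Bool) := fun i => Finset.univ.filter fun s : Fin n → Bool =>
      ∑ j, (boolSign (s j) : ZMod 3) * ((X i j : ZMod 3) * u j) = 0 with ht
  have h1 : (Finset.univ.filter fun ξ : Fin n → Fin n → Bool =>
      ∀ i, ∑ j, (signed ξ X i j : ZMod 3) * u j = 0) = Fintype.piFinset t := by
    ext ξ
    simp only [ht, signed, Finset.mem_filter, Finset.mem_univ, true_and, Fintype.mem_piFinset,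
      SignType.coe_mul, mul_assoc]
  rw [h1, Fintype.card_piFinset]
  push_cast
  have h2 : ∀ i, ((t i).card : ℝ) ≤ 2 ^ n * if i ∈ N then 1 / 2 else 1 := by
    intro i
    split_ifs with hi
    · have : 2 * (t i).card ≤ 2 ^ n := by
        refine two_mul_card_signed_sum_zmod_le _ ?_
        simp only [hN, rowNbhd, Finset.mem_filter, Finset.mem_univ, true_and] at hi
        obtain ⟨j, hu, hX⟩ := hi
        refine ⟨j, mul_ne_zero ?_ hu⟩
        revert hX
        generalize X i j = x
        revert x
        decide
      have : (2 : ℝ) * (t i).card ≤ 2 ^ n := by exact_mod_cast this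
      linarith
    · have : (t i).card ≤ 2 ^ n := (Finset.card_le_univ _).trans_eq (by simp)
      rw [mul_one]
      exact_mod_cast this
  refine (Finset.prod_le_prod (fun i _ => by positivity) fun i _ => h2 i).trans_eq ?_
  rw [Finset.prod_mul_distrib, Finset.prod_const, Finset.card_univ, Fintype.card_fin,
    Finset.prod_ite_mem, Finset.univ_inter, Finset.prod_const]

theorem sum_pow_card_support (n : ℕ) (w : ℝ) :
    ∑ u : Fin n → ZMod 3, w ^ (Finset.univ.filter fun j => u j ≠ 0).card = (1 + 2 * w) ^ n := by
  have h1 : ∀ u : Fin n → ZMod 3, w ^ (Finset.univ.filter fun j => u j ≠ 0).card =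
      ∏ j, if u j ≠ 0 then w else 1 := by
    intro u
    rw [← Finset.prod_const, Finset.prod_filter]
  have h2 : ∑ x : ZMod 3, (if x ≠ 0 then w else 1) = 1 + 2 * w := by
    rw [show (Finset.univ : Finset (ZMod 3)) = {0, 1, 2} from by decide]
    rw [Finset.sum_insert (by decide), Finset.sum_insert (by decide), Finset.sum_singleton,
      if_neg (by decide), if_pos (by decide), if_pos (by decide)]
    ring
  simp_rw [h1]
  have h3 := Finset.prod_univ_sum (fun _ : Fin n => (Finset.univ : Finset (ZMod 3)))
    (fun _ x => if x ≠ 0 then w else 1)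
  rw [Fintype.piFinset_univ] at h3
  rw [← h3, h2, Finset.prod_const, Finset.card_univ, Fintype.card_fin]

theorem entropy_bound {n m : ℕ} (hn : 0 < n) (hm : 1024 * m ≤ n) :
    (64 : ℝ) ^ m * (1 + 2 * (1 / 64)) ^ n * (1 / 2) ^ (n / 8) ≤ 20 / n := by
  have hl1 := Real.log_two_gt_d9
  have hl2 := Real.log_two_lt_d9
  have hn0 : (0 : ℝ) < n := by exact_mod_cast hn
  have hm' : (1024 : ℝ) * m ≤ n := by exact_mod_cast hm
  have h8 : (n : ℝ) ≤ 8 * ((n / 8 : ℕ) : ℝ) + 7 := by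
    exact_mod_cast (by omega : n ≤ 8 * (n / 8) + 7)
  have e1 : (64 : ℝ) ^ m = Real.exp (m * (6 * Real.log 2)) := by
    rw [Real.exp_nat_mul, mul_comm, Real.exp_mul, Real.exp_log (by norm_num)]
    norm_num
  have e2 : (1 + 2 * (1 / 64) : ℝ) ^ n ≤ Real.exp (n * (1 / 32)) := by
    rw [Real.exp_nat_mul]
    refine pow_le_pow_left₀ (by norm_num) ?_ n
    have := Real.add_one_le_exp (1 / 32 : ℝ)
    linarith
  have e3 : (1 / 2 : ℝ) ^ (n / 8) = Real.exp (((n / 8 : ℕ) : ℝ) * (-Real.log 2)) := by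
    rw [Real.exp_nat_mul, Real.exp_neg, Real.exp_log (by norm_num)]
    norm_num
  have e4 : Real.exp (-(n / 20 - 7 / 10)) ≤ 20 / n := by
    rw [Real.exp_neg, inv_le_comm₀ (Real.exp_pos _) (by positivity), inv_div]
    have := Real.add_one_le_exp ((n : ℝ) / 20 - 7 / 10)
    linarith
  rw [e1, e3]
  refine le_trans ?_ e4
  calc _ ≤ Real.exp (m * (6 * Real.log 2)) * Real.exp (n * (1 / 32)) *
        Real.exp (((n / 8 : ℕ) : ℝ) * (-Real.log 2)) := by gcongr
    _ = Real.exp (m * (6 * Real.log 2) + n * (1 / 32) + ((n / 8 : ℕ) : ℝ) * (-Real.log 2)) := by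
      rw [Real.exp_add, Real.exp_add]
    _ ≤ _ := by
      apply Real.exp_le_exp.2
      have a1 : (m : ℝ) * (6 * Real.log 2) ≤ n / 1024 * (6 * 0.6931471808) := by
        apply mul_le_mul <;> linarith
      have a2 : ((n - 7 : ℝ) / 8) * 0.6931471803 ≤ ((n / 8 : ℕ) : ℝ) * Real.log 2 := by
        have : (0:ℝ) ≤ ((n / 8 : ℕ) : ℝ) := by positivity
        nlinarith
      linarith

/-- `ξ ∘ X` has a nonzero null vector modulo `3` with at most `m` nonzero coordinates. -/
def HasSparseNull {n : ℕ} (m : ℕ) (Z : Matrix (Fin n) (Fin n) SignType) : Prop :=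
  ∃ u : Fin n → ZMod 3, u ≠ 0 ∧ (Finset.univ.filter fun j => u j ≠ 0).card ≤ m ∧
    ∀ i, ∑ j, (Z i j : ZMod 3) * u j = 0

theorem card_hasSparseNull_le {n m L : ℕ} (hn : 2 ≤ n) (hm : 1024 * m ≤ n) (hL : n ≤ 2 ^ L)
    {X : Matrix (Fin n) (Fin n) SignType} (hX : Expands m L X) :
    ((Finset.univ.filter fun ξ => HasSparseNull m (signed ξ X)).card : ℝ) ≤
      24 / n * (2 ^ n) ^ n := by
  have hn0 : (0 : ℝ) < n := by exact_mod_cast (by omega : 0 < n)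
  have hn1 : (1 : ℝ) ≤ n := by exact_mod_cast (by omega : 1 ≤ n)
  set S : (Fin n → ZMod 3) → ℕ := fun u => (Finset.univ.filter fun j => u j ≠ 0).card with hS
  set w : ℝ := (1 / 2) ^ (4 * L) with hw
  have hw0 : 0 < w := by positivity
  set J := (Finset.univ : Finset (Fin n → ZMod 3)).filter fun u => u ≠ 0 ∧ S u ≤ m with hJ
  have h1 : (Finset.univ.filter fun ξ => HasSparseNull m (signed ξ X)) ⊆
      J.biUnion fun u => Finset.univ.filter fun ξ : Fin n → Fin n → Bool =>
      ∀ i, ∑ j, (signed ξ X i j : ZMod 3) * u j = 0 := by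
    intro ξ hξ
    obtain ⟨u, hu, hum, h⟩ := (Finset.mem_filter.1 hξ).2
    simp only [hJ, Finset.mem_biUnion, Finset.mem_filter, Finset.mem_univ, true_and]
    exact ⟨u, ⟨hu, hum⟩, h⟩
  have h2 : ((Finset.univ.filter fun ξ => HasSparseNull m (signed ξ X)).card : ℝ) ≤
      ∑ u ∈ J, ((Finset.univ.filter fun ξ : Fin n → Fin n → Bool =>
        ∀ i, ∑ j, (signed ξ X i j : ZMod 3) * u j = 0).card : ℝ) := by
    exact_mod_cast (Finset.card_le_card h1).trans Finset.card_biUnion_le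
  have h3 : ∀ u ∈ J, ((Finset.univ.filter fun ξ : Fin n → Fin n → Bool =>
      ∀ i, ∑ j, (signed ξ X i j : ZMod 3) * u j = 0).card : ℝ) ≤
      (2 ^ n) ^ n * (w ^ S u + 64 ^ m * (1 / 2) ^ (n / 8) * (1 / 64) ^ S u) := by
    intro u hu
    obtain ⟨hu0, hum⟩ := (Finset.mem_filter.1 hu).2
    refine (card_signed_null_le X u).trans ?_
    gcongr
    have hne : (Finset.univ.filter fun j => u j ≠ 0).Nonempty := by
      obtain ⟨j, hj⟩ := Function.ne_iff.1 hu0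
      exact ⟨j, Finset.mem_filter.2 ⟨Finset.mem_univ _, hj⟩⟩
    rcases hX _ hne hum with h | h
    · have : ((1 : ℝ) / 2) ^ (rowNbhd X (Finset.univ.filter fun j => u j ≠ 0)).card ≤ w ^ S u := by
        rw [hw, ← pow_mul, mul_assoc]
        exact pow_le_pow_of_le_one (by norm_num) (by norm_num) h
      have h0 : (0 : ℝ) ≤ 64 ^ m * (1 / 2) ^ (n / 8) * (1 / 64) ^ S u := by positivity
      linarith
    · have : ((1 : ℝ) / 2) ^ (rowNbhd X (Finset.univ.filter fun j => u j ≠ 0)).card ≤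
          (1 / 2) ^ (n / 8) :=
        pow_le_pow_of_le_one (by norm_num) (by norm_num) (by omega)
      have h4 : (1 : ℝ) ≤ 64 ^ m * (1 / 64) ^ S u := by
        rw [one_div, inv_pow, le_mul_inv_iff₀ (by positivity), one_mul]
        exact pow_le_pow_right₀ (by norm_num) hum
      have h0 : (0 : ℝ) ≤ w ^ S u := by positivity
      have h5 : (0 : ℝ) ≤ (1 / 2) ^ (n / 8) := by positivity
      nlinarith
  have hnw : n * (2 * w) ≤ 2 / n := by
    have e2 : (n : ℝ) ≤ 2 ^ L := by exact_mod_cast hL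
    have e3 : (n : ℝ) * n ≤ 2 ^ (4 * L) := by
      calc (n : ℝ) * n ≤ 2 ^ L * 2 ^ L := by gcongr
        _ ≤ _ := by rw [← pow_add]; exact pow_le_pow_right₀ (by norm_num) (by omega)
    rw [le_div_iff₀ hn0, hw, one_div, inv_pow]
    have : (n : ℝ) * n * (2 ^ (4 * L))⁻¹ ≤ 1 := by
      rwa [mul_inv_le_iff₀ (by positivity), one_mul]
    linarith
  have hnw1 : n * (2 * w) ≤ 1 := hnw.trans (by
    rw [div_le_one hn0]; exact_mod_cast hn)
  have h6 : ∑ u ∈ J, w ^ S u ≤ 4 / n := by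
    have h7 : ∑ u ∈ J, w ^ S u ≤ 2 * (n * (2 * w)) := by
      refine le_trans ?_ (one_add_pow_sub_one_le (by positivity) hnw1)
      rw [← sum_pow_card_support, ← Finset.sum_erase_add _ _ (Finset.mem_univ (0 : Fin n → ZMod 3))]
      simp only [Pi.zero_apply, ne_eq, not_true_eq_false, Finset.filter_false, Finset.card_empty,
        pow_zero, add_sub_cancel_right]
      refine Finset.sum_le_sum_of_subset_of_nonneg ?_ fun _ _ _ => by positivity
      intro u hu
      exact Finset.mem_erase.2 ⟨(Finset.mem_filter.1 hu).2.1, Finset.mem_univ _⟩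
    refine h7.trans ?_
    calc 2 * (n * (2 * w)) ≤ 2 * (2 / n) := by gcongr
      _ = _ := by ring
  have h8 : ∑ u ∈ J, ((1 : ℝ) / 64) ^ S u ≤ (1 + 2 * (1 / 64)) ^ n := by
    rw [← sum_pow_card_support]
    exact Finset.sum_le_univ_sum_of_nonneg fun _ => by positivity
  have h9 := entropy_bound (by omega : 0 < n) hm
  calc _ ≤ _ := h2
    _ ≤ _ := Finset.sum_le_sum h3
    _ = (2 ^ n) ^ n * (∑ u ∈ J, w ^ S u +
        64 ^ m * (1 / 2) ^ (n / 8) * ∑ u ∈ J, (1 / 64) ^ S u) := by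
      rw [← Finset.mul_sum, Finset.sum_add_distrib, ← Finset.mul_sum]
    _ ≤ (2 ^ n) ^ n * (4 / n + 64 ^ m * (1 / 2) ^ (n / 8) * (1 + 2 * (1 / 64)) ^ n) := by gcongr
    _ ≤ (2 ^ n) ^ n * (4 / n + 20 / n) := by
      gcongr
      linarith
    _ = _ := by ring

theorem card_hasSparseNull_transpose {n m : ℕ} (X : Matrix (Fin n) (Fin n) SignType) :
    (Finset.univ.filter fun ξ => HasSparseNull m (signed ξ X).transpose).card =
      (Finset.univ.filter fun ξ => HasSparseNull m (signed ξ X.transpose)).card :=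
  Finset.card_nbij' (fun ξ i j => ξ j i) (fun ξ i j => ξ j i)
    (fun _ hξ => Finset.mem_coe.2 (Finset.mem_filter.2
      ⟨Finset.mem_univ _, (Finset.mem_filter.1 (Finset.mem_coe.1 hξ)).2⟩))
    (fun _ hξ => Finset.mem_coe.2 (Finset.mem_filter.2
      ⟨Finset.mem_univ _, (Finset.mem_filter.1 (Finset.mem_coe.1 hξ)).2⟩)) (fun _ _ => rfl) (fun _ _ => rfl)

theorem hasSparseNull_of_int {n m : ℕ} {Z : Matrix (Fin n) (Fin n) SignType} {u : Fin n → ℤ}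
    (hu : u ≠ 0) (hum : (Finset.univ.filter fun j => u j ≠ 0).card ≤ m)
    (h : ∀ i, ∑ j, (Z i j : ℤ) * u j = 0) : HasSparseNull m Z := by
  induction hk : ∑ j, (u j).natAbs using Nat.strong_induction_on generalizing u with
  | _ k ih =>
    by_cases h3 : ∀ j, (3 : ℤ) ∣ u j
    · choose v hv using h3
      obtain ⟨j, hj⟩ := Function.ne_iff.1 hu
      have hvj : v j ≠ 0 := by
        intro h0
        apply hj
        rw [hv, h0]; rfl
      refine ih (∑ j, (v j).natAbs) ?_ (u := v) (fun h0 => hvj (congrFun h0 j)) ?_ ?_ rfl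
      · rw [← hk]
        refine Finset.sum_lt_sum (fun i _ => ?_) ⟨j, Finset.mem_univ _, ?_⟩
        · rw [hv i]; omega
        · rw [hv j]; omega
      · refine le_trans (Finset.card_le_card fun i hi => ?_) hum
        simp only [Finset.mem_filter, Finset.mem_univ, true_and] at hi ⊢
        rw [hv i]; omega
      · intro i
        have := h i
        simp_rw [hv, mul_left_comm _ (3 : ℤ)] at this
        rw [← Finset.mul_sum] at this
        omega
    · push Not at h3
      obtain ⟨j, hj⟩ := h3
      refine ⟨fun j => (u j : ZMod 3), fun h0 => hj ?_, le_trans (Finset.card_le_card ?_) hum, ?_⟩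
      · exact (ZMod.intCast_zmod_eq_zero_iff_dvd _ 3).1 (congrFun h0 j)
      · intro i hi
        simp only [Finset.mem_filter, Finset.mem_univ, true_and] at hi ⊢
        rintro h0
        exact hi (by rw [h0, Int.cast_zero])
      · intro i
        have := congrArg (Int.cast : ℤ → ZMod 3) (h i)
        push_cast at this
        simpa [SignType.intCast_cast] using this

/-- `ξ` makes `signed ξ X` singular, with a right null vector meeting the support of row `i` in at
least `κ` places and a left null vector not vanishing at `i`. -/
def SingularAtRow {n : ℕ} (κ : ℕ) (X : Matrix (Fin n) (Fin n) SignType) (i : Fin n)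
    (ξ : Fin n → Fin n → Bool) : Prop :=
  ∃ u y : Fin n → ℤ, κ ≤ (Finset.univ.filter fun j => X i j ≠ 0 ∧ u j ≠ 0).card ∧
    (∀ k, ∑ j, (signed ξ X k j : ℤ) * u j = 0) ∧ y i ≠ 0 ∧
    ∀ j, ∑ k, y k * (signed ξ X k j : ℤ) = 0

theorem row_sum_eq_zero_of_left_null {n : ℕ} {A : Matrix (Fin n) (Fin n) ℤ} {u y : Fin n → ℤ}
    {i : Fin n} (hA : ∀ k, k ≠ i → ∑ j, A k j * u j = 0) (hy : y i ≠ 0)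
    (h : ∀ j, ∑ k, y k * A k j = 0) : ∑ j, A i j * u j = 0 := by
  have h1 : ∑ k, y k * ∑ j, A k j * u j = 0 := by
    simp_rw [Finset.mul_sum, ← mul_assoc]
    rw [Finset.sum_comm]
    simp_rw [← Finset.sum_mul, h, zero_mul]
    exact Finset.sum_const_zero
  rw [Finset.sum_eq_single i (fun k _ hk => by rw [hA k hk, mul_zero])
    (fun hi => absurd (Finset.mem_univ i) hi)] at h1
  exact (mul_eq_zero.1 h1).resolve_left hy

theorem card_singularAtRow_sq_mul_le {n κ : ℕ} (hκ : 0 < κ) (X : Matrix (Fin n) (Fin n) SignType)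
    (i : Fin n) :
    (Finset.univ.filter fun ξ => SingularAtRow κ X i ξ).card ^ 2 * κ ≤ ((2 ^ n) ^ n) ^ 2 := by
  set F := Finset.univ.filter fun ξ => SingularAtRow κ X i ξ with hF
  set restr : (Fin n → Fin n → Bool) → ({k // k ≠ i} → Fin n → Bool) := fun ξ k => ξ k with hr
  set t := Nat.sqrt (4 ^ n / κ) with ht
  have htκ : t ^ 2 * κ ≤ 4 ^ n := by
    refine le_trans (Nat.mul_le_mul_right _ ?_) (Nat.div_mul_le_self (4 ^ n) κ)
    exact Nat.sqrt_le' _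
  have hfib : ∀ g ∈ (Finset.univ : Finset ({k // k ≠ i} → Fin n → Bool)),
      (F.filter fun ξ => restr ξ = g).card ≤ t := by
    intro g _
    rw [ht, Nat.le_sqrt', Nat.le_div_iff_mul_le hκ]
    rcases (F.filter fun ξ => restr ξ = g).eq_empty_or_nonempty with h0 | ⟨ξ₀, hξ₀⟩
    · simp [h0]
    rw [Finset.mem_filter, hF, Finset.mem_filter] at hξ₀
    obtain ⟨⟨-, u, -, huκ, hu, -, -⟩, hg⟩ := hξ₀
    have hLO : (Finset.univ.filter fun s : Fin n → Bool =>
        ∑ j, (boolSign (s j) : ℤ) * ((X i j : ℤ) * u j) = 0).card ^ 2 *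
        (Finset.univ.filter fun j => (X i j : ℤ) * u j ≠ 0).card ≤ 4 ^ n := by
      have := card_signed_sum_eq_zero_sq_mul_le fun j => (X i j : ℤ) * u j
      rw [Fintype.card_fin] at this
      convert this
    refine le_trans (Nat.mul_le_mul (Nat.pow_le_pow_left ?_ 2) ?_) hLO
    · refine Finset.card_le_card_of_injOn (fun ξ => ξ i) ?_ ?_
      · intro ξ hξ
        rw [Finset.mem_coe, Finset.mem_filter, hF, Finset.mem_filter] at hξ
        obtain ⟨⟨-, -, y, -, -, hyi, hy⟩, hξg⟩ := hξ
        have hrow : ∀ k, k ≠ i → ∑ j, (signed ξ X k j : ℤ) * u j = 0 := by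
          intro k hk
          rw [← hu k]
          have : ξ k = ξ₀ k := congrFun (hξg.trans hg.symm) ⟨k, hk⟩
          simp [signed, this]
        have := row_sum_eq_zero_of_left_null (A := fun k j => (signed ξ X k j : ℤ)) hrow hyi hy
        refine Finset.mem_coe.2 (Finset.mem_filter.2 ⟨Finset.mem_univ _, ?_⟩)
        rw [← this]
        refine Finset.sum_congr rfl fun j _ => ?_
        simp [signed, mul_assoc]
      · intro ξ hξ ξ' hξ' h
        rw [Finset.mem_coe, Finset.mem_filter] at hξ hξ'
        funext k
        by_cases hk : k = i
        · rw [hk]; exact h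
        · exact congrFun (hξ.2.trans hξ'.2.symm) ⟨k, hk⟩
    · refine huκ.trans (Finset.card_le_card fun j hj => ?_)
      have h0 : ∀ s : SignType, s ≠ 0 → (s : ℤ) ≠ 0 := by decide
      obtain ⟨-, hX, hu⟩ := Finset.mem_filter.1 hj
      exact Finset.mem_filter.2 ⟨Finset.mem_univ _, mul_ne_zero (h0 _ hX) hu⟩
  have hcard : F.card ≤ t * (2 ^ n) ^ (n - 1) := by
    have := Finset.card_le_mul_card_image_of_maps_to (s := F) (t := Finset.univ) (f := restr)
      (fun _ _ => Finset.mem_univ _) t hfib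
    simpa using this
  have hn : n = (n - 1) + 1 := by have := i.pos; omega
  calc F.card ^ 2 * κ ≤ (t * (2 ^ n) ^ (n - 1)) ^ 2 * κ := by gcongr
    _ = (t ^ 2 * κ) * ((2 ^ n) ^ (n - 1)) ^ 2 := by ring
    _ ≤ 4 ^ n * ((2 ^ n) ^ (n - 1)) ^ 2 := by gcongr
    _ = ((2 ^ n) ^ ((n - 1) + 1)) ^ 2 := by
      rw [show (4 : ℕ) = 2 ^ 2 by norm_num, pow_right_comm]
      ring
    _ = _ := by rw [← hn]

theorem exists_int_null_of_det_eq_zero {n : ℕ} {Z : Matrix (Fin n) (Fin n) SignType}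
    (h : (s2r Z).det = 0) :
    (∃ u : Fin n → ℤ, u ≠ 0 ∧ ∀ i, ∑ j, (Z i j : ℤ) * u j = 0) ∧
      ∃ y : Fin n → ℤ, y ≠ 0 ∧ ∀ j, ∑ i, y i * (Z i j : ℤ) = 0 := by
  set A : Matrix (Fin n) (Fin n) ℤ := Matrix.of fun i j => (Z i j : ℤ) with hA
  have hdet : A.det = 0 := by
    have h1 : s2r Z = (Int.castRingHom ℝ).mapMatrix A := by
      ext i j
      simp [s2r, hA]
    rw [h1, ← RingHom.map_det] at h
    simpa using h
  refine ⟨?_, ?_⟩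
  · obtain ⟨u, hu, h⟩ := Matrix.exists_mulVec_eq_zero_iff.2 hdet
    exact ⟨u, hu, fun i => congrFun h i⟩
  · obtain ⟨y, hy, h⟩ := Matrix.exists_vecMul_eq_zero_iff.2 hdet
    exact ⟨y, hy, fun i => congrFun h i⟩

theorem le_card_singularAtRow {n m κ : ℕ} (hm : 0 < m) {X : Matrix (Fin n) (Fin n) SignType}
    (hX : Spread m κ X) {ξ : Fin n → Fin n → Bool} (hdet : (s2r (signed ξ X)).det = 0)
    (h₁ : ¬HasSparseNull m (signed ξ X)) (h₂ : ¬HasSparseNull m (signed ξ X).transpose) :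
    m ≤ 2 * (Finset.univ.filter fun i => SingularAtRow κ X i ξ).card := by
  obtain ⟨⟨u, hu0, hu⟩, y, hy0, hy⟩ := exists_int_null_of_det_eq_zero hdet
  have hus : m < (Finset.univ.filter fun j => u j ≠ 0).card := by
    by_contra! h
    exact h₁ (hasSparseNull_of_int hu0 h hu)
  have hys : m < (Finset.univ.filter fun j => y j ≠ 0).card := by
    by_contra! h
    refine h₂ (hasSparseNull_of_int hy0 h fun j => ?_)
    rw [← hy j]
    exact Finset.sum_congr rfl fun i _ => mul_comm _ _
  set T := Finset.univ.filter fun j => u j ≠ 0 with hT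
  set B := Finset.univ.filter fun i : Fin n => (T.filter fun j => X i j ≠ 0).card < κ with hB
  have hBm : 2 * B.card < m := by
    by_contra! h
    have h1 := hX B T hus.le h
    rw [edgeCount_eq_sum] at h1
    have hne : B.Nonempty := by
      rw [← Finset.card_pos]; omega
    have h2 : ∑ i ∈ B, (T.filter fun j => X i j ≠ 0).card < ∑ _i ∈ B, κ :=
      Finset.sum_lt_sum_of_nonempty hne fun i hi => (Finset.mem_filter.1 hi).2
    rw [Finset.sum_const, smul_eq_mul] at h2
    have h3 : B.card * κ ≤ n * κ := Nat.mul_le_mul_right _ (by simpa using Finset.card_le_univ B)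
    rw [mul_comm n κ] at h3
    omega
  have hsub : (Finset.univ.filter fun i => y i ≠ 0) ⊆
      B ∪ Finset.univ.filter fun i => SingularAtRow κ X i ξ := by
    intro i hi
    rw [Finset.mem_union]
    by_cases hiB : i ∈ B
    · exact Or.inl hiB
    · refine Or.inr (Finset.mem_filter.2 ⟨Finset.mem_univ _, u, y, ?_, hu,
        (Finset.mem_filter.1 hi).2, hy⟩)
      rw [hB, Finset.mem_filter, not_and, not_lt] at hiB
      refine (hiB (Finset.mem_univ _)).trans (Finset.card_le_card fun j hj => ?_)
      rw [hT, Finset.filter_filter] at hj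
      simp only [Finset.mem_filter, Finset.mem_univ, true_and] at hj ⊢
      exact hj.symm
  have := (Finset.card_le_card hsub).trans (Finset.card_union_le _ _)
  omega

theorem card_singular_signed_le {n m κ : ℕ} (hm : 0 < m) (hnm : n ≤ 2048 * m) (hκ : 0 < κ)
    {X : Matrix (Fin n) (Fin n) SignType} (hX : Spread m κ X) :
    ((Finset.univ.filter fun ξ => (s2r (signed ξ X)).det = 0 ∧ ¬HasSparseNull m (signed ξ X) ∧
      ¬HasSparseNull m (signed ξ X).transpose).card : ℝ) ≤ 4096 / √κ * (2 ^ n) ^ n := by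
  set S := Finset.univ.filter fun ξ => (s2r (signed ξ X)).det = 0 ∧ ¬HasSparseNull m (signed ξ X) ∧
      ¬HasSparseNull m (signed ξ X).transpose with hS
  have hκ0 : (0 : ℝ) < √κ := Real.sqrt_pos.2 (by exact_mod_cast hκ)
  have h1 : S.card * m ≤ 2 * ∑ i, (Finset.univ.filter fun ξ => SingularAtRow κ X i ξ).card := by
    simp_rw [Finset.card_filter]
    rw [Finset.sum_comm, Finset.mul_sum]
    simp_rw [← Finset.card_filter]
    calc S.card * m = ∑ _ξ ∈ S, m := by rw [Finset.sum_const, smul_eq_mul]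
      _ ≤ ∑ ξ ∈ S, 2 * (Finset.univ.filter fun i => SingularAtRow κ X i ξ).card := by
        refine Finset.sum_le_sum fun ξ hξ => ?_
        obtain ⟨-, hd, h2, h3⟩ := Finset.mem_filter.1 hξ
        exact le_card_singularAtRow hm hX hd h2 h3
      _ ≤ _ := Finset.sum_le_sum_of_subset (Finset.subset_univ _)
  have h2 : ∀ i, ((Finset.univ.filter fun ξ => SingularAtRow κ X i ξ).card : ℝ) ≤
      (2 ^ n) ^ n / √κ := by
    intro i
    rw [le_div_iff₀ hκ0]
    refine le_of_sq_le_sq ?_ (by positivity)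
    rw [mul_pow, Real.sq_sqrt (by positivity)]
    exact_mod_cast card_singularAtRow_sq_mul_le hκ X i
  have h3 : (S.card : ℝ) * m ≤ 2 * (n * ((2 ^ n) ^ n / √κ)) := by
    calc (S.card : ℝ) * m
        ≤ 2 * ∑ i, ((Finset.univ.filter fun ξ => SingularAtRow κ X i ξ).card : ℝ) := by
          exact_mod_cast h1
      _ ≤ 2 * ∑ _i : Fin n, (2 ^ n) ^ n / √κ := by
        gcongr with i
        exact h2 i
      _ = _ := by simp
  have hm' : (0 : ℝ) < m := by exact_mod_cast hm
  have hnm' : (n : ℝ) ≤ 2048 * m := by exact_mod_cast hnm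
  refine le_of_mul_le_mul_right ?_ hm'
  calc (S.card : ℝ) * m ≤ 2 * (n * ((2 ^ n) ^ n / √κ)) := h3
    _ ≤ 2 * (2048 * m * ((2 ^ n) ^ n / √κ)) := by gcongr
    _ = _ := by ring

theorem card_singular_le {n m κ L : ℕ} (hn : 2 ≤ n) (hm : 1024 * m ≤ n) (hL : n ≤ 2 ^ L)
    (hm0 : 0 < m) (hnm : n ≤ 2048 * m) (hκ : 0 < κ)
    {X : Matrix (Fin n) (Fin n) SignType} (hX₁ : Expands m L X) (hX₂ : Expands m L X.transpose)
    (hX₃ : Spread m κ X) :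
    ((Finset.univ.filter fun ξ => (s2r (signed ξ X)).det = 0).card : ℝ) ≤
      (48 / n + 4096 / √κ) * (2 ^ n) ^ n := by
  have h1 := card_hasSparseNull_le hn hm hL hX₁
  have h2 := card_hasSparseNull_le hn hm hL hX₂
  rw [← card_hasSparseNull_transpose] at h2
  have h3 := card_singular_signed_le hm0 hnm hκ hX₃
  have hsub : (Finset.univ.filter fun ξ => (s2r (signed ξ X)).det = 0) ⊆
      ((Finset.univ.filter fun ξ => HasSparseNull m (signed ξ X)) ∪
      (Finset.univ.filter fun ξ => HasSparseNull m (signed ξ X).transpose)) ∪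
      (Finset.univ.filter fun ξ => (s2r (signed ξ X)).det = 0 ∧ ¬HasSparseNull m (signed ξ X) ∧
      ¬HasSparseNull m (signed ξ X).transpose) := by
    intro ξ
    simp only [Finset.mem_union, Finset.mem_filter, Finset.mem_univ, true_and]
    tauto
  have h4 := ((Finset.card_le_card hsub).trans (Finset.card_union_le _ _)).trans
    (Nat.add_le_add_right (Finset.card_union_le _ _) _)
  have h5 := (Nat.cast_le (α := ℝ)).2 h4
  push_cast at h5
  calc _ ≤ _ := h5
    _ ≤ 24 / n * (2 ^ n) ^ n + 24 / n * (2 ^ n) ^ n + 4096 / √κ * (2 ^ n) ^ n := by gcongr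
    _ = _ := by ring

theorem card_sregSet_singular_le {n d m κ L : ℕ} (hn : 2 ≤ n) (hd : 0 < d) (hm : 1024 * m ≤ n)
    (hL : n ≤ 2 ^ L) (hdL : 4 * (L * L) + 2 * L ≤ d / 8) (hm0 : 0 < m) (hnm : n ≤ 2048 * m)
    (hκ : 3 ≤ κ) (hκd : 2 ^ 40 * κ ≤ d) :
    (((sregSet n d).filter fun A => (s2r A).det = 0).card : ℝ) ≤
      (61 / n + 4096 / √κ) * (sregSet n d).card := by
  set Ω := sregSet n d with hΩ
  set good : Matrix (Fin n) (Fin n) SignType → Prop := fun X =>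
    Expands m L X ∧ Expands m L X.transpose ∧ Spread m κ X with hgood
  have hn0 : (0 : ℝ) < n := by positivity
  have hbad : ((Ω.filter fun X => ¬good X).card : ℝ) ≤ 13 / n * Ω.card := by
    have h1 := card_not_expands_le hn hd (by omega : 16 * m ≤ n) hL hdL
    have h2 := h1
    rw [← card_not_expands_transpose] at h2
    have h3 : ((Ω.filter fun X => ¬Spread m κ X).card : ℝ) ≤ 1 / n * Ω.card := by
      have h := card_not_spread_mul_le (by omega : 0 < n) hd hnm hκd
      have h4 : 4 ^ n * n ≤ 2 ^ (κ * n) := by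
        calc 4 ^ n * n ≤ 4 ^ n * 2 ^ n := Nat.mul_le_mul_left _ Nat.lt_two_pow_self.le
          _ = 2 ^ (3 * n) := by
            rw [show (4 : ℕ) = 2 ^ 2 by norm_num, ← pow_mul, ← pow_add]
            congr 1; ring
          _ ≤ _ := Nat.pow_le_pow_right (by norm_num) (Nat.mul_le_mul_right _ hκ)
      have h5 : (Ω.filter fun X => ¬Spread m κ X).card * n ≤ Ω.card := by
        refine Nat.le_of_mul_le_mul_left ?_ (by positivity : 0 < 4 ^ n)
        calc 4 ^ n * ((Ω.filter fun X => ¬Spread m κ X).card * n)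
            = (Ω.filter fun X => ¬Spread m κ X).card * (4 ^ n * n) := by ring
          _ ≤ _ := Nat.mul_le_mul_left _ h4
          _ ≤ _ := h
      rw [one_div, inv_mul_eq_div, le_div_iff₀ hn0]
      exact_mod_cast h5
    have hsub : (Ω.filter fun X => ¬good X) ⊆ ((Ω.filter fun X => ¬Expands m L X) ∪
        (Ω.filter fun X => ¬Expands m L X.transpose)) ∪ Ω.filter fun X => ¬Spread m κ X := by
      intro X
      simp only [hgood, Finset.mem_union, Finset.mem_filter]
      tauto
    have h4 := ((Finset.card_le_card hsub).trans (Finset.card_union_le _ _)).trans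
      (Nat.add_le_add_right (Finset.card_union_le _ _) _)
    have h5 := (Nat.cast_le (α := ℝ)).2 h4
    push_cast at h5
    calc _ ≤ _ := h5
      _ ≤ 6 / n * Ω.card + 6 / n * Ω.card + 1 / n * Ω.card := by gcongr
      _ = _ := by ring
  have hW : (0 : ℝ) < (2 ^ n) ^ n := by positivity
  refine le_of_mul_le_mul_right ?_ hW
  have hsum := (Nat.cast_inj (R := ℝ)).2
    (card_filter_sregSet_mul (n := n) (d := d) fun A => (s2r A).det = 0)
  push_cast at hsum
  rw [hsum, ← Finset.sum_filter_add_sum_filter_not _ good]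
  have hg : ∑ X ∈ Ω.filter good,
      ((Finset.univ.filter fun ξ => (s2r (signed ξ X)).det = 0).card : ℝ) ≤
      Ω.card * ((48 / n + 4096 / √κ) * (2 ^ n) ^ n) := by
    refine (Finset.sum_le_card_nsmul _ _ ((48 / n + 4096 / √κ) * (2 ^ n) ^ n)
      fun X hX => ?_).trans ?_
    · obtain ⟨-, h1, h2, h3⟩ := Finset.mem_filter.1 hX
      exact card_singular_le hn hm hL hm0 hnm (by omega) h1 h2 h3
    · rw [nsmul_eq_mul]
      gcongr
      exact Finset.filter_subset _ _
  have hb : ∑ X ∈ Ω.filter fun X => ¬good X,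
      ((Finset.univ.filter fun ξ => (s2r (signed ξ X)).det = 0).card : ℝ) ≤
      13 / n * Ω.card * (2 ^ n) ^ n := by
    refine (Finset.sum_le_card_nsmul _ _ ((2 ^ n) ^ n) fun X _ => ?_).trans ?_
    · have : (Finset.univ.filter fun ξ => (s2r (signed ξ X)).det = 0).card ≤ (2 ^ n) ^ n := by
        simpa using Finset.card_le_univ (Finset.univ.filter fun ξ => (s2r (signed ξ X)).det = 0)
      exact_mod_cast this
    · rw [nsmul_eq_mul]
      gcongr
  calc _ ≤ _ := add_le_add hg hb
    _ = _ := by ring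

/-- **Signed rrd matrices are invertible a.a.s.**  If `ω(log² n) ≤ d ≤ n`, a
uniform random element of `M^±_{n,d}` is singular with probability `O(d^{-1/4})`. -/
theorem singularity_of_signed_rrd
    (d : ℕ → ℕ) (hd : ∀ n, d n ≤ n)
    (hω : ∀ c : ℝ, 0 < c → ∃ N : ℕ, ∀ n, N ≤ n →
      c * (Real.log n) ^ 2 ≤ (d n : ℝ)) :
    ∃ C : ℝ, 0 < C ∧ ∃ N : ℕ, ∀ n, N ≤ n →
      cprob (sregSet n (d n)) (fun A => (s2r A).det = 0)
        ≤ C * (d n : ℝ) ^ (-(1/4 : ℝ)) := by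
  obtain ⟨N, hN⟩ := hω (2 ^ 42) (by norm_num)
  refine ⟨61 + 4096 * 2 ^ 21, by norm_num, max N 1024, fun n hn => ?_⟩
  have hnN := hN n (le_of_max_le_left hn)
  have hn1024 : 1024 ≤ n := le_of_max_le_right hn
  have hdn := hd n
  set e := d n with he
  have hlog2 : Real.log 2 ≤ 1 := by linarith [Real.log_two_lt_d9]
  have hlog2' : (1 / 2 : ℝ) ≤ Real.log 2 := by linarith [Real.log_two_gt_d9]
  set L := Nat.clog 2 n with hLdef
  have hL : n ≤ 2 ^ L := Nat.le_pow_clog (by norm_num) n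
  have hL1 : 1 ≤ L := Nat.clog_pos (by norm_num) (by omega)
  have hL2 : 2 ^ (L - 1) < n := Nat.pow_pred_clog_lt_self (by norm_num) (by omega)
  have hL10 : 10 ≤ L := by
    by_contra! h
    have : 2 ^ L ≤ 2 ^ 9 := Nat.pow_le_pow_right (by norm_num) (by omega)
    omega
  have hlogn : (L : ℝ) ≤ 4 * Real.log n := by
    have h1 : Real.log ((2 : ℝ) ^ (L - 1)) ≤ Real.log n := by
      refine Real.log_le_log (by positivity) ?_
      exact_mod_cast hL2.le
    rw [Real.log_pow, Nat.cast_sub hL1] at h1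
    have h2 : (10 : ℝ) ≤ L := by exact_mod_cast hL10
    push_cast at h1
    nlinarith
  have hLe : 2 ^ 38 * (L * L) ≤ e := by
    have h1 : (2 : ℝ) ^ 38 * (L * L) ≤ e := by
      refine le_trans ?_ hnN
      nlinarith [(Nat.cast_nonneg L : (0 : ℝ) ≤ L)]
    exact_mod_cast h1
  have hLL : 10 * L ≤ L * L := Nat.mul_le_mul_right _ hL10
  have hdL : 4 * (L * L) + 2 * L ≤ e / 8 := by omega
  have hκ : 3 ≤ e / 2 ^ 40 := by omega
  have hmain := card_sregSet_singular_le (n := n) (d := e) (m := n / 1024) (κ := e / 2 ^ 40) (L := L)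
    (by omega) (by omega) (by omega) hL hdL (by omega) (by omega) hκ (by omega)
  have he1 : (1 : ℝ) ≤ e := by
    have : 1 ≤ e := by omega
    exact_mod_cast this
  have hen : (e : ℝ) ≤ n := by exact_mod_cast hdn
  have he0 : (0 : ℝ) < e := by linarith
  have hκe : (e : ℝ) / 2 ^ 42 ≤ (e / 2 ^ 40 : ℕ) := by
    have : e ≤ 2 ^ 42 * (e / 2 ^ 40) := by omega
    rw [div_le_iff₀ (by positivity), mul_comm]
    exact_mod_cast this
  have h1 : (1 : ℝ) / n ≤ (e : ℝ) ^ (-(1 / 4 : ℝ)) := by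
    calc (1 : ℝ) / n ≤ 1 / e := by gcongr
      _ = (e : ℝ) ^ (-1 : ℝ) := by rw [Real.rpow_neg_one, one_div]
      _ ≤ _ := Real.rpow_le_rpow_of_exponent_le he1 (by norm_num)
  have h2 : 1 / √((e / 2 ^ 40 : ℕ) : ℝ) ≤ 2 ^ 21 * (e : ℝ) ^ (-(1 / 4 : ℝ)) := by
    have hs : √((e : ℝ) / 2 ^ 42) = √e / 2 ^ 21 := by
      rw [Real.sqrt_div' _ (by positivity)]
      congr 1
      rw [show (2 : ℝ) ^ 42 = (2 ^ 21) ^ 2 by norm_num]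
      exact Real.sqrt_sq (by positivity)
    have hse : 0 < √(e : ℝ) := Real.sqrt_pos.2 he0
    calc 1 / √((e / 2 ^ 40 : ℕ) : ℝ) ≤ 1 / √((e : ℝ) / 2 ^ 42) := by
          refine one_div_le_one_div_of_le (by rw [hs]; positivity) (Real.sqrt_le_sqrt hκe)
      _ = 2 ^ 21 * (e : ℝ) ^ (-(1 / 2 : ℝ)) := by
        rw [hs, Real.rpow_neg he0.le, ← Real.sqrt_eq_rpow]
        field_simp
      _ ≤ _ := mul_le_mul_of_nonneg_left
        (Real.rpow_le_rpow_of_exponent_le he1 (by norm_num)) (by positivity)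
  have hpos : (0 : ℝ) ≤ (e : ℝ) ^ (-(1 / 4 : ℝ)) := by positivity
  have h3 : (61 : ℝ) / n + 4096 / √((e / 2 ^ 40 : ℕ) : ℝ) ≤
      (61 + 4096 * 2 ^ 21) * (e : ℝ) ^ (-(1 / 4 : ℝ)) := by
    calc (61 : ℝ) / n + 4096 / √((e / 2 ^ 40 : ℕ) : ℝ)
        = 61 * (1 / n) + 4096 * (1 / √((e / 2 ^ 40 : ℕ) : ℝ)) := by ring
      _ ≤ 61 * (e : ℝ) ^ (-(1 / 4 : ℝ)) + 4096 * (2 ^ 21 * (e : ℝ) ^ (-(1 / 4 : ℝ))) := by gcongr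
      _ = _ := by ring
  rw [cprob]
  refine div_le_of_le_mul₀ (by positivity) (by positivity) ?_
  refine le_trans ?_ (mul_le_mul_of_nonneg_right h3 (by positivity))
  convert hmain

end
end

section
/- Assume n is even, and let Ξ₀ be an n×n matrix of iid uniform ±1 signs conditioned on the event that every row sum and every column sum equals 0. Then with probability 1 − o(1) as n → ∞, the kernel of Ξ₀ equals the one-dimensional span of the all-ones vector 𝟙 = (1,…,1) ∈ ℝⁿ. -/
open scoped Classical

noncomputable section

/-- The real `±1` matrix associated to a Boolean matrix (`true ↦ +1`, `false ↦ -1`). -/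
def sgn2r {n : ℕ} (A : Matrix (Fin n) (Fin n) Bool) : Matrix (Fin n) (Fin n) ℝ :=
  Matrix.of fun i j => if A i j then (1 : ℝ) else -1

/-- Sign matrices (encoded as Boolean matrices) all of whose row sums and column sums
(of the associated `±1` matrix) are zero. -/
def zeroSumSigns (n : ℕ) : Finset (Matrix (Fin n) (Fin n) Bool) :=
  Finset.univ.filter fun A =>
    (∀ i, ∑ j, sgn2r A i j = 0) ∧ (∀ j, ∑ i, sgn2r A i j = 0)

open Finset in
/-- A two-factor LYM inequality: if the pairs in `S` are pairwise incomparable for the order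
shrinking the first set and enlarging the second, and every product of binomials is at most `M`,
then `S` has at most `M` elements. -/
theorem card_le_of_two_sided_antichain {α β : Type*} [Fintype α] [Fintype β]
    (S : Finset (Finset α × Finset β)) (c M : ℕ)
    (hcard : ∀ p ∈ S, #p.1 + #p.2 = c)
    (hanti : ∀ p ∈ S, ∀ q ∈ S, q.1 ⊆ p.1 → p.2 ⊆ q.2 → p = q)
    (hM : ∀ a b, a + b = c → (Fintype.card α).choose a * (Fintype.card β).choose b ≤ M) :
    #S ≤ M := by
  set F : Finset α × Finset β → Finset (Numbering α × Numbering β) :=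
    fun p => Numbering.prefixed p.1 ×ˢ Numbering.prefixed p.2 with hF
  have hdisj : (S : Set (Finset α × Finset β)).PairwiseDisjoint F := by
    intro p hp q hq hpq
    rw [Function.onFun, Finset.disjoint_left]
    rintro ⟨f, g⟩ h1 h2
    simp only [hF, mem_product, Numbering.mem_prefixed] at h1 h2
    apply hpq
    have hp' := hcard p hp
    have hq' := hcard q hq
    rcases le_total #p.2 #q.2 with h | h
    · exact hanti p hp q hq (h2.1.subset_of_card_le_card h1.1 (by omega))
        (h1.2.subset_of_card_le_card h2.2 h)
    · exact (hanti q hq p hp (h1.1.subset_of_card_le_card h2.1 (by omega))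
        (h2.2.subset_of_card_le_card h1.2 h)).symm
  have hle : #(S.biUnion F) ≤ (Fintype.card α).factorial * (Fintype.card β).factorial := by
    refine (Finset.card_le_univ _).trans ?_
    rw [Fintype.card_prod, Fintype.card_numbering, Fintype.card_numbering]
  rw [Finset.card_biUnion hdisj] at hle
  have hpos : 0 < (Fintype.card α).factorial * (Fintype.card β).factorial := by positivity
  have hterm : ∀ p ∈ S, (Fintype.card α).factorial * (Fintype.card β).factorial ≤ M * #(F p) := by
    intro p hp
    have h1 := Nat.choose_mul_factorial_mul_factorial (Finset.card_le_univ p.1)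
    have h2 := Nat.choose_mul_factorial_mul_factorial (Finset.card_le_univ p.2)
    have h3 := hM _ _ (hcard p hp)
    rw [hF, card_product, Numbering.card_prefixed, Numbering.card_prefixed, ← h1, ← h2]
    calc _ = ((Fintype.card α).choose #p.1 * (Fintype.card β).choose #p.2) *
          ((#p.1).factorial * (Fintype.card α - #p.1).factorial *
            ((#p.2).factorial * (Fintype.card β - #p.2).factorial)) := by ring
      _ ≤ _ := Nat.mul_le_mul_right _ h3
  refine Nat.le_of_mul_le_mul_right ?_ hpos
  calc #S * ((Fintype.card α).factorial * (Fintype.card β).factorial)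
      = ∑ p ∈ S, (Fintype.card α).factorial * (Fintype.card β).factorial := by
        rw [sum_const, smul_eq_mul]
    _ ≤ ∑ p ∈ S, M * #(F p) := sum_le_sum hterm
    _ = M * ∑ p ∈ S, #(F p) := by rw [mul_sum]
    _ ≤ _ := Nat.mul_le_mul_left _ hle

open Finset in
/-- An Erdős–Littlewood–Offord bound on the slice `powersetCard c D`. -/
theorem card_powersetCard_sum_eq_le {ι : Type*} (D : Finset ι) (w : ι → ℝ) (t v : ℝ) (c M : ℕ)
    (hM : ∀ a b, a + b = c →
      (#{j ∈ D | w j ≤ t}).choose a * (#{j ∈ D | t < w j}).choose b ≤ M) :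
    #{Y ∈ powersetCard c D | ∑ j ∈ Y, w j = v} ≤ M := by
  set D1 := {j ∈ D | w j ≤ t} with hD1
  set D2 := {j ∈ D | t < w j} with hD2
  set φ : Finset ι → Finset D1 × Finset D2 :=
    fun Y => (Y.subtype (· ∈ D1), Y.subtype (· ∈ D2)) with hφ
  have hsplit : ∀ Y ⊆ D, Y.filter (· ∈ D1) ∪ Y.filter (· ∈ D2) = Y := by
    intro Y hY
    ext j
    simp only [mem_union, mem_filter, hD1, hD2]
    have := @hY j
    have := le_or_gt (w j) t
    tauto
  have hdis : ∀ Y Y' : Finset ι, Disjoint (Y.filter (· ∈ D1)) (Y'.filter (· ∈ D2)) := by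
    intro Y Y'
    rw [Finset.disjoint_left]
    intro j h1 h2
    simp only [mem_filter, hD1, hD2] at h1 h2
    linarith [h1.2.2, h2.2.2]
  have hinj : Set.InjOn φ ({Y ∈ powersetCard c D | ∑ j ∈ Y, w j = v} : Finset (Finset ι)) := by
    intro Y hY Y' hY' h
    simp only [coe_filter, mem_powersetCard, Set.mem_ofPred_eq] at hY hY'
    rw [← hsplit Y hY.1.1, ← hsplit Y' hY'.1.1, ← subtype_map, ← subtype_map, ← subtype_map,
      ← subtype_map]
    simp only [hφ, Prod.mk.injEq] at h
    rw [h.1, h.2]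
  rw [← card_image_of_injOn hinj]
  refine card_le_of_two_sided_antichain _ c M ?_ ?_ ?_
  · intro p hp
    obtain ⟨Y, hY, rfl⟩ := mem_image.1 hp
    simp only [mem_filter, mem_powersetCard] at hY
    simp only [hφ, card_subtype]
    rw [← card_union_of_disjoint (hdis Y Y), hsplit Y hY.1.1, hY.1.2]
  · intro p hp q hq h1 h2
    obtain ⟨Y, hY, rfl⟩ := mem_image.1 hp
    obtain ⟨Y', hY', rfl⟩ := mem_image.1 hq
    simp only [mem_filter, mem_powersetCard] at hY hY'
    have h1' : Y'.filter (· ∈ D1) ⊆ Y.filter (· ∈ D1) := by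
      rw [← subtype_map, ← subtype_map]; exact map_subset_map.2 h1
    have h2' : Y.filter (· ∈ D2) ⊆ Y'.filter (· ∈ D2) := by
      rw [← subtype_map, ← subtype_map]; exact map_subset_map.2 h2
    have e1 : #(Y.filter (· ∈ D1)) + #(Y.filter (· ∈ D2)) = c := by
      rw [← card_union_of_disjoint (hdis Y Y), hsplit Y hY.1.1, hY.1.2]
    have e2 : #(Y'.filter (· ∈ D1)) + #(Y'.filter (· ∈ D2)) = c := by
      rw [← card_union_of_disjoint (hdis Y' Y'), hsplit Y' hY'.1.1, hY'.1.2]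
    have s1 : ∑ j ∈ Y.filter (· ∈ D1), w j + ∑ j ∈ Y.filter (· ∈ D2), w j = v := by
      rw [← sum_union (hdis Y Y), hsplit Y hY.1.1, hY.2]
    have s2 : ∑ j ∈ Y'.filter (· ∈ D1), w j + ∑ j ∈ Y'.filter (· ∈ D2), w j = v := by
      rw [← sum_union (hdis Y' Y'), hsplit Y' hY'.1.1, hY'.2]
    rw [← sum_sdiff h1'] at s1
    rw [← sum_sdiff h2'] at s2
    have c1 := card_sdiff_add_card_eq_card h1'
    have c2 := card_sdiff_add_card_eq_card h2'
    have b1 : ∑ j ∈ Y.filter (· ∈ D1) \ Y'.filter (· ∈ D1), w j ≤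
        #(Y.filter (· ∈ D1) \ Y'.filter (· ∈ D1)) • t := by
      apply sum_le_card_nsmul
      intro j hj
      simp only [mem_sdiff, mem_filter, hD1] at hj
      exact hj.1.2.2
    have hemp : Y'.filter (· ∈ D2) \ Y.filter (· ∈ D2) = ∅ := by
      by_contra hne
      have b2 : #(Y'.filter (· ∈ D2) \ Y.filter (· ∈ D2)) • t <
          ∑ j ∈ Y'.filter (· ∈ D2) \ Y.filter (· ∈ D2), w j := by
        rw [← sum_const]
        apply sum_lt_sum_of_nonempty (nonempty_iff_ne_empty.2 hne)
        intro j hj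
        simp only [mem_sdiff, mem_filter, hD2] at hj
        exact hj.1.2.2
      have : #(Y.filter (· ∈ D1) \ Y'.filter (· ∈ D1)) =
          #(Y'.filter (· ∈ D2) \ Y.filter (· ∈ D2)) := by omega
      rw [this] at b1
      linarith
    have hemp2 : Y.filter (· ∈ D1) \ Y'.filter (· ∈ D1) = ∅ := by
      rw [← card_eq_zero]
      rw [← card_eq_zero] at hemp
      omega
    have f1 : Y'.filter (· ∈ D1) = Y.filter (· ∈ D1) :=
      h1'.antisymm (sdiff_eq_empty_iff_subset.1 hemp2)
    have f2 : Y.filter (· ∈ D2) = Y'.filter (· ∈ D2) :=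
      h2'.antisymm (sdiff_eq_empty_iff_subset.1 hemp)
    have : Y = Y' := by rw [← hsplit Y hY.1.1, ← hsplit Y' hY'.1.1, f1, f2]
    rw [this]
  · intro a b hab
    rw [Fintype.card_coe, Fintype.card_coe]
    exact hM a b hab

theorem three_mul_choose_mul_choose_le {d₁ d₂ a b c : ℕ} (h₁ : 1 ≤ d₁) (h₂ : 1 ≤ d₂)
    (hd : d₁ + d₂ = 2 * c) (hab : a + b = c) :
    3 * (d₁.choose a * d₂.choose b) ≤ 2 * (2 * c).choose c := by
  have key : ∀ d₁ d₂ a b : ℕ, 1 ≤ d₁ → 1 ≤ d₂ → d₁ + d₂ = 2 * c → a + b = c →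
      d₁ ≤ 2 * a → 3 * (d₁.choose a * d₂.choose b) ≤ 2 * (2 * c).choose c := by
    intro d₁ d₂ a b h₁ h₂ hd hab hle
    have hV := Nat.add_choose_eq d₁ d₂ c
    obtain ⟨a, rfl⟩ : ∃ a', a = a' + 1 := ⟨a - 1, by omega⟩
    by_cases had : d₁ < a + 1
    · simp [Nat.choose_eq_zero_of_lt had]
    push Not at had
    have hA : d₁.choose (a + 1) * (a + 1) = d₁.choose a * (d₁ - a) := Nat.choose_succ_right_eq _ _
    have hB : d₂.choose (b + 1) * (b + 1) = d₂.choose b * (d₂ - b) := Nat.choose_succ_right_eq _ _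
    rcases Nat.lt_or_ge d₁ (2 * (a + 1)) with hlt | hge
    · have hA' : d₁.choose (a + 1) ≤ d₁.choose a := by
        have : d₁ - a ≤ a + 1 := by omega
        nlinarith [Nat.mul_le_mul_left (d₁.choose a) this]
      have hB' : d₂.choose b ≤ d₂.choose (b + 1) := by
        have : b + 1 ≤ d₂ - b := by omega
        nlinarith [Nat.mul_le_mul_left (d₂.choose b) this]
      have hsub : ({(a + 1, b), (a, b + 1)} : Finset (ℕ × ℕ)) ⊆ Finset.HasAntidiagonal.antidiagonal c := by
        intro p hp
        simp only [Finset.mem_insert, Finset.mem_singleton] at hp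
        rcases hp with rfl | rfl <;> simp <;> omega
      have := Finset.sum_le_sum_of_subset (f := fun ij : ℕ × ℕ => d₁.choose ij.1 * d₂.choose ij.2)
        hsub
      rw [← hV, hd, Finset.sum_pair (by simp)] at this
      have := Nat.mul_le_mul hA' hB'
      simp only at *
      omega
    · have hd1 : d₁ = 2 * (a + 1) := by omega
      have hd2 : d₂ = 2 * b := by omega
      obtain ⟨b, rfl⟩ : ∃ b', b = b' + 1 := ⟨b - 1, by omega⟩
      have hA' : d₁.choose (a + 1) ≤ 2 * d₁.choose a := by
        have : d₁ - a ≤ 2 * (a + 1) := by omega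
        nlinarith [Nat.mul_le_mul_left (d₁.choose a) this]
      have hB' : d₂.choose (b + 1) ≤ 2 * d₂.choose (b + 2) := by
        have : b + 1 + 1 ≤ 2 * (d₂ - (b + 1)) := by omega
        have h3 : d₂.choose (b + 1) * (b + 2) ≤ (2 * d₂.choose (b + 2)) * (b + 2) := by
          calc _ ≤ d₂.choose (b + 1) * (2 * (d₂ - (b + 1))) := Nat.mul_le_mul_left _ this
            _ = _ := by linarith
        exact Nat.le_of_mul_le_mul_right h3 (by omega)
      have hA2 : d₁.choose (a + 2) = d₁.choose a := by
        apply Nat.choose_symm_of_eq_add; omega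
      have hB2 : d₂.choose (b + 2) = d₂.choose b := by
        apply Nat.choose_symm_of_eq_add; omega
      have hsub : ({(a + 1, b + 1), (a, b + 2), (a + 2, b)} : Finset (ℕ × ℕ)) ⊆
          Finset.HasAntidiagonal.antidiagonal c := by
        intro p hp
        simp only [Finset.mem_insert, Finset.mem_singleton] at hp
        rcases hp with rfl | rfl | rfl <;> simp <;> omega
      have := Finset.sum_le_sum_of_subset (f := fun ij : ℕ × ℕ => d₁.choose ij.1 * d₂.choose ij.2)
        hsub
      rw [← hV, hd, Finset.sum_insert (by simp), Finset.sum_pair (by simp)] at this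
      simp only [hA2, ← hB2] at this
      have := Nat.mul_le_mul hA' hB'
      nlinarith
  rcases Nat.lt_or_ge (2 * a) d₁ with h | h
  · have := key d₂ d₁ b a h₂ h₁ (by omega) (by omega) (by omega)
    rwa [mul_comm (d₂.choose b)] at this
  · exact key d₁ d₂ a b h₁ h₂ hd hab h

theorem centralBinom_sq_bounds (k : ℕ) (hk : 1 ≤ k) :
    k.centralBinom ^ 2 * (2 * k + 1) ≤ 16 ^ k ∧ 16 ^ k ≤ k.centralBinom ^ 2 * (4 * k) := by
  induction k, hk using Nat.le_induction with
  | base => decide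
  | succ k hk ih =>
    have h := Nat.succ_mul_centralBinom_succ k
    set x := k.centralBinom
    set y := (k + 1).centralBinom
    have h2 : (k + 1) ^ 2 * y ^ 2 = 4 * (2 * k + 1) ^ 2 * x ^ 2 := by
      rw [← mul_pow, h]; ring
    have hp : 0 < (k + 1) ^ 2 := by positivity
    constructor
    · refine Nat.le_of_mul_le_mul_left ?_ hp
      calc (k + 1) ^ 2 * (y ^ 2 * (2 * (k + 1) + 1))
          = ((k + 1) ^ 2 * y ^ 2) * (2 * k + 3) := by ring
        _ = (4 * (2 * k + 1) * (2 * k + 3)) * (x ^ 2 * (2 * k + 1)) := by rw [h2]; ring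
        _ ≤ (4 * (2 * k + 1) * (2 * k + 3)) * 16 ^ k := Nat.mul_le_mul_left _ ih.1
        _ ≤ (16 * (k + 1) ^ 2) * 16 ^ k := Nat.mul_le_mul_right _ (by nlinarith)
        _ = _ := by ring
    · refine Nat.le_of_mul_le_mul_left ?_ hp
      have : 16 ^ k * (4 * k * (k + 1)) ≤ (x ^ 2 * (4 * k)) * (2 * k + 1) ^ 2 := by
        apply Nat.mul_le_mul ih.2; nlinarith
      have h3 : 16 ^ k * (k + 1) ≤ x ^ 2 * (2 * k + 1) ^ 2 := by
        refine Nat.le_of_mul_le_mul_left (c := 4 * k) ?_ (by omega)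
        linarith
      calc (k + 1) ^ 2 * 16 ^ (k + 1) = 16 * (k + 1) * (16 ^ k * (k + 1)) := by ring
        _ ≤ 16 * (k + 1) * (x ^ 2 * (2 * k + 1) ^ 2) := Nat.mul_le_mul_left _ h3
        _ = (4 * (2 * k + 1) ^ 2 * x ^ 2) * (4 * (k + 1)) := by ring
        _ = _ := by rw [← h2]; ring

theorem choose_sq_mul_le (d a : ℕ) : d.choose a ^ 2 * d ≤ 4 ^ d := by
  have h := Nat.choose_le_middle a d
  refine (Nat.mul_le_mul_right d (Nat.pow_le_pow_left h 2)).trans ?_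
  rcases Nat.even_or_odd' d with ⟨k, rfl | rfl⟩
  · rcases Nat.eq_zero_or_pos k with rfl | hk
    · simp
    have := (centralBinom_sq_bounds k hk).1
    rw [Nat.centralBinom_eq_two_mul_choose] at this
    rw [show 2 * k / 2 = k by omega, pow_mul]
    norm_num
    refine le_trans (Nat.mul_le_mul_left _ (by omega)) this
  · rw [show (2 * k + 1) / 2 = k by omega]
    have h1 := (centralBinom_sq_bounds (k + 1) (by omega)).1
    have h2 : (k + 1).centralBinom = 2 * (2 * k + 1).choose k := by
      rw [Nat.centralBinom_eq_two_mul_choose, show 2 * (k + 1) = (2 * k + 1) + 1 by ring,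
        Nat.choose_succ_succ, Nat.choose_symm_half]
      ring
    rw [h2] at h1
    have : 4 ^ (2 * k + 1) * 4 = 16 ^ (k + 1) := by
      rw [← pow_succ, show 2 * k + 1 + 1 = 2 * (k + 1) by ring, pow_mul]
      norm_num
    nlinarith

theorem choose_mul_choose_sq_mul_le {d₁ d₂ a b c μ : ℕ} (h₁ : μ ≤ d₁) (h₂ : μ ≤ d₂)
    (hd : d₁ + d₂ = 2 * c) :
    (d₁.choose a * d₂.choose b) ^ 2 * μ ≤ 4 * (2 * c).choose c ^ 2 := by
  rcases Nat.eq_zero_or_pos μ with rfl | hμ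
  · simp
  have e1 := choose_sq_mul_le d₁ a
  have e2 := choose_sq_mul_le d₂ b
  have e3 := (centralBinom_sq_bounds c (by omega)).2
  rw [Nat.centralBinom_eq_two_mul_choose] at e3
  have e4 : (4 : ℕ) ^ d₁ * 4 ^ d₂ = 16 ^ c := by rw [← pow_add, hd, pow_mul]; norm_num
  have e5 := Nat.mul_le_mul e1 e2
  rw [e4] at e5
  have e6 : μ * (2 * c) ≤ 2 * (d₁ * d₂) := by rw [← hd]; nlinarith
  have hc : 0 < 2 * c := by omega
  refine Nat.le_of_mul_le_mul_right ?_ hc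
  set x := d₁.choose a
  set y := d₂.choose b
  calc (x * y) ^ 2 * μ * (2 * c) = (x * y) ^ 2 * (μ * (2 * c)) := by ring
    _ ≤ (x * y) ^ 2 * (2 * (d₁ * d₂)) := Nat.mul_le_mul_left _ e6
    _ = 2 * (x ^ 2 * d₁ * (y ^ 2 * d₂)) := by ring
    _ ≤ 2 * ((2 * c).choose c ^ 2 * (4 * c)) := by linarith
    _ = _ := by ring

theorem mem_zeroSumSigns {n : ℕ} {A : Matrix (Fin n) (Fin n) Bool} :
    A ∈ zeroSumSigns n ↔ (∀ i, ∑ j, sgn2r A i j = 0) ∧ (∀ j, ∑ i, sgn2r A i j = 0) := by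
  simp [zeroSumSigns]

theorem sgn2r_apply {n : ℕ} (A : Matrix (Fin n) (Fin n) Bool) (i j : Fin n) :
    sgn2r A i j = if A i j then (1 : ℝ) else -1 := rfl

/-- The columns in which the rows `i` and `i'` of `A` differ. -/
def diffSet {n : ℕ} (A : Matrix (Fin n) (Fin n) Bool) (i i' : Fin n) : Finset (Fin n) :=
  {j | A i j ≠ A i' j}

/-- The zero-sum matrices that agree with `A₀` outside the rows `i` and `i'`. -/
def rowClass {n : ℕ} (A₀ : Matrix (Fin n) (Fin n) Bool) (i i' : Fin n) :
    Finset (Matrix (Fin n) (Fin n) Bool) :=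
  {A ∈ zeroSumSigns n | ∀ l, l ≠ i → l ≠ i' → A l = A₀ l}

theorem mem_diffSet {n : ℕ} {A : Matrix (Fin n) (Fin n) Bool} {i i' j : Fin n} :
    j ∈ diffSet A i i' ↔ A i j ≠ A i' j := by
  simp [diffSet]

theorem diffSet_comm {n : ℕ} (A : Matrix (Fin n) (Fin n) Bool) (i i' : Fin n) :
    diffSet A i i' = diffSet A i' i := by
  ext j; simp only [mem_diffSet, ne_comm]

theorem mem_rowClass {n : ℕ} {A₀ A : Matrix (Fin n) (Fin n) Bool} {i i' : Fin n} :
    A ∈ rowClass A₀ i i' ↔ A ∈ zeroSumSigns n ∧ ∀ l, l ≠ i → l ≠ i' → A l = A₀ l := by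
  simp [rowClass]

theorem rowClass_comm {n : ℕ} (A₀ : Matrix (Fin n) (Fin n) Bool) (i i' : Fin n) :
    rowClass A₀ i i' = rowClass A₀ i' i := by
  ext A; simp only [mem_rowClass]; grind

section rowClass

variable {n : ℕ} {A₀ A : Matrix (Fin n) (Fin n) Bool} {i i' : Fin n}

theorem add_eq_add_of_mem_rowClass (h₀ : A₀ ∈ zeroSumSigns n) (hii : i ≠ i')
    (hA : A ∈ rowClass A₀ i i') (j : Fin n) :
    sgn2r A i j + sgn2r A i' j = sgn2r A₀ i j + sgn2r A₀ i' j := by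
  rw [mem_rowClass] at hA
  have h1 := (mem_zeroSumSigns.1 hA.1).2 j
  have h2 := (mem_zeroSumSigns.1 h₀).2 j
  have h3 : ∑ l, (sgn2r A l j - sgn2r A₀ l j) =
      (sgn2r A i j - sgn2r A₀ i j) + (sgn2r A i' j - sgn2r A₀ i' j) := by
    apply Fintype.sum_eq_add _ _ hii
    rintro l ⟨hl, hl'⟩
    simp [sgn2r_apply, hA.2 l hl hl']
  rw [Finset.sum_sub_distrib, h1, h2] at h3
  linarith

theorem entries_of_mem_rowClass (h₀ : A₀ ∈ zeroSumSigns n) (hii : i ≠ i')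
    (hA : A ∈ rowClass A₀ i i') (j : Fin n) :
    (A₀ i j = A₀ i' j → A i j = A₀ i j ∧ A i' j = A₀ i' j) ∧
      (A₀ i j ≠ A₀ i' j → A i' j = !(A i j)) := by
  have := add_eq_add_of_mem_rowClass h₀ hii hA j
  simp only [sgn2r_apply] at this
  revert this
  cases A i j <;> cases A i' j <;> cases A₀ i j <;> cases A₀ i' j <;> norm_num

theorem diffSet_of_mem_rowClass (h₀ : A₀ ∈ zeroSumSigns n) (hii : i ≠ i')
    (hA : A ∈ rowClass A₀ i i') : diffSet A i i' = diffSet A₀ i i' := by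
  ext j
  have := entries_of_mem_rowClass h₀ hii hA j
  simp only [mem_diffSet]
  grind

theorem sum_sgn_eq (D : Finset (Fin n)) (f : Fin n → Bool) :
    ∑ j ∈ D, (if f j then (1 : ℝ) else -1) = 2 * (D.filter (f ·)).card - D.card := by
  have : ∀ j, (if f j then (1 : ℝ) else -1) = 2 * (if f j then (1 : ℝ) else 0) - 1 := by
    intro j; split_ifs <;> norm_num
  simp_rw [this]
  rw [Finset.sum_sub_distrib, ← Finset.mul_sum, Finset.sum_boole]
  simp

theorem sum_diffSet_eq_zero (h₀ : A₀ ∈ zeroSumSigns n) :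
    ∑ j ∈ diffSet A₀ i i', sgn2r A₀ i j = 0 := by
  have h1 := (mem_zeroSumSigns.1 h₀).1 i
  have h2 := (mem_zeroSumSigns.1 h₀).1 i'
  have h3 : ∑ j, (sgn2r A₀ i j - sgn2r A₀ i' j) = 2 * ∑ j ∈ diffSet A₀ i i', sgn2r A₀ i j := by
    rw [Finset.mul_sum, diffSet, Finset.sum_filter]
    apply Finset.sum_congr rfl
    intro j _
    simp only [sgn2r_apply]
    cases A₀ i j <;> cases A₀ i' j <;> norm_num
  rw [Finset.sum_sub_distrib, h1, h2] at h3
  linarith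

theorem two_mul_card_filter_diffSet (h₀ : A₀ ∈ zeroSumSigns n) :
    2 * ((diffSet A₀ i i').filter (A₀ i ·)).card = (diffSet A₀ i i').card := by
  have h := sum_diffSet_eq_zero (i := i) (i' := i') h₀
  simp only [sgn2r_apply] at h
  rw [sum_sgn_eq] at h
  have : (2 * ((diffSet A₀ i i').filter (A₀ i ·)).card : ℝ) = (diffSet A₀ i i').card := by
    linarith
  exact_mod_cast this

theorem card_filter_rowClass_le (h₀ : A₀ ∈ zeroSumSigns n) (hii : i ≠ i')
    (φ : Finset (Fin n) → Prop) :
    ((rowClass A₀ i i').filter fun A => φ ((diffSet A₀ i i').filter (A i ·))).card ≤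
      ((Finset.powersetCard ((diffSet A₀ i i').filter (A₀ i ·)).card
        (diffSet A₀ i i')).filter φ).card := by
  apply Finset.card_le_card_of_injOn (fun A => (diffSet A₀ i i').filter (A i ·))
  · intro A hA
    simp only [Finset.coe_filter, Set.mem_ofPred_eq] at hA
    simp only [Finset.coe_filter, Set.mem_ofPred_eq, Finset.mem_powersetCard]
    refine ⟨⟨Finset.filter_subset _ _, ?_⟩, hA.2⟩
    have h1 := two_mul_card_filter_diffSet (i := i) (i' := i') h₀
    have h2 := two_mul_card_filter_diffSet (i := i) (i' := i') (mem_rowClass.1 hA.1).1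
    rw [diffSet_of_mem_rowClass h₀ hii hA.1] at h2
    omega
  · intro A hA B hB hAB
    simp only [Finset.coe_filter, Set.mem_ofPred_eq] at hA hB
    have key : ∀ j, A i j = B i j := by
      intro j
      have eA := entries_of_mem_rowClass h₀ hii hA.1 j
      have eB := entries_of_mem_rowClass h₀ hii hB.1 j
      by_cases hj : A₀ i j = A₀ i' j
      · rw [(eA.1 hj).1, (eB.1 hj).1]
      · have := Finset.ext_iff.1 hAB j
        simp only [Finset.mem_filter, mem_diffSet] at this
        rw [Bool.eq_iff_iff]
        simpa [hj] using this
    funext l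
    by_cases hl : l = i
    · subst hl; funext j; exact key j
    by_cases hl' : l = i'
    · subst hl'
      funext j
      have eA := entries_of_mem_rowClass h₀ hii hA.1 j
      have eB := entries_of_mem_rowClass h₀ hii hB.1 j
      by_cases hj : A₀ i j = A₀ l j
      · rw [(eA.1 hj).2, (eB.1 hj).2]
      · rw [eA.2 hj, eB.2 hj, key]
    · rw [(mem_rowClass.1 hA.1).2 l hl hl', (mem_rowClass.1 hB.1).2 l hl hl']

/-- Resplit the rows `i` and `i'`: row `i` becomes `true` on `Y` and `false` on the rest of the
difference set, and row `i'` the opposite. -/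
def resplit (A₀ : Matrix (Fin n) (Fin n) Bool) (i i' : Fin n) (Y : Finset (Fin n)) :
    Matrix (Fin n) (Fin n) Bool := fun l j =>
  if A₀ i j = A₀ i' j then A₀ l j
  else if l = i then decide (j ∈ Y) else if l = i' then !decide (j ∈ Y) else A₀ l j

theorem resplit_mem_rowClass (h₀ : A₀ ∈ zeroSumSigns n) (hii : i ≠ i') {Y : Finset (Fin n)}
    (hY : Y ∈ Finset.powersetCard ((diffSet A₀ i i').filter (A₀ i ·)).card (diffSet A₀ i i')) :
    resplit A₀ i i' Y ∈ rowClass A₀ i i' := by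
  rw [Finset.mem_powersetCard] at hY
  have hoff : ∀ l, l ≠ i → l ≠ i' → resplit A₀ i i' Y l = A₀ l := by
    intro l hl hl'; funext j; simp [resplit, hl, hl']
  have hYsum : ∑ j, (if A₀ i j = A₀ i' j then (0 : ℝ) else if j ∈ Y then 1 else -1) = 0 := by
    have e := sum_sgn_eq (diffSet A₀ i i') (fun j => decide (j ∈ Y))
    have e2 : (diffSet A₀ i i').filter (fun j => decide (j ∈ Y) = true) = Y := by
      ext j; simp only [Finset.mem_filter, decide_eq_true_eq]; exact ⟨fun h => h.2, fun h => ⟨hY.1 h, h⟩⟩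
    rw [e2, hY.2] at e
    have e3 := two_mul_card_filter_diffSet (i := i) (i' := i') h₀
    have e4 : (2 * ((diffSet A₀ i i').filter (A₀ i ·)).card : ℝ) = (diffSet A₀ i i').card := by
      exact_mod_cast e3
    rw [e4, sub_self, diffSet, Finset.sum_filter] at e
    refine Eq.trans (Finset.sum_congr rfl fun j _ => ?_) e
    by_cases h : A₀ i j = A₀ i' j <;> simp [h]
  have hcommon : ∀ l, l = i ∨ l = i' →
      ∑ j, (if A₀ i j = A₀ i' j then sgn2r A₀ l j else 0) = 0 := by
    intro l hl
    have e1 := (mem_zeroSumSigns.1 h₀).1 l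
    have e2 : ∑ j ∈ diffSet A₀ i i', sgn2r A₀ l j = 0 := by
      rcases hl with rfl | rfl
      · exact sum_diffSet_eq_zero h₀
      · rw [diffSet_comm]; exact sum_diffSet_eq_zero h₀
    rw [diffSet, Finset.sum_filter] at e2
    have e3 : ∑ j, (if A₀ i j = A₀ i' j then sgn2r A₀ l j else 0) =
        ∑ j, sgn2r A₀ l j - ∑ j, (if A₀ i j ≠ A₀ i' j then sgn2r A₀ l j else 0) := by
      rw [← Finset.sum_sub_distrib]
      apply Finset.sum_congr rfl
      intro j _
      by_cases h : A₀ i j = A₀ i' j <;> simp [h]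
    rw [e3, e1, e2, sub_zero]
  rw [mem_rowClass, mem_zeroSumSigns]
  refine ⟨⟨?_, ?_⟩, hoff⟩
  · intro l
    by_cases hl : l = i
    · subst hl
      refine Eq.trans ?_ ((congrArg₂ (· + ·) (hcommon l (Or.inl rfl)) hYsum).trans (add_zero 0))
      rw [← Finset.sum_add_distrib]
      apply Finset.sum_congr rfl
      intro j _
      simp only [sgn2r_apply, resplit]
      by_cases h : A₀ l j = A₀ i' j <;> simp [h]
    by_cases hl' : l = i'
    · subst hl'
      refine Eq.trans ?_ ((congrArg₂ (· - ·) (hcommon l (Or.inr rfl)) hYsum).trans (sub_zero 0))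
      rw [← Finset.sum_sub_distrib]
      apply Finset.sum_congr rfl
      intro j _
      simp only [sgn2r_apply, resplit]
      by_cases h : A₀ i j = A₀ l j
      · simp [h]
      · by_cases hj : j ∈ Y <;> simp [h, hl, hj]
    · rw [← (mem_zeroSumSigns.1 h₀).1 l]
      apply Finset.sum_congr rfl
      intro j _
      rw [sgn2r_apply, sgn2r_apply, hoff l hl hl']
  · intro j
    rw [← (mem_zeroSumSigns.1 h₀).2 j, ← sub_eq_zero, ← Finset.sum_sub_distrib,
      Fintype.sum_eq_add i i' hii]
    · simp only [sgn2r_apply, resplit]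
      have := hii.symm
      by_cases hj : j ∈ Y <;> cases h : A₀ i j <;> cases h' : A₀ i' j <;> simp [hj, this]
    · rintro l ⟨hl, hl'⟩
      rw [sgn2r_apply, sgn2r_apply, hoff l hl hl', sub_self]

theorem choose_le_card_rowClass (h₀ : A₀ ∈ zeroSumSigns n) (hii : i ≠ i') :
    (diffSet A₀ i i').card.choose ((diffSet A₀ i i').filter (A₀ i ·)).card ≤
      (rowClass A₀ i i').card := by
  rw [← Finset.card_powersetCard]
  apply Finset.card_le_card_of_injOn (resplit A₀ i i')
  · intro Y hY
    exact resplit_mem_rowClass h₀ hii hY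
  · intro Y hY Y' hY' h
    simp only [Finset.mem_coe, Finset.mem_powersetCard] at hY hY'
    ext j
    have hj := congrFun (congrFun h i) j
    by_cases hD : j ∈ diffSet A₀ i i'
    · rw [mem_diffSet] at hD
      simpa [resplit, hD] using hj
    · exact ⟨fun h => absurd (hY.1 h) hD, fun h => absurd (hY'.1 h) hD⟩

theorem card_filter_rowClass_bound (h₀ : A₀ ∈ zeroSumSigns n) (hii : i ≠ i')
    (w : Fin n → ℝ) (t v : ℝ) {M : ℕ}
    (hM : ∀ a b, a + b = ((diffSet A₀ i i').filter (A₀ i ·)).card →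
      ((diffSet A₀ i i').filter (w · ≤ t)).card.choose a *
        ((diffSet A₀ i i').filter (t < w ·)).card.choose b ≤ M) :
    ((rowClass A₀ i i').filter fun A => ∑ j, sgn2r A i j * w j = v).card ≤ M := by
  set D := diffSet A₀ i i' with hD
  set v' : ℝ := (v - ∑ j, (if A₀ i j = A₀ i' j then sgn2r A₀ i j * w j else 0) + ∑ j ∈ D, w j) / 2
    with hv'
  have hb := card_powersetCard_sum_eq_le D w t v' _ M hM
  refine le_trans (le_trans (Finset.card_le_card ?_)
    (card_filter_rowClass_le h₀ hii (fun Y => ∑ j ∈ Y, w j = v'))) hb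
  intro A hA
  rw [Finset.mem_filter] at hA ⊢
  refine ⟨hA.1, ?_⟩
  rw [hv', eq_div_iff two_ne_zero, ← hA.2, Finset.sum_filter, ← hD, hD, diffSet,
    Finset.sum_filter, Finset.sum_filter, Finset.sum_mul, ← Finset.sum_sub_distrib,
    ← Finset.sum_add_distrib]
  apply Finset.sum_congr rfl
  intro j _
  have e := entries_of_mem_rowClass h₀ hii hA.1 j
  simp only [sgn2r_apply]
  by_cases h : A₀ i j = A₀ i' j
  · simp [(e.1 h).1, h]
  · cases A i j <;> simp [h]
    ring

theorem card_filter_diffSet_le_add_lt (D : Finset (Fin n)) (w : Fin n → ℝ) (t : ℝ) :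
    (D.filter (w · ≤ t)).card + (D.filter (t < w ·)).card = D.card := by
  rw [← Finset.card_filter_add_card_filter_not (s := D) (w · ≤ t)]
  simp only [not_le]

theorem three_mul_card_filter_rowClass_le (h₀ : A₀ ∈ zeroSumSigns n) (hii : i ≠ i')
    (w : Fin n → ℝ) (t v : ℝ) (h₁ : 1 ≤ ((diffSet A₀ i i').filter (w · ≤ t)).card)
    (h₂ : 1 ≤ ((diffSet A₀ i i').filter (t < w ·)).card) :
    3 * ((rowClass A₀ i i').filter fun A => ∑ j, sgn2r A i j * w j = v).card ≤
      2 * (rowClass A₀ i i').card := by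
  have hc := choose_le_card_rowClass h₀ hii
  have h2 := two_mul_card_filter_diffSet (i := i) (i' := i') h₀
  rw [← h2] at hc
  have hs := card_filter_diffSet_le_add_lt (diffSet A₀ i i') w t
  rw [← h2] at hs
  set c := ((diffSet A₀ i i').filter (A₀ i ·)).card with hcdef
  have := card_filter_rowClass_bound h₀ hii w t v (M := 2 * (2 * c).choose c / 3) (by
    intro a b hab
    rw [Nat.le_div_iff_mul_le (by norm_num), mul_comm]
    exact three_mul_choose_mul_choose_le h₁ h₂ hs hab)
  omega

theorem card_filter_rowClass_sq_mul_le (h₀ : A₀ ∈ zeroSumSigns n) (hii : i ≠ i')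
    (w : Fin n → ℝ) (t v : ℝ) {μ : ℕ} (hμ : 1 ≤ μ)
    (h₁ : μ ≤ ((diffSet A₀ i i').filter (w · ≤ t)).card)
    (h₂ : μ ≤ ((diffSet A₀ i i').filter (t < w ·)).card) :
    ((rowClass A₀ i i').filter fun A => ∑ j, sgn2r A i j * w j = v).card ^ 2 * μ ≤
      4 * (rowClass A₀ i i').card ^ 2 := by
  have hc := choose_le_card_rowClass h₀ hii
  have h2 := two_mul_card_filter_diffSet (i := i) (i' := i') h₀
  rw [← h2] at hc
  have hs := card_filter_diffSet_le_add_lt (diffSet A₀ i i') w t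
  rw [← h2] at hs
  set c := ((diffSet A₀ i i').filter (A₀ i ·)).card with hcdef
  have := card_filter_rowClass_bound h₀ hii w t v
    (M := Nat.sqrt (4 * (2 * c).choose c ^ 2 / μ)) (by
    intro a b _
    rw [Nat.le_sqrt', Nat.le_div_iff_mul_le (by omega)]
    exact choose_mul_choose_sq_mul_le h₁ h₂ hs)
  rw [Nat.le_sqrt', Nat.le_div_iff_mul_le (by omega)] at this
  exact this.trans (Nat.mul_le_mul_left _ (Nat.pow_le_pow_left hc 2))

end rowClass

/-- If each factor depends only on its own coordinate of `Z` and has conditional mean at most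
one, then so does their product. -/
theorem sum_prod_le_card {α β ι : Type*} (Z : Finset α) (P : Finset ι) (κ : ι → α → β)
    (f : ι → α → ℝ) (hnn : ∀ i A, 0 ≤ f i A)
    (hinv : ∀ i ∈ P, ∀ j ∈ P, i ≠ j → ∀ A ∈ Z, ∀ A' ∈ Z, κ j A = κ j A' → f i A = f i A')
    (havg : ∀ i ∈ P, ∀ A₀ ∈ Z, ∑ A ∈ Z with κ i A = κ i A₀, f i A ≤
      ((Z.filter fun A => κ i A = κ i A₀).card : ℝ)) :
    ∑ A ∈ Z, ∏ i ∈ P, f i A ≤ (Z.card : ℝ) := by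
  induction P using Finset.induction_on with
  | empty => simp
  | insert i P hi ih =>
    have ih' := ih (fun a ha b hb => hinv a (Finset.mem_insert_of_mem ha) b
      (Finset.mem_insert_of_mem hb)) (fun a ha => havg a (Finset.mem_insert_of_mem ha))
    refine le_trans ?_ ih'
    rw [← Finset.sum_fiberwise_of_maps_to (g := κ i) (t := Z.image (κ i))
        (fun A hA => Finset.mem_image_of_mem _ hA),
      ← Finset.sum_fiberwise_of_maps_to (s := Z) (g := κ i) (t := Z.image (κ i))
        (fun A hA => Finset.mem_image_of_mem _ hA)]
    apply Finset.sum_le_sum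
    intro b hb
    obtain ⟨A₀, hA₀, rfl⟩ := Finset.mem_image.1 hb
    have hconst : ∀ A ∈ Z.filter (fun A => κ i A = κ i A₀),
        ∏ j ∈ P, f j A = ∏ j ∈ P, f j A₀ := by
      intro A hA
      rw [Finset.mem_filter] at hA
      apply Finset.prod_congr rfl
      intro j hj
      exact hinv j (Finset.mem_insert_of_mem hj) i (Finset.mem_insert_self _ _)
        (fun h => hi (h ▸ hj)) A hA.1 A₀ hA₀ hA.2
    rw [Finset.sum_congr rfl hconst, Finset.sum_const, nsmul_eq_mul]
    calc _ = ∑ A ∈ Z with κ i A = κ i A₀, f i A * ∏ j ∈ P, f j A₀ := by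
          apply Finset.sum_congr rfl
          intro A hA
          rw [Finset.prod_insert hi, hconst A hA]
      _ = (∑ A ∈ Z with κ i A = κ i A₀, f i A) * ∏ j ∈ P, f j A₀ := by rw [Finset.sum_mul]
      _ ≤ _ := mul_le_mul_of_nonneg_right (havg i (Finset.mem_insert_self _ _) A₀ hA₀)
          (Finset.prod_nonneg fun j _ => hnn j A₀)

/-- Pair up the rows by the involution `τ`.  If, for each pair disjoint from `I` that is good, the
event `ev` has conditional probability at most `q` after resplitting the pair, then the probability
that at least `N` pairs are good, and `ev` holds for all good pairs, is at most `q ^ N`. -/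
theorem card_forall_good_le {n : ℕ} (τ : Fin n → Fin n) (hτ : ∀ i, τ (τ i) = i)
    (I : Finset (Fin n)) (good ev : Fin n → Matrix (Fin n) (Fin n) Bool → Prop)
    (q : ℝ) (hq : 0 < q) (hq1 : q ≤ 1) (N : ℕ) (P : Finset (Fin n))
    (hP : ∀ l ∈ P, l < τ l ∧ l ∉ I ∧ τ l ∉ I)
    (hgood : ∀ l ∈ P, ∀ A ∈ zeroSumSigns n, ∀ A' ∈ zeroSumSigns n, (∀ i ∈ I, A i = A' i) →
      A l = A' l → A (τ l) = A' (τ l) → (good l A ↔ good l A'))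
    (hev : ∀ l ∈ P, ∀ A ∈ zeroSumSigns n, ∀ A' ∈ zeroSumSigns n, (∀ i ∈ I, A i = A' i) →
      A l = A' l → A (τ l) = A' (τ l) → (ev l A ↔ ev l A'))
    (hcls : ∀ l ∈ P, ∀ A₀ ∈ zeroSumSigns n, ∀ A ∈ rowClass A₀ l (τ l), good l A → good l A₀)
    (hprob : ∀ l ∈ P, ∀ A₀ ∈ zeroSumSigns n, good l A₀ →
      (((rowClass A₀ l (τ l)).filter (ev l)).card : ℝ) ≤ q * (rowClass A₀ l (τ l)).card) :
    (((zeroSumSigns n).filter fun A =>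
      (∀ l ∈ P, good l A → ev l A) ∧ N ≤ (P.filter (good · A)).card).card : ℝ) ≤
      q ^ N * (zeroSumSigns n).card := by
  set f : Fin n → Matrix (Fin n) (Fin n) Bool → ℝ :=
    fun l A => if good l A then (if ev l A then q⁻¹ else 0) else 1 with hf
  set κ : Fin n → Matrix (Fin n) (Fin n) Bool → Matrix (Fin n) (Fin n) Bool :=
    fun i A l => if l = i ∨ l = τ i then fun _ => false else A l with hκ
  have hκiff : ∀ i A A', κ i A = κ i A' ↔ ∀ l, l ≠ i → l ≠ τ i → A l = A' l := by
    intro i A A'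
    constructor
    · intro h l hl hl'
      have := congrFun h l
      simpa [hκ, hl, hl'] using this
    · intro h
      funext l
      by_cases hl : l = i ∨ l = τ i
      · simp [hκ, hl]
      · push Not at hl
        simp [hκ, hl, h l hl.1 hl.2]
  have hclass : ∀ i A₀ [DecidablePred fun A => κ i A = κ i A₀], (zeroSumSigns n).filter (fun A => κ i A = κ i A₀) =
      rowClass A₀ i (τ i) := by
    intro i A₀ _
    ext A
    rw [Finset.mem_filter, mem_rowClass, hκiff]
  have hmain := sum_prod_le_card (zeroSumSigns n) P κ f
    (by intro i A; simp only [hf]; split_ifs <;> positivity)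
    (by
      intro i hi j hj hij A hA A' hA' h
      rw [hκiff] at h
      have hne : i ≠ τ j ∧ τ i ≠ j ∧ τ i ≠ τ j := by
        have h1 := (hP i hi).1
        have h2 := (hP j hj).1
        refine ⟨?_, ?_, ?_⟩
        · rintro rfl; rw [hτ] at h1; exact absurd (h1.trans h2) (lt_irrefl _)
        · rintro rfl; rw [hτ] at h2; exact absurd (h1.trans h2) (lt_irrefl _)
        · intro h; apply hij; rw [← hτ i, h, hτ]
      have hI : ∀ l ∈ I, A l = A' l := fun l hl =>
        h l (by rintro rfl; exact (hP l hj).2.1 hl) (by rintro rfl; exact (hP j hj).2.2 hl)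
      have e1 := h i hij hne.1
      have e2 := h (τ i) hne.2.1 hne.2.2
      simp only [hf, hgood i hi A hA A' hA' hI e1 e2, hev i hi A hA A' hA' hI e1 e2])
    (by
      intro i hi A₀ hA₀
      rw [hclass]
      by_cases hg : good i A₀
      · have hle : ∑ A ∈ rowClass A₀ i (τ i), f i A ≤
            ∑ A ∈ rowClass A₀ i (τ i), if ev i A then q⁻¹ else 0 := by
          apply Finset.sum_le_sum
          intro A hA
          have hA' : A₀ ∈ rowClass A i (τ i) := by
            rw [mem_rowClass]
            exact ⟨hA₀, fun l hl hl' => ((mem_rowClass.1 hA).2 l hl hl').symm⟩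
          simp only [hf, hcls i hi A (mem_rowClass.1 hA).1 A₀ hA' hg, if_true, le_refl]
        refine hle.trans ?_
        rw [← Finset.sum_filter, Finset.sum_const, nsmul_eq_mul, ← div_eq_mul_inv,
          div_le_iff₀ hq, mul_comm]
        exact hprob i hi A₀ hA₀ hg
      · rw [← nsmul_one, ← Finset.sum_const]
        apply Finset.sum_le_sum
        intro A hA
        have : ¬ good i A := fun h => hg (hcls i hi A₀ hA₀ A hA h)
        simp [hf, this])
  have hlow : ∀ A ∈ (zeroSumSigns n).filter (fun A =>
      (∀ l ∈ P, good l A → ev l A) ∧ N ≤ (P.filter (good · A)).card),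
      (q⁻¹) ^ N ≤ ∏ i ∈ P, f i A := by
    intro A hA
    rw [Finset.mem_filter] at hA
    have : ∏ i ∈ P, f i A = q⁻¹ ^ (P.filter (good · A)).card := by
      rw [← Finset.prod_const, Finset.prod_filter]
      apply Finset.prod_congr rfl
      intro i hi
      simp only [hf]
      split_ifs with h1 h2
      · rfl
      · exact absurd (hA.2.1 i hi h1) h2
      · rfl
    rw [this]
    exact pow_le_pow_right₀ ((one_le_inv₀ hq).2 hq1) hA.2.2
  have h1 := (Finset.card_nsmul_le_sum _ _ _ hlow).trans
    ((Finset.sum_le_sum_of_subset_of_nonneg (Finset.filter_subset _ _)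
      (fun A _ _ => Finset.prod_nonneg fun i _ => by
        simp only [hf]; split_ifs <;> positivity)).trans hmain)
  rw [nsmul_eq_mul, inv_pow, ← div_eq_mul_inv, div_le_iff₀ (by positivity)] at h1
  rw [mul_comm]
  exact h1

section pairing

variable {n : ℕ}

theorem exists_pairing [NeZero n] (R : Fin n → Fin n → Prop) (hs : ∀ l b, R l b → R b l)
    (hi : ∀ l, ¬ R l l) :
    ∃ s : Fin n, (Finset.univ.filter fun p : Fin n × Fin n => R p.1 p.2).card ≤
      2 * n * (Finset.univ.filter fun l : Fin n => l < s - l ∧ R l (s - l)).card := by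
  by_contra! h
  have h1 : ∀ s : Fin n,
      ((Finset.univ.filter fun p : Fin n × Fin n => R p.1 p.2).filter
        fun p => p.1 + p.2 = s).card ≤
      2 * (Finset.univ.filter fun l : Fin n => l < s - l ∧ R l (s - l)).card := by
    intro s
    set L := Finset.univ.filter fun l : Fin n => l < s - l ∧ R l (s - l) with hL
    have h2 : ((Finset.univ.filter fun p : Fin n × Fin n => R p.1 p.2).filter
        fun p => p.1 + p.2 = s).card ≤ (L ∪ L.image (s - ·)).card := by
      apply Finset.card_le_card_of_injOn (fun p => p.1)
      · rintro ⟨l, b⟩ hp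
        simp only [Finset.coe_filter, Finset.mem_filter, Finset.mem_univ, true_and,
          Set.mem_ofPred_eq] at hp
        obtain ⟨hR, hlb⟩ := hp
        have hb : b = s - l := by rw [← hlb]; abel
        have hl : l = s - b := by rw [← hlb]; abel
        have hne : l ≠ b := by rintro rfl; exact hi _ hR
        simp only [Finset.coe_union, Set.mem_union, Finset.mem_coe, Finset.mem_image]
        rcases lt_or_gt_of_ne hne with hlt | hlt
        · left; simp only [hL, Finset.mem_filter, Finset.mem_univ, true_and]
          rw [← hb]; exact ⟨hlt, hR⟩
        · right
          refine ⟨b, ?_, hl.symm⟩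
          simp only [hL, Finset.mem_filter, Finset.mem_univ, true_and]
          rw [← hl]; exact ⟨hlt, hs _ _ hR⟩
      · rintro ⟨l, b⟩ hp ⟨l', b'⟩ hp' heq
        simp only [Finset.coe_filter, Finset.mem_filter, Finset.mem_univ, true_and,
          Set.mem_ofPred_eq] at hp hp' heq
        subst heq
        have : b = b' := add_left_cancel (hp.2.trans hp'.2.symm)
        rw [this]
    refine h2.trans ((Finset.card_union_le _ _).trans ?_)
    have := Finset.card_image_le (s := L) (f := (s - ·))
    omega
  have h3 := Finset.card_eq_sum_card_fiberwise
    (s := Finset.univ.filter fun p : Fin n × Fin n => R p.1 p.2) (t := Finset.univ)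
    (f := fun p => p.1 + p.2) (fun _ _ => Finset.mem_univ _)
  have hn : 0 < n := Nat.pos_of_ne_zero (NeZero.ne n)
  set C := (Finset.univ.filter fun p : Fin n × Fin n => R p.1 p.2).card with hC
  have h4 : n * C < n * C := by
    calc n * C ≤ n * ∑ s : Fin n,
          2 * (Finset.univ.filter fun l : Fin n => l < s - l ∧ R l (s - l)).card := by
          apply Nat.mul_le_mul_left
          rw [h3]
          exact Finset.sum_le_sum fun s _ => h1 s
      _ = ∑ s : Fin n,
          2 * n * (Finset.univ.filter fun l : Fin n => l < s - l ∧ R l (s - l)).card := by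
          rw [Finset.mul_sum]; exact Finset.sum_congr rfl fun s _ => by ring
      _ < ∑ s : Fin n, C :=
          Finset.sum_lt_sum_of_nonempty ⟨0, Finset.mem_univ _⟩ fun s _ => h s
      _ = n * C := by simp
  exact lt_irrefl _ h4

theorem card_le_of_forall_good_pairs [NeZero n]
    (I : Finset (Fin n)) (good ev : Fin n → Fin n → Matrix (Fin n) (Fin n) Bool → Prop)
    (q : ℝ) (hq : 0 < q) (hq1 : q ≤ 1) (N : ℕ)
    (hI : ∀ l b A, good l b A → l ∉ I ∧ l ≠ b)
    (hsymm : ∀ l b A, good l b A → good b l A)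
    (hgood : ∀ l b, ∀ A ∈ zeroSumSigns n, ∀ A' ∈ zeroSumSigns n, (∀ i ∈ I, A i = A' i) →
      A l = A' l → A b = A' b → (good l b A ↔ good l b A'))
    (hev : ∀ l b, ∀ A ∈ zeroSumSigns n, ∀ A' ∈ zeroSumSigns n, (∀ i ∈ I, A i = A' i) →
      A l = A' l → A b = A' b → (ev l b A ↔ ev l b A'))
    (hcls : ∀ l b, l ≠ b → l ∉ I → b ∉ I → ∀ A₀ ∈ zeroSumSigns n, ∀ A ∈ rowClass A₀ l b,
      good l b A → good l b A₀)
    (hprob : ∀ l b, ∀ A₀ ∈ zeroSumSigns n, good l b A₀ →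
      ∀ S ⊆ rowClass A₀ l b, (∀ A ∈ S, ev l b A) → (S.card : ℝ) ≤ q * (rowClass A₀ l b).card)
    (B : Finset (Matrix (Fin n) (Fin n) Bool)) (hB : ∀ A ∈ B, A ∈ zeroSumSigns n ∧
      (∀ l b, good l b A → ev l b A) ∧ ∃ G : Finset (Fin n × Fin n),
        (∀ p ∈ G, good p.1 p.2 A) ∧ 2 * n * N ≤ G.card) :
    (B.card : ℝ) ≤ n * q ^ N * (zeroSumSigns n).card := by
  set P : Fin n → Finset (Fin n) := fun s =>
    Finset.univ.filter fun l => l < s - l ∧ l ∉ I ∧ s - l ∉ I with hP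
  have key : ∀ s : Fin n, (((zeroSumSigns n).filter fun A =>
      (∀ l ∈ P s, good l (s - l) A → ev l (s - l) A) ∧
        N ≤ ((P s).filter (fun l => good l (s - l) A)).card).card : ℝ) ≤
      q ^ N * (zeroSumSigns n).card := by
    intro s
    refine card_forall_good_le (fun l => s - l) (fun l => sub_sub_cancel s l) I
      (fun l => good l (s - l)) (fun l => ev l (s - l)) q hq hq1 N (P s) ?_ ?_ ?_ ?_ ?_
    · intro l hl; simpa [hP] using hl
    · intro l _ A hA A' hA'; exact hgood l (s - l) A hA A' hA'
    · intro l _ A hA A' hA'; exact hev l (s - l) A hA A' hA'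
    · intro l hl A₀ h₀ A hA
      have : l < s - l ∧ l ∉ I ∧ s - l ∉ I := by simpa [hP] using hl
      exact hcls l (s - l) this.1.ne this.2.1 this.2.2 A₀ h₀ A hA
    · intro l _ A₀ h₀ hg
      exact hprob l (s - l) A₀ h₀ hg _ (Finset.filter_subset _ _)
        fun A hA => (Finset.mem_filter.1 hA).2
  have hsub : B ⊆ (Finset.univ : Finset (Fin n)).biUnion fun s => (zeroSumSigns n).filter fun A =>
      (∀ l ∈ P s, good l (s - l) A → ev l (s - l) A) ∧
        N ≤ ((P s).filter (fun l => good l (s - l) A)).card := by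
    intro A hA
    obtain ⟨hAZ, h1, G, hG, h2⟩ := hB A hA
    replace h2 : 2 * n * N ≤
        (Finset.univ.filter fun p : Fin n × Fin n => good p.1 p.2 A).card :=
      h2.trans (Finset.card_le_card fun p hp => by simpa using hG p hp)
    obtain ⟨s, hs⟩ := exists_pairing (fun l b => good l b A) (fun l b h => hsymm l b A h)
      (fun l h => (hI l l A h).2 rfl)
    simp only [Finset.mem_biUnion, Finset.mem_univ, true_and, Finset.mem_filter]
    refine ⟨s, hAZ, fun l _ h => h1 _ _ h, ?_⟩
    have hn : 0 < 2 * n := by have := NeZero.ne n; omega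
    refine (Nat.le_of_mul_le_mul_left (h2.trans hs) hn).trans (Finset.card_le_card ?_)
    intro l hl
    simp only [Finset.mem_filter, Finset.mem_univ, true_and, hP] at hl ⊢
    exact ⟨⟨hl.1, (hI _ _ _ hl.2).1, (hI _ _ _ (hsymm _ _ _ hl.2)).1⟩, hl.2⟩
  calc _ ≤ (∑ s : Fin n, ((zeroSumSigns n).filter fun A =>
      (∀ l ∈ P s, good l (s - l) A → ev l (s - l) A) ∧
        N ≤ ((P s).filter (fun l => good l (s - l) A)).card).card : ℝ) := by
        exact_mod_cast (Finset.card_le_card hsub).trans Finset.card_biUnion_le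
    _ ≤ ∑ s : Fin n, q ^ N * ((zeroSumSigns n).card : ℝ) := Finset.sum_le_sum fun s _ => key s
    _ = _ := by simp; ring

end pairing

section balance

variable {n : ℕ} {A : Matrix (Fin n) (Fin n) Bool}

theorem two_mul_card_column (hA : A ∈ zeroSumSigns n) (i a : Fin n) :
    2 * (Finset.univ.filter fun b => a ∈ diffSet A i b).card = n := by
  have h := (mem_zeroSumSigns.1 hA).2 a
  simp only [sgn2r_apply] at h
  rw [sum_sgn_eq] at h
  have hc := Finset.card_filter_add_card_filter_not (s := (Finset.univ : Finset (Fin n)))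
    (fun b => A b a = true)
  simp only [Finset.card_univ, Fintype.card_fin] at hc h
  have h' : 2 * (Finset.univ.filter fun b => A b a = true).card = n := by
    have : (2 * (Finset.univ.filter fun b => A b a = true).card : ℝ) = n := by linarith
    exact_mod_cast this
  cases hi : A i a
  · refine Eq.trans ?_ h'
    congr 2; ext b; simp [mem_diffSet, hi]
  · have he : (Finset.univ.filter fun b => a ∈ diffSet A i b) =
        Finset.univ.filter fun b => ¬ A b a = true := by
      ext b; rw [Finset.mem_filter, Finset.mem_filter, mem_diffSet, hi]
      cases A b a <;> simp
    have := congrArg Finset.card he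
    omega

theorem two_mul_sum_card_diffSet_inter (hA : A ∈ zeroSumSigns n) (i : Fin n)
    (U : Finset (Fin n)) : 2 * ∑ b, (diffSet A i b ∩ U).card = n * U.card := by
  have : ∀ b, (diffSet A i b ∩ U).card = ∑ a ∈ U, if a ∈ diffSet A i b then 1 else 0 := by
    intro b
    rw [Finset.sum_boole, Finset.inter_comm, ← Finset.filter_mem_eq_inter]; simp
  simp_rw [this]
  rw [Finset.sum_comm, Finset.mul_sum]
  simp_rw [Finset.sum_boole, Nat.cast_id]
  rw [Finset.sum_congr rfl fun a _ => two_mul_card_column hA i a]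
  simp [mul_comm]

theorem le_three_mul_card_large_inter (hA : A ∈ zeroSumSigns n) (i : Fin n)
    {U : Finset (Fin n)} (hU : U.Nonempty) :
    n ≤ 3 * (Finset.univ.filter fun b => U.card ≤ 4 * (diffSet A i b ∩ U).card).card := by
  have h := two_mul_sum_card_diffSet_inter hA i U
  set G := Finset.univ.filter fun b => U.card ≤ 4 * (diffSet A i b ∩ U).card with hG
  have h1 : ∑ b, 4 * (diffSet A i b ∩ U).card ≤
      ∑ b, (U.card + if b ∈ G then 3 * U.card else 0) := by
    apply Finset.sum_le_sum
    intro b _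
    have : (diffSet A i b ∩ U).card ≤ U.card := Finset.card_le_card Finset.inter_subset_right
    split_ifs with hb
    · omega
    · simp only [hG, Finset.mem_filter, Finset.mem_univ, true_and] at hb; omega
  rw [← Finset.mul_sum, Finset.sum_add_distrib, ← Finset.sum_filter] at h1
  simp at h1
  have hp := hU.card_pos
  have : n * U.card ≤ (3 * G.card) * U.card := by nlinarith
  exact Nat.le_of_mul_le_mul_right this hp

end balance

section quasirandom

variable {n : ℕ} {A₀ : Matrix (Fin n) (Fin n) Bool} {i l b : Fin n}

theorem card_filter_rowClass_le_mul (h₀ : A₀ ∈ zeroSumSigns n) (hlb : l ≠ b)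
    (w : Fin n → ℝ) (t v : ℝ) {μ : ℕ} (hμ : 1 ≤ μ)
    (h₁ : μ ≤ ((diffSet A₀ l b).filter (w · ≤ t)).card)
    (h₂ : μ ≤ ((diffSet A₀ l b).filter (t < w ·)).card) :
    (((rowClass A₀ l b).filter fun A => ∑ j, sgn2r A l j * w j = v).card : ℝ) ≤
      2 / √μ * (rowClass A₀ l b).card := by
  have h := card_filter_rowClass_sq_mul_le h₀ hlb w t v hμ h₁ h₂
  set x := ((rowClass A₀ l b).filter fun A => ∑ j, sgn2r A l j * w j = v).card
  set y := (rowClass A₀ l b).card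
  have h' : (x : ℝ) ^ 2 * μ ≤ 4 * (y : ℝ) ^ 2 := by exact_mod_cast h
  have hpos : (0 : ℝ) < μ := by exact_mod_cast hμ
  have hs : 0 < √(μ : ℝ) := Real.sqrt_pos.2 hpos
  rw [div_mul_eq_mul_div, le_div_iff₀ hs]
  refine abs_le_of_sq_le_sq' ?_ (by positivity) |>.2
  rw [mul_pow, Real.sq_sqrt hpos.le]
  linarith

theorem exists_constant_half (E : Finset (Fin n)) (f : Fin n → Bool) {μ : ℕ}
    (hE : 2 * μ ≤ E.card) :
    ∃ V ⊆ E, V.card = μ ∧ ∃ c, ∀ j ∈ V, f j = c := by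
  have h := Finset.card_filter_add_card_filter_not (s := E) (fun j => f j = true)
  rcases le_total μ (E.filter fun j => f j = true).card with h1 | h1
  · obtain ⟨V, hV, hc⟩ := Finset.exists_subset_card_eq h1
    exact ⟨V, hV.trans (Finset.filter_subset _ _), hc, true,
      fun j hj => (Finset.mem_filter.1 (hV hj)).2⟩
  · have h2 : μ ≤ (E.filter fun j => ¬ f j = true).card := by omega
    obtain ⟨V, hV, hc⟩ := Finset.exists_subset_card_eq h2
    exact ⟨V, hV.trans (Finset.filter_subset _ _), hc, false,
      fun j hj => by simpa using (Finset.mem_filter.1 (hV hj)).2⟩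

theorem card_small_inter_le (h₀ : A₀ ∈ zeroSumSigns n) (hlb : l ≠ b) (hil : i ≠ l) (hib : i ≠ b)
    (U : Finset (Fin n)) (m : ℕ) {μ : ℕ} (hμ : 1 ≤ μ) (hU : 2 * μ ≤ (diffSet A₀ l b ∩ U).card) :
    (((rowClass A₀ l b).filter fun A => (diffSet A i l ∩ U).card < m).card : ℝ) ≤
      2 * m / √μ * (rowClass A₀ l b).card := by
  obtain ⟨V, hVE, hVc, c, hc⟩ := exists_constant_half _ (A₀ i) hU
  set w : Fin n → ℝ := fun j => if j ∈ V then 1 else 0 with hw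
  set v : ℕ → ℝ := fun r => (if c then 1 else -1) * ((μ : ℝ) - 2 * r) with hv
  have hVD : V ⊆ diffSet A₀ l b := hVE.trans Finset.inter_subset_left
  have e1 : (diffSet A₀ l b).filter (w · ≤ 1 / 2) = diffSet A₀ l b \ V := by
    ext j; simp only [Finset.mem_filter, Finset.mem_sdiff, hw]
    split_ifs with h <;> norm_num [h]
  have e2 : (diffSet A₀ l b).filter (1 / 2 < w ·) = V := by
    ext j; simp only [Finset.mem_filter, hw]
    split_ifs with h <;> norm_num [h]
    exact hVD h
  have h1 : μ ≤ ((diffSet A₀ l b).filter (w · ≤ 1 / 2)).card := by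
    rw [e1, Finset.card_sdiff_of_subset hVD]
    have := Finset.card_le_card
      (Finset.inter_subset_left : diffSet A₀ l b ∩ U ⊆ diffSet A₀ l b)
    omega
  have h2 : μ ≤ ((diffSet A₀ l b).filter (1 / 2 < w ·)).card := by rw [e2, hVc]
  have hsub : ((rowClass A₀ l b).filter fun A => (diffSet A i l ∩ U).card < m) ⊆
      (Finset.range m).biUnion fun r =>
        (rowClass A₀ l b).filter fun A => ∑ j, sgn2r A l j * w j = v r := by
    intro A hA
    rw [Finset.mem_filter] at hA
    have hAi : A i = A₀ i := (mem_rowClass.1 hA.1).2 i hil hib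
    simp only [Finset.mem_biUnion, Finset.mem_range, Finset.mem_filter]
    refine ⟨(V.filter (· ∈ diffSet A i l)).card, lt_of_le_of_lt (Finset.card_le_card ?_) hA.2,
      hA.1, ?_⟩
    · intro j hj
      rw [Finset.mem_filter] at hj
      exact Finset.mem_inter.2 ⟨hj.2, (Finset.mem_inter.1 (hVE hj.1)).2⟩
    · simp only [hw, mul_ite, mul_one, mul_zero, hv]
      rw [← Finset.sum_filter, Finset.filter_mem_eq_inter, Finset.univ_inter]
      have : ∀ j ∈ V, sgn2r A l j =
          (if c then 1 else -1) * (1 - 2 * (if j ∈ diffSet A i l then (1 : ℝ) else 0)) := by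
        intro j hj
        have := hc j hj
        rw [sgn2r_apply]
        simp only [mem_diffSet, hAi, this]
        cases c <;> cases A l j <;> norm_num
      rw [Finset.sum_congr rfl this, ← Finset.mul_sum, Finset.sum_sub_distrib, ← Finset.mul_sum,
        Finset.sum_boole]
      simp [hVc]
  calc _ ≤ (∑ r ∈ Finset.range m, ((rowClass A₀ l b).filter fun A =>
        ∑ j, sgn2r A l j * w j = v r).card : ℝ) := by
        exact_mod_cast (Finset.card_le_card hsub).trans Finset.card_biUnion_le
    _ ≤ ∑ r ∈ Finset.range m, 2 / √μ * ((rowClass A₀ l b).card : ℝ) :=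
        Finset.sum_le_sum fun r _ => card_filter_rowClass_le_mul h₀ hlb w (1 / 2) (v r) hμ h1 h2
    _ = _ := by rw [Finset.sum_const, Finset.card_range, nsmul_eq_mul]; ring

/-- The rows whose difference set with row `i` meets `U` in fewer than `m` columns. -/
def closeRows (A : Matrix (Fin n) (Fin n) Bool) (m : ℕ) (i : Fin n) (U : Finset (Fin n)) :
    Finset (Fin n) :=
  {i' | (diffSet A i i' ∩ U).card < m}

theorem mem_closeRows {A : Matrix (Fin n) (Fin n) Bool} {m : ℕ} {i i' : Fin n}
    {U : Finset (Fin n)} : i' ∈ closeRows A m i U ↔ (diffSet A i i' ∩ U).card < m := by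
  simp [closeRows]

/-- No row of `A` is close to many other rows on a large set of columns. -/
def IsSpread (k m : ℕ) (A : Matrix (Fin n) (Fin n) Bool) : Prop :=
  ∀ i U, k ≤ 2 * U.card → 4 * (closeRows A m i U).card ≤ k

theorem card_closeRows_eq_le [NeZero n] (i : Fin n) (U T : Finset (Fin n)) {k m μ N : ℕ} {q : ℝ}
    (hn : 12 ≤ n) (hk : 8 ≤ k) (hμ : 1 ≤ μ) (hμk : 16 * μ ≤ k) (hN : 64 * N ≤ k)
    (hq : 0 < q) (hq1 : q ≤ 1) (hmq : 2 * m / √μ ≤ q)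
    (hU : k ≤ 2 * U.card) (hT : k < 4 * T.card) :
    (((zeroSumSigns n).filter fun A => closeRows A m i U = T).card : ℝ) ≤
      n * q ^ N * (zeroSumSigns n).card := by
  set good : Fin n → Fin n → Matrix (Fin n) (Fin n) Bool → Prop := fun l b A =>
    l ≠ i ∧ b ≠ i ∧ l ≠ b ∧ (l ∈ T ∨ b ∈ T) ∧ U.card ≤ 4 * (diffSet A l b ∩ U).card with hgood
  set ev : Fin n → Fin n → Matrix (Fin n) (Fin n) Bool → Prop := fun l b A =>
    (l ∈ T → (diffSet A i l ∩ U).card < m) ∧ (b ∈ T → (diffSet A i b ∩ U).card < m) with hev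
  have hdiff : ∀ {A A' : Matrix (Fin n) (Fin n) Bool} {x y : Fin n}, A x = A' x → A y = A' y →
      diffSet A x y = diffSet A' x y := by
    intro A A' x y hx hy; ext j; simp [mem_diffSet, hx, hy]
  have main := card_le_of_forall_good_pairs {i} good ev q hq hq1 N ?_ ?_ ?_ ?_ ?_ ?_
    ((zeroSumSigns n).filter fun A => closeRows A m i U = T) ?_
  · exact main
  · rintro l b A ⟨h1, h2, h3, -⟩; exact ⟨by simpa using h1, h3⟩
  · rintro l b A ⟨h1, h2, h3, h4, h5⟩
    exact ⟨h2, h1, h3.symm, h4.symm, by rwa [diffSet_comm]⟩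
  · intro l b A _ A' _ _ hl hb
    simp only [hgood, hdiff hl hb]
  · intro l b A _ A' _ hI hl hb
    have hi : A i = A' i := hI i (by simp)
    simp only [hev, hdiff hi hl, hdiff hi hb]
  · intro l b hlb _ _ A₀ h₀ A hA hg
    simpa only [hgood, diffSet_of_mem_rowClass h₀ hlb hA] using hg
  · rintro l b A₀ h₀ ⟨h1, h2, h3, h4, h5⟩ S hS hSev
    have h6 : 2 * μ ≤ (diffSet A₀ l b ∩ U).card := by omega
    have hcc : ((rowClass A₀ l b).card : ℝ) ≥ 0 := by positivity
    rcases h4 with h4 | h4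
    · have := card_small_inter_le h₀ h3 h1.symm h2.symm U m hμ h6
      refine le_trans (le_trans ?_ this) (mul_le_mul_of_nonneg_right hmq hcc)
      norm_cast
      apply Finset.card_le_card
      intro A hA
      exact Finset.mem_filter.2 ⟨hS hA, (hSev A hA).1 h4⟩
    · rw [diffSet_comm] at h6
      have := card_small_inter_le h₀ h3.symm h2.symm h1.symm U m hμ h6
      rw [rowClass_comm] at this
      refine le_trans (le_trans ?_ this) (mul_le_mul_of_nonneg_right hmq hcc)
      norm_cast
      apply Finset.card_le_card
      intro A hA
      exact Finset.mem_filter.2 ⟨hS hA, (hSev A hA).2 h4⟩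
  · intro A hA
    rw [Finset.mem_filter] at hA
    obtain ⟨hA, hTA⟩ := hA
    refine ⟨hA, fun l b _ => ?_,
      Finset.univ.filter fun p => good p.1 p.2 A, fun p hp => (Finset.mem_filter.1 hp).2, ?_⟩
    · simp only [hev]
      rw [← hTA]
      exact ⟨fun h => mem_closeRows.1 h, fun h => mem_closeRows.1 h⟩
    · have hUne : U.Nonempty := by rw [← Finset.card_pos]; omega
      set G : Fin n → Finset (Fin n) := fun t =>
        Finset.univ.filter fun b => U.card ≤ 4 * (diffSet A t b ∩ U).card with hG
      have hsub : (T.erase i).sigma (fun t => (G t).erase i) ⊆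
          ((Finset.univ.filter fun p : Fin n × Fin n => good p.1 p.2 A).map
            (Equiv.sigmaEquivProd (Fin n) (Fin n)).symm.toEmbedding) := by
        rintro ⟨t, b⟩ h
        simp only [Finset.mem_sigma, Finset.mem_erase, hG, Finset.mem_filter, Finset.mem_univ,
          true_and] at h
        simp only [Finset.mem_map_equiv, Finset.mem_filter, Finset.mem_univ, true_and, hgood]
        refine ⟨h.1.1, h.2.1, ?_, Or.inl h.1.2, h.2.2⟩
        intro htb
        replace htb : t = b := htb
        subst htb
        have h3 := h.2.2
        have : diffSet A t t = ∅ := by ext j; simp [mem_diffSet]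
        simp [this] at h3
        exact hUne.ne_empty h3
      have h1 := Finset.card_le_card hsub
      rw [Finset.card_map, Finset.card_sigma] at h1
      have h2 : ∀ t ∈ T.erase i, n ≤ 4 * ((G t).erase i).card := by
        intro t _
        have := le_three_mul_card_large_inter hA t hUne
        have h3 := Finset.pred_card_le_card_erase (s := G t) (a := i)
        simp only [hG] at h3 ⊢
        omega
      have h3 := Finset.pred_card_le_card_erase (s := T) (a := i)
      have h4 : (T.erase i).card * n ≤ ∑ t ∈ T.erase i, 4 * ((G t).erase i).card := by
        rw [← smul_eq_mul, ← Finset.sum_const]; exact Finset.sum_le_sum h2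
      rw [← Finset.mul_sum] at h4
      have h5 : 8 * N ≤ (T.erase i).card := by omega
      have h6 : 8 * N * n ≤ (T.erase i).card * n := Nat.mul_le_mul_right _ h5
      nlinarith

theorem card_not_isSpread_le [NeZero n] {k m μ N : ℕ} {q : ℝ}
    (hn : 12 ≤ n) (hk : 8 ≤ k) (hμ : 1 ≤ μ) (hμk : 16 * μ ≤ k) (hN : 64 * N ≤ k)
    (hq : 0 < q) (hq1 : q ≤ 1) (hmq : 2 * m / √μ ≤ q) :
    (((zeroSumSigns n).filter fun A => ¬ IsSpread k m A).card : ℝ) ≤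
      n ^ 2 * 4 ^ n * q ^ N * (zeroSumSigns n).card := by
  set S : Finset (Fin n × Finset (Fin n) × Finset (Fin n)) :=
    Finset.univ.filter fun p => k ≤ 2 * p.2.1.card ∧ k < 4 * p.2.2.card with hS
  have hsub : ((zeroSumSigns n).filter fun A => ¬ IsSpread k m A) ⊆
      S.biUnion fun p => (zeroSumSigns n).filter fun A => closeRows A m p.1 p.2.1 = p.2.2 := by
    intro A hA
    rw [Finset.mem_filter, IsSpread] at hA
    obtain ⟨hA, h⟩ := hA
    push Not at h
    obtain ⟨i, U, hU, hT⟩ := h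
    simp only [Finset.mem_biUnion, Finset.mem_filter, hS, Finset.mem_univ, true_and]
    exact ⟨(i, U, closeRows A m i U), ⟨hU, hT⟩, hA, rfl⟩
  calc _ ≤ (∑ p ∈ S, ((zeroSumSigns n).filter fun A =>
        closeRows A m p.1 p.2.1 = p.2.2).card : ℝ) := by
        exact_mod_cast (Finset.card_le_card hsub).trans Finset.card_biUnion_le
    _ ≤ ∑ p ∈ S, n * q ^ N * ((zeroSumSigns n).card : ℝ) := by
        apply Finset.sum_le_sum
        intro p hp
        simp only [hS, Finset.mem_filter, Finset.mem_univ, true_and] at hp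
        exact card_closeRows_eq_le p.1 p.2.1 p.2.2 hn hk hμ hμk hN hq hq1 hmq hp.1 hp.2
    _ = S.card * (n * q ^ N * ((zeroSumSigns n).card : ℝ)) := by
        rw [Finset.sum_const, nsmul_eq_mul]
    _ ≤ (n * (2 ^ n * 2 ^ n) : ℕ) * (n * q ^ N * ((zeroSumSigns n).card : ℝ)) := by
        gcongr
        refine (Finset.card_le_univ _).trans_eq ?_
        simp
    _ = _ := by
        push_cast
        rw [← mul_pow]
        norm_num
        ring

end quasirandom

section sparse

variable {n : ℕ}

theorem exists_finset_pairs_of_forall {L : Finset (Fin n)} {R : Fin n → Fin n → Prop} {c : ℕ}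
    (h : ∀ l ∈ L, ∃ G : Finset (Fin n), c ≤ G.card ∧ ∀ b ∈ G, R l b) :
    ∃ G : Finset (Fin n × Fin n), (∀ p ∈ G, R p.1 p.2) ∧ L.card * c ≤ G.card := by
  choose! G hc hR using h
  refine ⟨(L.sigma G).map (Equiv.sigmaEquivProd (Fin n) (Fin n)).toEmbedding, ?_, ?_⟩
  · intro p hp
    rw [Finset.mem_map_equiv, Finset.mem_sigma] at hp
    exact hR _ hp.1 _ hp.2
  · rw [Finset.card_map, Finset.card_sigma, ← smul_eq_mul, ← Finset.sum_const]
    exact Finset.sum_le_sum hc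

theorem exists_spanning_rows (B : Matrix (Fin n) (Fin n) ℝ) (J : Finset (Fin n)) :
    ∃ I : Finset (Fin n), I.card ≤ J.card ∧ ∀ w : Fin n → ℝ, (∀ j ∉ J, w j = 0) →
      (∀ i ∈ I, ∑ j, B i j * w j = 0) → ∀ i, ∑ j, B i j * w j = 0 := by
  set v : Fin n → (J → ℝ) := fun i j => B i j with hv
  obtain ⟨κ, a, ha, hspan, hli⟩ := exists_linearIndependent' ℝ v
  have : Finite κ := Finite.of_injective a ha
  have : Fintype κ := Fintype.ofFinite κ
  refine ⟨Finset.univ.image a, ?_, ?_⟩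
  · refine Finset.card_image_le.trans ?_
    have := hli.fintype_card_le_finrank
    simpa using this
  · intro w hw hI i
    have hsum : ∀ i, ∑ j, B i j * w j = ∑ j : J, v i j * w j := by
      intro i
      rw [Finset.sum_coe_sort J (fun j => B i j * w j)]
      refine (Finset.sum_subset (Finset.subset_univ J) fun j _ hj => ?_).symm
      rw [hw j hj, mul_zero]
    let φ : (J → ℝ) →ₗ[ℝ] ℝ := ∑ j : J, (w j) • LinearMap.proj j
    have hφ : ∀ x, φ x = ∑ j : J, x j * w j := by
      intro x; simp [φ, mul_comm]
    have hle : Submodule.span ℝ (Set.range v) ≤ LinearMap.ker φ := by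
      rw [← hspan, Submodule.span_le]
      rintro _ ⟨x, rfl⟩
      rw [SetLike.mem_coe, LinearMap.mem_ker, hφ]
      have := hI (a x) (Finset.mem_image_of_mem a (Finset.mem_univ x))
      rw [hsum] at this
      exact this
    rw [hsum, ← hφ]
    exact hle (Submodule.subset_span ⟨i, rfl⟩)

/-- A choice of a nonzero vector supported on `J` and orthogonal to the rows of `A` in `I`. -/
def sparseVec (I J : Finset (Fin n)) (A : Matrix (Fin n) (Fin n) Bool) : Fin n → ℝ :=
  Classical.epsilon fun w => w ≠ 0 ∧ (∀ j ∉ J, w j = 0) ∧ ∀ i ∈ I, ∑ j, sgn2r A i j * w j = 0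

theorem sparseVec_spec {I J : Finset (Fin n)} {A : Matrix (Fin n) (Fin n) Bool}
    (h : ∃ w : Fin n → ℝ, w ≠ 0 ∧ (∀ j ∉ J, w j = 0) ∧
      ∀ i ∈ I, ∑ j, sgn2r A i j * w j = 0) :
    sparseVec I J A ≠ 0 ∧ (∀ j ∉ J, sparseVec I J A j = 0) ∧
      ∀ i ∈ I, ∑ j, sgn2r A i j * sparseVec I J A j = 0 :=
  Classical.epsilon_spec h

theorem sparseVec_congr {I J : Finset (Fin n)} {A A' : Matrix (Fin n) (Fin n) Bool}
    (h : ∀ i ∈ I, A i = A' i) : sparseVec I J A = sparseVec I J A' := by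
  unfold sparseVec
  congr 1
  funext w
  congr 2
  apply propext
  refine forall₂_congr fun i hi => ?_
  simp only [sgn2r_apply, h i hi]

theorem card_sparse_kernel_le_of_support [NeZero n] (I J : Finset (Fin n)) {k m N : ℕ} (hm : 1 ≤ m)
    (hk : 1000 * k ≤ n) (hN : 10 * N ≤ n) (hI : I.card ≤ k) (hJ : J.card ≤ k)
    (B : Finset (Matrix (Fin n) (Fin n) Bool))
    (hB : ∀ A ∈ B, A ∈ zeroSumSigns n ∧ IsSpread k m A ∧
      (∃ z : Fin n → ℝ, z ≠ 0 ∧ (∀ j ∉ J, z j = 0) ∧ ∀ i, ∑ j, sgn2r A i j * z j = 0) ∧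
      ∀ w : Fin n → ℝ, (∀ j ∉ J, w j = 0) →
        (∀ i ∈ I, ∑ j, sgn2r A i j * w j = 0) → ∀ i, ∑ j, sgn2r A i j * w j = 0) :
    (B.card : ℝ) ≤ n * (2 / 3 : ℝ) ^ N * (zeroSumSigns n).card := by
  set good : Fin n → Fin n → Matrix (Fin n) (Fin n) Bool → Prop := fun l b A =>
    l ∉ I ∧ b ∉ I ∧ l ≠ b ∧ ∃ t, (∃ j ∈ diffSet A l b, sparseVec I J A j ≤ t) ∧
      (∃ j ∈ diffSet A l b, t < sparseVec I J A j) with hgood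
  set ev : Fin n → Fin n → Matrix (Fin n) (Fin n) Bool → Prop := fun l _ A =>
    ∑ j, sgn2r A l j * sparseVec I J A j = 0 with hev
  have hdiff : ∀ {A A' : Matrix (Fin n) (Fin n) Bool} {x y : Fin n}, A x = A' x → A y = A' y →
      diffSet A x y = diffSet A' x y := by
    intro A A' x y hx hy; ext j; simp [mem_diffSet, hx, hy]
  have hclsI : ∀ {l b : Fin n} {A₀ A : Matrix (Fin n) (Fin n) Bool}, l ∉ I → b ∉ I →
      A ∈ rowClass A₀ l b → ∀ i ∈ I, A i = A₀ i := by
    intro l b A₀ A hl hb hA i hi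
    exact (mem_rowClass.1 hA).2 i (fun h => hl (h ▸ hi)) (fun h => hb (h ▸ hi))
  refine card_le_of_forall_good_pairs I good ev (2 / 3) (by norm_num) (by norm_num) N
    ?_ ?_ ?_ ?_ ?_ ?_ B ?_
  · rintro l b A ⟨h1, h2, h3, -⟩; exact ⟨h1, h3⟩
  · rintro l b A ⟨h1, h2, h3, h4⟩
    exact ⟨h2, h1, h3.symm, by rwa [diffSet_comm]⟩
  · intro l b A _ A' _ hI hl hb
    simp only [hgood, hdiff hl hb, sparseVec_congr hI]
  · intro l b A _ A' _ hI hl hb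
    simp only [hev, sparseVec_congr hI, sgn2r_apply, hl]
  · intro l b hlb hl hb A₀ h₀ A hA hg
    simpa only [hgood, diffSet_of_mem_rowClass h₀ hlb hA,
      sparseVec_congr (hclsI hl hb hA)] using hg
  · rintro l b A₀ h₀ ⟨h1, h2, h3, t, ⟨j, hj, hjt⟩, ⟨j', hj', hjt'⟩⟩ S hS hSev
    have key := three_mul_card_filter_rowClass_le h₀ h3 (sparseVec I J A₀) t 0
      (Finset.card_pos.2 ⟨j, Finset.mem_filter.2 ⟨hj, hjt⟩⟩)
      (Finset.card_pos.2 ⟨j', Finset.mem_filter.2 ⟨hj', hjt'⟩⟩)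
    have hsub : S ⊆ (rowClass A₀ l b).filter fun A =>
        ∑ j, sgn2r A l j * sparseVec I J A₀ j = 0 := by
      intro A hA
      refine Finset.mem_filter.2 ⟨hS hA, ?_⟩
      rw [← sparseVec_congr (hclsI h1 h2 (hS hA))]
      exact hSev A hA
    have hc := Finset.card_le_card hsub
    have : 3 * S.card ≤ 2 * (rowClass A₀ l b).card := by omega
    have : (3 * S.card : ℝ) ≤ 2 * (rowClass A₀ l b).card := by exact_mod_cast this
    linarith
  · intro A hA
    obtain ⟨hAZ, hsp, ⟨z, hz0, hzJ, hz⟩, hIspan⟩ := hB A hA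
    obtain ⟨hw0, hwJ, hwI⟩ := sparseVec_spec (I := I) (J := J) (A := A)
      ⟨z, hz0, hzJ, fun i _ => hz i⟩
    refine ⟨hAZ, fun l b _ => hIspan _ hwJ hwI l, ?_⟩
    obtain ⟨a, ha⟩ := Function.ne_iff.1 hw0
    have hn : 0 < n := Nat.pos_of_ne_zero (NeZero.ne n)
    have hJc : (Jᶜ).card + J.card = n := by simp
    obtain ⟨G, hG, hGc⟩ := exists_finset_pairs_of_forall (L := Iᶜ)
      (R := fun l b => good l b A) (c := (n - 3 * k) / 2) (by
      intro l hl
      rw [Finset.mem_compl] at hl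
      have hclose := hsp l Jᶜ (by omega)
      have hcol := two_mul_card_column hAZ l a
      set C := Finset.univ.filter fun b => a ∈ diffSet A l b with hC
      refine ⟨(C \ closeRows A m l Jᶜ) \ I, ?_, ?_⟩
      · have e1 := Finset.le_card_sdiff (closeRows A m l Jᶜ) C
        have e2 := Finset.le_card_sdiff I (C \ closeRows A m l Jᶜ)
        omega
      · intro b hb
        simp only [Finset.mem_sdiff, hC, Finset.mem_filter, Finset.mem_univ, true_and,
          mem_closeRows, not_lt] at hb
        obtain ⟨⟨hab, hbm⟩, hbI⟩ := hb
        refine ⟨hl, hbI, ?_, ?_⟩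
        · rintro rfl; simp [mem_diffSet] at hab
        · obtain ⟨j, hj⟩ := Finset.card_pos.1 (show 0 < (diffSet A l b ∩ Jᶜ).card by omega)
          rw [Finset.mem_inter, Finset.mem_compl] at hj
          have hj0 := hwJ j hj.2
          rcases lt_or_gt_of_ne ha with h | h
          · exact ⟨_, ⟨a, hab, le_rfl⟩, ⟨j, hj.1, by rw [hj0]; exact h⟩⟩
          · exact ⟨0, ⟨j, hj.1, hj0.le⟩, ⟨a, hab, h⟩⟩)
    refine ⟨G, hG, le_trans ?_ hGc⟩
    have hIc : (Iᶜ).card + I.card = n := by simp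
    have hcol := two_mul_card_column hAZ a a
    have e1 : 4 * n ≤ 5 * (Iᶜ).card := by omega
    have e3 : n ≤ 4 * ((n - 3 * k) / 2) := by omega
    have e4 := Nat.mul_le_mul e1 e3
    have e5 := Nat.mul_le_mul_left n hN
    nlinarith

theorem card_sparse_kernel_le [NeZero n] {k m N : ℕ} (hm : 1 ≤ m)
    (hk : 1000 * k ≤ n) (hN : 10 * N ≤ n) (B : Finset (Matrix (Fin n) (Fin n) Bool))
    (hB : ∀ A ∈ B, A ∈ zeroSumSigns n ∧ IsSpread k m A ∧ ∃ J : Finset (Fin n), J.card ≤ k ∧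
      ∃ z : Fin n → ℝ, z ≠ 0 ∧ (∀ j ∉ J, z j = 0) ∧ ∀ i, ∑ j, sgn2r A i j * z j = 0) :
    (B.card : ℝ) ≤ ((Finset.univ.filter fun J : Finset (Fin n) => J.card ≤ k).card : ℝ) ^ 2 *
      (n * (2 / 3 : ℝ) ^ N * (zeroSumSigns n).card) := by
  set F := Finset.univ.filter fun J : Finset (Fin n) => J.card ≤ k with hF
  set spans : Finset (Fin n) → Finset (Fin n) → Matrix (Fin n) (Fin n) Bool → Prop :=
    fun I J A => (∃ z : Fin n → ℝ, z ≠ 0 ∧ (∀ j ∉ J, z j = 0) ∧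
        ∀ i, ∑ j, sgn2r A i j * z j = 0) ∧
      ∀ w : Fin n → ℝ, (∀ j ∉ J, w j = 0) →
        (∀ i ∈ I, ∑ j, sgn2r A i j * w j = 0) → ∀ i, ∑ j, sgn2r A i j * w j = 0 with hspans
  have hsub : B ⊆ (F ×ˢ F).biUnion fun p => B.filter (spans p.1 p.2) := by
    intro A hA
    obtain ⟨-, -, J, hJ, hz⟩ := hB A hA
    obtain ⟨I, hIJ, hI⟩ := exists_spanning_rows (sgn2r A) J
    simp only [Finset.mem_biUnion, Finset.mem_product, Finset.mem_filter, hF, Finset.mem_univ,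
      true_and]
    exact ⟨(I, J), ⟨hIJ.trans hJ, hJ⟩, hA, hz, hI⟩
  calc (B.card : ℝ) ≤ (∑ p ∈ F ×ˢ F, (B.filter (spans p.1 p.2)).card : ℝ) := by
        exact_mod_cast (Finset.card_le_card hsub).trans Finset.card_biUnion_le
    _ ≤ ∑ p ∈ F ×ˢ F, n * (2 / 3 : ℝ) ^ N * ((zeroSumSigns n).card : ℝ) := by
        apply Finset.sum_le_sum
        intro p hp
        simp only [Finset.mem_product, hF, Finset.mem_filter, Finset.mem_univ, true_and] at hp
        refine card_sparse_kernel_le_of_support p.1 p.2 hm hk hN hp.1 hp.2 _ ?_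
        intro A hA
        rw [Finset.mem_filter] at hA
        exact ⟨(hB A hA.1).1, (hB A hA.1).2.1, hA.2⟩
    _ = _ := by rw [Finset.sum_const, Finset.card_product, nsmul_eq_mul]; push_cast; ring

theorem card_filter_card_le_mul_pow_le (n k : ℕ) {θ : ℝ} (hθ : 0 < θ) (hθ1 : θ ≤ 1) :
    ((Finset.univ.filter fun J : Finset (Fin n) => J.card ≤ k).card : ℝ) * θ ^ k ≤
      (1 + θ) ^ n := by
  have h : ∑ J : Finset (Fin n), θ ^ J.card = (1 + θ) ^ n := by
    have := Finset.sum_pow_mul_eq_add_pow θ 1 (Finset.univ : Finset (Fin n))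
    simpa [add_comm] using this
  rw [← h, ← nsmul_eq_mul, ← Finset.sum_const]
  refine (Finset.sum_le_sum fun J hJ => ?_).trans
    (Finset.sum_le_sum_of_subset_of_nonneg (Finset.subset_univ _) fun _ _ _ => by positivity)
  exact pow_le_pow_of_le_one hθ.le hθ1 (Finset.mem_filter.1 hJ).2

end sparse

section dense

variable {n : ℕ}

theorem exists_balanced_threshold {k : ℕ} (x : Fin n → ℝ)
    (hx : ∀ c, k < (Finset.univ.filter fun j => x j ≠ c).card) :
    ∃ t, k ≤ 2 * (Finset.univ.filter fun j => x j ≤ t).card ∧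
      k ≤ 2 * (Finset.univ.filter fun j => t < x j).card := by
  rcases Nat.eq_zero_or_pos k with rfl | hk
  · exact ⟨0, by simp, by simp⟩
  set S := Finset.univ.filter fun i : Fin n =>
    k ≤ 2 * (Finset.univ.filter fun j => x j ≤ x i).card with hS
  have hne : (Finset.univ : Finset (Fin n)).Nonempty := by
    obtain ⟨j, -⟩ := Finset.card_pos.1 (lt_of_le_of_lt (Nat.zero_le k) (hx 0))
    exact ⟨j, Finset.mem_univ j⟩
  have hSne : S.Nonempty := by
    obtain ⟨i, -, hi⟩ := Finset.exists_max_image Finset.univ x hne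
    refine ⟨i, ?_⟩
    have h1 : (Finset.univ.filter fun j => x j ≤ x i) = Finset.univ :=
      Finset.filter_true_of_mem hi
    have h2 := hx 0
    have h3 := Finset.card_le_univ (Finset.univ.filter fun j => x j ≠ 0)
    simp only [hS, Finset.mem_filter, Finset.mem_univ, true_and]
    rw [h1, Finset.card_univ]
    omega
  obtain ⟨i, hiS, hi⟩ := Finset.exists_min_image S x hSne
  have hi1 : k ≤ 2 * (Finset.univ.filter fun j => x j ≤ x i).card :=
    (Finset.mem_filter.1 hiS).2
  refine ⟨x i, hi1, ?_⟩
  have hlt : 2 * (Finset.univ.filter fun j => x j < x i).card < k := by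
    rcases Finset.eq_empty_or_nonempty (Finset.univ.filter fun j => x j < x i) with h | h
    · rw [h]; simpa using hk
    · obtain ⟨i', hi', hmax⟩ := Finset.exists_max_image _ x h
      have hi'lt : x i' < x i := (Finset.mem_filter.1 hi').2
      have hnot : i' ∉ S := fun h => absurd (hi i' h) (not_le.2 hi'lt)
      simp only [hS, Finset.mem_filter, Finset.mem_univ, true_and, not_le] at hnot
      refine lt_of_le_of_lt (Nat.mul_le_mul_left 2 (Finset.card_le_card ?_)) hnot
      intro j hj
      exact Finset.mem_filter.2 ⟨Finset.mem_univ _, hmax j hj⟩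
  have hun : (Finset.univ.filter fun j => x j ≠ x i) ⊆
      (Finset.univ.filter fun j => x j < x i) ∪ (Finset.univ.filter fun j => x i < x j) := by
    intro j hj
    simpa using lt_or_gt_of_ne (Finset.mem_filter.1 hj).2
  have h1 := (Finset.card_le_card hun).trans (Finset.card_union_le _ _)
  have h2 := hx (x i)
  omega

/-- The vectors orthogonal to all rows of `A` but the rows `i`, `i'`, and having at least `m`
coordinates on either side of some threshold within the columns where these two rows differ. -/
def IsBalancedVec (m : ℕ) (i i' : Fin n) (A : Matrix (Fin n) (Fin n) Bool) (x : Fin n → ℝ) :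
    Prop :=
  (∀ l, l ≠ i → l ≠ i' → ∑ j, sgn2r A l j * x j = 0) ∧
    ∃ t, m ≤ ((diffSet A i i').filter (x · ≤ t)).card ∧
      m ≤ ((diffSet A i i').filter (t < x ·)).card

/-- A choice of a balanced vector for the rows `i` and `i'` of `A`. -/
def balancedVec (m : ℕ) (i i' : Fin n) (A : Matrix (Fin n) (Fin n) Bool) : Fin n → ℝ :=
  Classical.epsilon (IsBalancedVec m i i' A)

/-- The zero-sum matrices whose row `i` is orthogonal to the chosen balanced vector. -/
def balancedEvent (m : ℕ) (i i' : Fin n) : Finset (Matrix (Fin n) (Fin n) Bool) :=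
  (zeroSumSigns n).filter fun A => IsBalancedVec m i i' A (balancedVec m i i' A) ∧
    ∑ j, sgn2r A i j * balancedVec m i i' A j = 0

theorem isBalancedVec_congr {m : ℕ} {i i' : Fin n} {A₀ A : Matrix (Fin n) (Fin n) Bool}
    (h₀ : A₀ ∈ zeroSumSigns n) (hii : i ≠ i') (hA : A ∈ rowClass A₀ i i') :
    IsBalancedVec m i i' A = IsBalancedVec m i i' A₀ := by
  funext x
  apply propext
  unfold IsBalancedVec
  rw [diffSet_of_mem_rowClass h₀ hii hA]
  refine and_congr_left fun _ => forall_congr' fun l => ?_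
  refine forall₂_congr fun h h' => ?_
  simp only [sgn2r_apply, (mem_rowClass.1 hA).2 l h h']

theorem balancedVec_congr {m : ℕ} {i i' : Fin n} {A₀ A : Matrix (Fin n) (Fin n) Bool}
    (h₀ : A₀ ∈ zeroSumSigns n) (hii : i ≠ i') (hA : A ∈ rowClass A₀ i i') :
    balancedVec m i i' A = balancedVec m i i' A₀ := by
  unfold balancedVec
  rw [isBalancedVec_congr h₀ hii hA]

theorem card_balancedEvent_le {m : ℕ} (hm : 1 ≤ m) {i i' : Fin n} (hii : i ≠ i') :
    ((balancedEvent m i i').card : ℝ) ≤ 2 / √m * (zeroSumSigns n).card := by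
  set κ : Matrix (Fin n) (Fin n) Bool → Matrix (Fin n) (Fin n) Bool :=
    fun A l => if l = i ∨ l = i' then fun _ => false else A l with hκ
  have hκiff : ∀ A A', κ A = κ A' ↔ ∀ l, l ≠ i → l ≠ i' → A l = A' l := by
    intro A A'
    constructor
    · intro h l hl hl'
      have := congrFun h l
      simpa [hκ, hl, hl'] using this
    · intro h
      funext l
      by_cases hl : l = i ∨ l = i'
      · simp [hκ, hl]
      · push Not at hl
        simp [hκ, hl, h l hl.1 hl.2]
  have h1 := Finset.card_eq_sum_card_fiberwise (s := balancedEvent m i i')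
    (t := (zeroSumSigns n).image κ) (f := κ)
    (fun A hA => Finset.mem_image_of_mem κ (Finset.mem_filter.1 hA).1)
  have h2 := Finset.card_eq_sum_card_fiberwise (s := zeroSumSigns n)
    (t := (zeroSumSigns n).image κ) (f := κ) (fun A hA => Finset.mem_image_of_mem κ hA)
  rw [h1, h2]
  push_cast
  rw [Finset.mul_sum]
  apply Finset.sum_le_sum
  intro c hc
  obtain ⟨A₁, h₁, rfl⟩ := Finset.mem_image.1 hc
  have hcls : ((zeroSumSigns n).filter fun A => κ A = κ A₁) = rowClass A₁ i i' := by
    ext A; rw [Finset.mem_filter, mem_rowClass, hκiff]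
  rw [hcls]
  rcases Finset.eq_empty_or_nonempty ((balancedEvent m i i').filter fun A => κ A = κ A₁)
    with he | ⟨A₂, hA₂⟩
  · rw [he]; simp; positivity
  · rw [Finset.mem_filter, balancedEvent, Finset.mem_filter] at hA₂
    have hA₂c : A₂ ∈ rowClass A₁ i i' := by rw [← hcls]; exact Finset.mem_filter.2 ⟨hA₂.1.1, hA₂.2⟩
    have hb := hA₂.1.2.1
    rw [isBalancedVec_congr h₁ hii hA₂c, balancedVec_congr h₁ hii hA₂c] at hb
    obtain ⟨-, t, ht1, ht2⟩ := hb
    refine le_trans ?_ (card_filter_rowClass_le_mul h₁ hii (balancedVec m i i' A₁) t 0 hm ht1 ht2)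
    norm_cast
    apply Finset.card_le_card
    intro A hA
    rw [Finset.mem_filter, balancedEvent, Finset.mem_filter] at hA
    have hAc : A ∈ rowClass A₁ i i' := by rw [← hcls]; exact Finset.mem_filter.2 ⟨hA.1.1, hA.2⟩
    refine Finset.mem_filter.2 ⟨hAc, ?_⟩
    rw [← balancedVec_congr h₁ hii hAc]
    exact hA.1.2.2

theorem mem_balancedEvent_of_kernel {m : ℕ} {A : Matrix (Fin n) (Fin n) Bool}
    (hA : A ∈ zeroSumSigns n) {x y : Fin n → ℝ} (hx : ∀ l, ∑ j, sgn2r A l j * x j = 0)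
    (hy : ∀ j, ∑ l, y l * sgn2r A l j = 0) {i i' : Fin n} (hyi : y i' ≠ y i) {t : ℝ}
    (h₁ : m ≤ ((diffSet A i i').filter (x · ≤ t)).card)
    (h₂ : m ≤ ((diffSet A i i').filter (t < x ·)).card) :
    A ∈ balancedEvent m i i' := by
  have hii : i ≠ i' := by rintro rfl; exact hyi rfl
  have hspec : IsBalancedVec m i i' A (balancedVec m i i' A) :=
    Classical.epsilon_spec (p := IsBalancedVec m i i' A) ⟨x, fun l _ _ => hx l, t, h₁, h₂⟩
  refine Finset.mem_filter.2 ⟨hA, hspec, ?_⟩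
  set x' := balancedVec m i i' A
  have hsum : ∑ l, (y l - y i') * ∑ j, sgn2r A l j * x' j = 0 := by
    simp_rw [Finset.mul_sum]
    rw [Finset.sum_comm]
    apply Finset.sum_eq_zero
    intro j _
    have : ∀ l, (y l - y i') * (sgn2r A l j * x' j) =
        (y l * sgn2r A l j) * x' j - y i' * x' j * sgn2r A l j := fun l => by ring
    simp_rw [this]
    rw [Finset.sum_sub_distrib, ← Finset.sum_mul, ← Finset.mul_sum, hy,
      (mem_zeroSumSigns.1 hA).2 j]
    simp
  rw [Fintype.sum_eq_single i] at hsum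
  · exact (mul_eq_zero.1 hsum).resolve_left (sub_ne_zero.2 hyi.symm)
  · intro l hl
    by_cases h : l = i'
    · simp [h]
    · rw [hspec.1 l hl h, mul_zero]

theorem card_dense_kernel_mul_le {k m : ℕ} (hm : 1 ≤ m)
    (B : Finset (Matrix (Fin n) (Fin n) Bool))
    (hB : ∀ A ∈ B, A ∈ zeroSumSigns n ∧ IsSpread k m A ∧ ∃ x y : Fin n → ℝ,
      (∀ l, ∑ j, sgn2r A l j * x j = 0) ∧ (∀ j, ∑ l, y l * sgn2r A l j = 0) ∧
      (∀ c, k < (Finset.univ.filter fun j => x j ≠ c).card) ∧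
      ∀ c, k < (Finset.univ.filter fun j => y j ≠ c).card) :
    (B.card : ℝ) * (n * k) ≤ 4 * n ^ 2 / √m * (zeroSumSigns n).card := by
  set O := (Finset.univ : Finset (Fin n × Fin n)).filter fun p => p.1 ≠ p.2 with hO
  have hcount : ∀ A ∈ B, n * k ≤ 2 * (O.filter fun p => A ∈ balancedEvent m p.1 p.2).card := by
    intro A hA
    obtain ⟨hAZ, hsp, x, y, hx, hy, hxk, hyk⟩ := hB A hA
    obtain ⟨t, ht1, ht2⟩ := exists_balanced_threshold x hxk
    set U₁ := Finset.univ.filter fun j => x j ≤ t with hU₁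
    set U₂ := Finset.univ.filter fun j => t < x j with hU₂
    obtain ⟨G, hG, hGc⟩ := exists_finset_pairs_of_forall (L := Finset.univ)
      (R := fun i i' => i ≠ i' ∧ A ∈ balancedEvent m i i') (c := (k + 1) / 2) (by
      intro i _
      set Y := Finset.univ.filter fun j => y j ≠ y i with hY
      refine ⟨(Y \ closeRows A m i U₁) \ closeRows A m i U₂, ?_, ?_⟩
      · have e1 := Finset.le_card_sdiff (closeRows A m i U₁) Y
        have e2 := Finset.le_card_sdiff (closeRows A m i U₂) (Y \ closeRows A m i U₁)
        have e3 : k < Y.card := hyk (y i)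
        have e4 := hsp i U₁ ht1
        have e5 := hsp i U₂ ht2
        omega
      · intro i' hi'
        simp only [Finset.mem_sdiff, hY, Finset.mem_filter, Finset.mem_univ, true_and,
          mem_closeRows, not_lt] at hi'
        obtain ⟨⟨hyi, h1⟩, h2⟩ := hi'
        refine ⟨by rintro rfl; exact hyi rfl,
          mem_balancedEvent_of_kernel hAZ hx hy hyi (t := t) (h1.trans_eq ?_) (h2.trans_eq ?_)⟩
        · congr 1; ext j; simp [hU₁]
        · congr 1; ext j; simp [hU₂])
    have hsub : G ⊆ O.filter fun p => A ∈ balancedEvent m p.1 p.2 := by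
      intro p hp
      exact Finset.mem_filter.2
        ⟨Finset.mem_filter.2 ⟨Finset.mem_univ _, (hG p hp).1⟩, (hG p hp).2⟩
    have h := hGc.trans (Finset.card_le_card hsub)
    rw [Finset.card_univ, Fintype.card_fin] at h
    calc n * k ≤ n * (2 * ((k + 1) / 2)) := Nat.mul_le_mul_left _ (by omega)
      _ = 2 * (n * ((k + 1) / 2)) := by ring
      _ ≤ _ := Nat.mul_le_mul_left 2 h
  have hdc : B.card * (n * k) ≤ 2 * ∑ p ∈ O, (balancedEvent m p.1 p.2).card := by
    calc B.card * (n * k) = ∑ A ∈ B, n * k := by simp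
      _ ≤ ∑ A ∈ B, 2 * (O.filter fun p => A ∈ balancedEvent m p.1 p.2).card :=
          Finset.sum_le_sum hcount
      _ = 2 * ∑ p ∈ O, (B.filter fun A => A ∈ balancedEvent m p.1 p.2).card := by
          rw [← Finset.mul_sum]
          congr 1
          simp_rw [Finset.card_filter]
          exact Finset.sum_comm
      _ ≤ _ := by
          gcongr with p _
          exact fun A hA => (Finset.mem_filter.1 hA).2
  calc (B.card : ℝ) * (n * k) ≤ 2 * ∑ p ∈ O, ((balancedEvent m p.1 p.2).card : ℝ) := by
        exact_mod_cast hdc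
    _ ≤ 2 * ∑ p ∈ O, 2 / √m * ((zeroSumSigns n).card : ℝ) := by
        gcongr with p hp
        exact card_balancedEvent_le hm (Finset.mem_filter.1 hp).2
    _ = 2 * (O.card * (2 / √m * ((zeroSumSigns n).card : ℝ))) := by
        rw [Finset.sum_const, nsmul_eq_mul]
    _ ≤ 2 * ((n ^ 2 : ℕ) * (2 / √m * ((zeroSumSigns n).card : ℝ))) := by
        gcongr
        refine (Finset.card_le_univ _).trans_eq ?_
        simp [sq]
    _ = _ := by push_cast; ring

end dense

section assembly

variable {n : ℕ}

theorem sgn2r_transpose (A : Matrix (Fin n) (Fin n) Bool) :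
    sgn2r A.transpose = (sgn2r A).transpose := rfl

theorem transpose_mem_zeroSumSigns {A : Matrix (Fin n) (Fin n) Bool} (hA : A ∈ zeroSumSigns n) :
    A.transpose ∈ zeroSumSigns n := by
  rw [mem_zeroSumSigns] at hA ⊢
  exact ⟨hA.2, hA.1⟩

theorem card_filter_transpose_le (p : Matrix (Fin n) (Fin n) Bool → Prop) :
    ((zeroSumSigns n).filter fun A => p A.transpose).card ≤ ((zeroSumSigns n).filter p).card := by
  apply Finset.card_le_card_of_injOn Matrix.transpose
  · intro A hA
    simp only [Finset.coe_filter, Set.mem_ofPred_eq] at hA ⊢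
    exact ⟨transpose_mem_zeroSumSigns hA.1, hA.2⟩
  · exact Matrix.transpose_injective.injOn

theorem zeroSumSigns_nonempty (hn : Even n) : (zeroSumSigns n).Nonempty := by
  have key : ∀ i : Fin n, ∑ j : Fin n, (if Even (i.val + j.val) then (1 : ℝ) else -1) = 0 := by
    intro i
    have h := Equiv.sum_comp (Fin.revPerm : Equiv.Perm (Fin n))
      (fun j => if Even (i.val + j.val) then (1 : ℝ) else -1)
    have h2 : ∀ j : Fin n, (if Even (i.val + (Fin.revPerm j).val) then (1 : ℝ) else -1) =
        -(if Even (i.val + j.val) then (1 : ℝ) else -1) := by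
      intro j
      have hr : (Fin.revPerm j).val = n - (j.val + 1) := by simp [Fin.val_rev]
      have hj := j.isLt
      have : Even (i.val + (Fin.revPerm j).val) ↔ ¬ Even (i.val + j.val) := by
        rw [hr]
        obtain ⟨h, rfl⟩ := hn
        simp only [Nat.even_iff]
        omega
      by_cases h3 : Even (i.val + j.val) <;> simp only [this, h3] <;> simp
    simp_rw [h2] at h
    rw [Finset.sum_neg_distrib] at h
    linarith
  refine ⟨fun i j => decide (Even (i.val + j.val)), mem_zeroSumSigns.2 ⟨fun i => ?_, fun j => ?_⟩⟩
  · refine Eq.trans (Finset.sum_congr rfl fun j _ => ?_) (key i)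
    simp [sgn2r]
  · refine Eq.trans (Finset.sum_congr rfl fun i _ => ?_) (key j)
    simp [sgn2r, add_comm]

/-- `A` has a nonzero null vector with at most `k` nonzero coordinates. -/
def HasSparseKernel (k : ℕ) (A : Matrix (Fin n) (Fin n) Bool) : Prop :=
  ∃ J : Finset (Fin n), J.card ≤ k ∧
    ∃ z : Fin n → ℝ, z ≠ 0 ∧ (∀ j ∉ J, z j = 0) ∧ ∀ i, ∑ j, sgn2r A i j * z j = 0

theorem span_one_le_ker {A : Matrix (Fin n) (Fin n) Bool} (hA : A ∈ zeroSumSigns n) :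
    Submodule.span ℝ {fun _ => (1 : ℝ)} ≤ LinearMap.ker (Matrix.mulVecLin (sgn2r A)) := by
  rw [Submodule.span_singleton_le_iff_mem, LinearMap.mem_ker]
  funext i
  simpa [Matrix.mulVec, dotProduct] using (mem_zeroSumSigns.1 hA).1 i

theorem exists_mem_ker_not_mem_span {A : Matrix (Fin n) (Fin n) Bool} (hA : A ∈ zeroSumSigns n)
    (h : LinearMap.ker (Matrix.mulVecLin (sgn2r A)) ≠ Submodule.span ℝ {fun _ => (1 : ℝ)}) :
    ∃ x : Fin n → ℝ, (∀ i, ∑ j, sgn2r A i j * x j = 0) ∧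
      x ∉ Submodule.span ℝ {fun _ : Fin n => (1 : ℝ)} := by
  obtain ⟨x, hx, hx'⟩ := SetLike.exists_of_lt (lt_of_le_of_ne (span_one_le_ker hA) h.symm)
  refine ⟨x, fun i => ?_, hx'⟩
  rw [LinearMap.mem_ker] at hx
  exact congrFun hx i

theorem ker_transpose_ne_span {A : Matrix (Fin n) (Fin n) Bool}
    (hA : A ∈ zeroSumSigns n)
    (h : LinearMap.ker (Matrix.mulVecLin (sgn2r A)) ≠ Submodule.span ℝ {fun _ => (1 : ℝ)}) :
    LinearMap.ker (Matrix.mulVecLin (sgn2r A.transpose)) ≠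
      Submodule.span ℝ {fun _ => (1 : ℝ)} := by
  intro he
  have hlt := Submodule.finrank_lt_finrank_of_lt (lt_of_le_of_ne (span_one_le_ker hA) h.symm)
  have h1 := LinearMap.finrank_range_add_finrank_ker (Matrix.mulVecLin (sgn2r A))
  have h2 := LinearMap.finrank_range_add_finrank_ker (Matrix.mulVecLin (sgn2r A.transpose))
  have h3 : (sgn2r A.transpose).rank = (sgn2r A).rank := by
    rw [sgn2r_transpose, Matrix.rank_transpose]
  rw [Matrix.rank, Matrix.rank] at h3
  rw [he] at h2
  omega

theorem lt_card_ne_of_not_hasSparseKernel {k : ℕ} {A : Matrix (Fin n) (Fin n) Bool}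
    (hA : A ∈ zeroSumSigns n) (hs : ¬ HasSparseKernel k A) {x : Fin n → ℝ}
    (hx : ∀ i, ∑ j, sgn2r A i j * x j = 0)
    (hx' : x ∉ Submodule.span ℝ {fun _ : Fin n => (1 : ℝ)}) (c : ℝ) :
    k < (Finset.univ.filter fun j => x j ≠ c).card := by
  by_contra! hle
  refine hs ⟨_, hle, fun j => x j - c, fun h0 => hx' ?_, fun j hj => ?_, fun i => ?_⟩
  · rw [Submodule.mem_span_singleton]
    refine ⟨c, funext fun j => ?_⟩
    have := congrFun h0 j
    simp only [Pi.zero_apply] at this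
    simp only [Pi.smul_apply, smul_eq_mul, mul_one]
    linarith
  · simpa [sub_eq_zero] using hj
  · simp_rw [mul_sub]
    rw [Finset.sum_sub_distrib, hx, ← Finset.sum_mul, (mem_zeroSumSigns.1 hA).1 i]
    simp

theorem card_ker_ne_span_le {k m : ℕ} {a b c : ℝ}
    (ha : (((zeroSumSigns n).filter fun A => ¬ IsSpread k m A).card : ℝ) ≤ a)
    (hb : (((zeroSumSigns n).filter fun A => IsSpread k m A ∧ HasSparseKernel k A).card : ℝ) ≤ b)
    (hc : ∀ B : Finset (Matrix (Fin n) (Fin n) Bool),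
      (∀ A ∈ B, A ∈ zeroSumSigns n ∧ IsSpread k m A ∧ ∃ x y : Fin n → ℝ,
        (∀ l, ∑ j, sgn2r A l j * x j = 0) ∧ (∀ j, ∑ l, y l * sgn2r A l j = 0) ∧
        (∀ c, k < (Finset.univ.filter fun j => x j ≠ c).card) ∧
        ∀ c, k < (Finset.univ.filter fun j => y j ≠ c).card) → (B.card : ℝ) ≤ c) :
    (((zeroSumSigns n).filter fun A => LinearMap.ker (Matrix.mulVecLin (sgn2r A)) ≠
      Submodule.span ℝ {fun _ => (1 : ℝ)}).card : ℝ) ≤ 2 * a + 2 * b + c := by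
  obtain ⟨p, hp⟩ : ∃ p : Matrix (Fin n) (Fin n) Bool → Prop, ∀ A, p A ↔ ¬ IsSpread k m A :=
    ⟨_, fun _ => Iff.rfl⟩
  obtain ⟨r, hr⟩ : ∃ r : Matrix (Fin n) (Fin n) Bool → Prop,
      ∀ A, r A ↔ IsSpread k m A ∧ HasSparseKernel k A := ⟨_, fun _ => Iff.rfl⟩
  simp_rw [← hp] at ha
  simp_rw [← hr] at hb
  set bad := (zeroSumSigns n).filter fun A => LinearMap.ker (Matrix.mulVecLin (sgn2r A)) ≠
      Submodule.span ℝ {fun _ => (1 : ℝ)} with hbad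
  set B := bad.filter fun A => ¬ p A ∧ ¬ r A ∧ ¬ p A.transpose ∧ ¬ r A.transpose with hB
  have hBc := hc B (by
    intro A hA
    simp only [hB, hbad, Finset.mem_filter] at hA
    obtain ⟨⟨hAZ, hker⟩, hpA, hrA, hpT, hrT⟩ := hA
    rw [hp, not_not] at hpA hpT
    rw [hr] at hrA hrT
    have hTZ := transpose_mem_zeroSumSigns hAZ
    obtain ⟨x, hx, hx'⟩ := exists_mem_ker_not_mem_span hAZ hker
    obtain ⟨y, hy, hy'⟩ := exists_mem_ker_not_mem_span hTZ (ker_transpose_ne_span hAZ hker)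
    refine ⟨hAZ, hpA, x, y, hx, fun j => ?_,
      lt_card_ne_of_not_hasSparseKernel hAZ (fun h => hrA ⟨hpA, h⟩) hx hx',
      lt_card_ne_of_not_hasSparseKernel hTZ (fun h => hrT ⟨hpT, h⟩) hy hy'⟩
    rw [← hy j]
    exact Finset.sum_congr rfl fun l _ => mul_comm _ _)
  have hsub : bad ⊆ (zeroSumSigns n).filter p ∪ ((zeroSumSigns n).filter r ∪
      ((zeroSumSigns n).filter (fun A => p A.transpose) ∪
        ((zeroSumSigns n).filter (fun A => r A.transpose) ∪ B))) := by
    intro A hA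
    have hAZ := (Finset.mem_filter.1 hA).1
    simp only [Finset.mem_union, Finset.mem_filter, hAZ, true_and, hB, hA]
    tauto
  have h1 := Finset.card_le_card hsub
  have h2 := card_filter_transpose_le p
  have h3 := card_filter_transpose_le r
  have h4 : bad.card ≤ 2 * ((zeroSumSigns n).filter p).card +
      2 * ((zeroSumSigns n).filter r).card + B.card := by
    refine h1.trans ((Finset.card_union_le _ _).trans ?_)
    have e1 := Finset.card_union_le ((zeroSumSigns n).filter (fun A => r A.transpose)) B
    have e2 := Finset.card_union_le ((zeroSumSigns n).filter (fun A => p A.transpose))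
      ((zeroSumSigns n).filter (fun A => r A.transpose) ∪ B)
    have e3 := Finset.card_union_le ((zeroSumSigns n).filter r)
      ((zeroSumSigns n).filter (fun A => p A.transpose) ∪
        ((zeroSumSigns n).filter (fun A => r A.transpose) ∪ B))
    omega
  have h5 : (bad.card : ℝ) ≤ 2 * ((zeroSumSigns n).filter p).card +
      2 * ((zeroSumSigns n).filter r).card + B.card := by exact_mod_cast h4
  linarith

end assembly

section asymptotics

open Filter Topology

theorem eventually_card_not_isSpread_le (m : ℕ) {δ : ℝ} (hδ : 0 < δ) :
    ∀ᶠ n : ℕ in atTop, (((zeroSumSigns n).filter fun A => ¬ IsSpread (n / 1100) m A).card : ℝ) ≤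
      δ * (zeroSumSigns n).card := by
  obtain ⟨c, hc⟩ : ∃ c : ℕ, c = 281600 := ⟨_, rfl⟩
  have hq : (0 : ℝ) < (1 / 8) ^ c := by positivity
  have t1 : Tendsto (fun n : ℕ => (n : ℝ) ^ 2 * (1 / 2 : ℝ) ^ n) atTop (𝓝 0) :=
    tendsto_pow_const_mul_const_pow_of_lt_one 2 (by norm_num) (by norm_num)
  have t0 : Tendsto (fun n : ℕ => n / 1100 / 16) atTop atTop :=
    (Nat.tendsto_div_const_atTop (by norm_num)).comp (Nat.tendsto_div_const_atTop (by norm_num))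
  have t2 : Tendsto (fun n : ℕ => 2 * (m : ℝ) / √((n / 1100 / 16 : ℕ) : ℝ)) atTop (𝓝 0) :=
    Tendsto.const_div_atTop (Real.tendsto_sqrt_atTop.comp
      (tendsto_natCast_atTop_atTop.comp t0)) _
  filter_upwards [t1.eventually_le_const hδ, t2.eventually_le_const hq,
    eventually_ge_atTop 1100000] with n h1 h2 hn
  have : NeZero n := ⟨by omega⟩
  have h := card_not_isSpread_le (n := n) (k := n / 1100) (m := m) (μ := n / 1100 / 16)
    (N := n / 1100 / 64) (by omega) (by omega) (by omega) (by omega) (by omega) hq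
    (pow_le_one₀ (by norm_num) (by norm_num)) h2
  refine h.trans (mul_le_mul_of_nonneg_right ?_ (Nat.cast_nonneg _))
  refine le_trans ?_ h1
  have hle : n ≤ c * (n / 1100 / 64) := by rw [hc]; omega
  have h3 : ((1 / 8 : ℝ) ^ c) ^ (n / 1100 / 64) ≤ (1 / 8) ^ n := by
    rw [← pow_mul]
    exact pow_le_pow_of_le_one (by norm_num) (by norm_num) hle
  calc (n : ℝ) ^ 2 * 4 ^ n * ((1 / 8 : ℝ) ^ c) ^ (n / 1100 / 64)
      ≤ (n : ℝ) ^ 2 * 4 ^ n * (1 / 8) ^ n := by gcongr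
    _ = (n : ℝ) ^ 2 * (1 / 2 : ℝ) ^ n := by
        rw [mul_assoc, ← mul_pow]; norm_num

theorem two_hundred_le_pow : (200 : ℝ) ≤ (1 + 1 / 200) ^ 1100 := by
  have h : (1.64 : ℝ) ≤ (1 + 1 / 200) ^ 100 := by norm_num
  calc (200 : ℝ) ≤ 1.64 ^ 11 := by norm_num
    _ ≤ ((1 + 1 / 200) ^ 100) ^ 11 := by gcongr
    _ = _ := by rw [← pow_mul]

theorem card_filter_card_le_div_le (n : ℕ) :
    ((Finset.univ.filter fun J : Finset (Fin n) => J.card ≤ n / 1100).card : ℝ) ≤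
      (1 + 1 / 200) ^ (2 * n) := by
  have h := card_filter_card_le_mul_pow_le n (n / 1100) (θ := 1 / 200) (by norm_num) (by norm_num)
  have h1 : (200 : ℝ) ^ (n / 1100) ≤ (1 + 1 / 200) ^ n := by
    calc (200 : ℝ) ^ (n / 1100) ≤ ((1 + 1 / 200) ^ 1100) ^ (n / 1100) := by
          gcongr; exact two_hundred_le_pow
      _ = (1 + 1 / 200) ^ (1100 * (n / 1100)) := by rw [← pow_mul]
      _ ≤ (1 + 1 / 200) ^ n := pow_le_pow_right₀ (by norm_num) (Nat.mul_div_le n 1100)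
  rw [two_mul, pow_add]
  calc _ = ((Finset.univ.filter fun J : Finset (Fin n) => J.card ≤ n / 1100).card : ℝ) *
        (1 / 200) ^ (n / 1100) * 200 ^ (n / 1100) := by
        rw [mul_assoc, ← mul_pow]; norm_num
    _ ≤ _ := mul_le_mul h h1 (by positivity) (by positivity)

theorem eventually_card_hasSparseKernel_le {m : ℕ} (hm : 1 ≤ m) {δ : ℝ} (hδ : 0 < δ) :
    ∀ᶠ n : ℕ in atTop, (((zeroSumSigns n).filter fun A =>
      IsSpread (n / 1100) m A ∧ HasSparseKernel (n / 1100) A).card : ℝ) ≤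
      δ * (zeroSumSigns n).card := by
  have t1 : Tendsto (fun N : ℕ => (40 : ℝ) * ((N : ℝ) ^ 1 * (0.82 : ℝ) ^ N)) atTop (𝓝 0) := by
    simpa using (tendsto_pow_const_mul_const_pow_of_lt_one 1 (r := (0.82 : ℝ)) (by norm_num)
      (by norm_num)).const_mul 40
  have t2 := t1.comp (Nat.tendsto_div_const_atTop (n := 10) (by norm_num))
  filter_upwards [t2.eventually_le_const hδ, eventually_ge_atTop 10] with n h1 hn
  have : NeZero n := ⟨by omega⟩
  have h := card_sparse_kernel_le (n := n) (k := n / 1100) (m := m) (N := n / 10) hm (by omega)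
    (by omega) ((zeroSumSigns n).filter fun A =>
      IsSpread (n / 1100) m A ∧ HasSparseKernel (n / 1100) A)
    (fun A hA => ⟨(Finset.mem_filter.1 hA).1, (Finset.mem_filter.1 hA).2.1,
      (Finset.mem_filter.1 hA).2.2⟩)
  refine h.trans ?_
  rw [← mul_assoc]
  refine mul_le_mul_of_nonneg_right (le_trans ?_ h1) (Nat.cast_nonneg _)
  have hM := card_filter_card_le_div_le n
  set N := n / 10 with hN
  have hn20 : (n : ℝ) ≤ 20 * N := by exact_mod_cast (show n ≤ 20 * N by omega)
  have hM2 : ((Finset.univ.filter fun J : Finset (Fin n) => J.card ≤ n / 1100).card : ℝ) ^ 2 ≤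
      2 * ((1 + 1 / 200) ^ 40) ^ N := by
    calc _ ≤ ((1 + 1 / 200 : ℝ) ^ (2 * n)) ^ 2 := by gcongr
      _ = (1 + 1 / 200 : ℝ) ^ (4 * n) := by rw [← pow_mul]; congr 1; ring
      _ ≤ (1 + 1 / 200 : ℝ) ^ (40 + 40 * N) := pow_le_pow_right₀ (by norm_num) (by omega)
      _ = (1 + 1 / 200 : ℝ) ^ 40 * ((1 + 1 / 200) ^ 40) ^ N := by rw [pow_add, pow_mul]
      _ ≤ _ := by gcongr; norm_num
  calc _ ≤ 2 * ((1 + 1 / 200 : ℝ) ^ 40) ^ N * ((20 * N) * (2 / 3 : ℝ) ^ N) := by gcongr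
    _ = 40 * (N * ((1 + 1 / 200 : ℝ) ^ 40 * (2 / 3)) ^ N) := by rw [mul_pow]; ring
    _ ≤ 40 * (N * (0.82 : ℝ) ^ N) := by gcongr; norm_num
    _ = _ := by simp [hN]

end asymptotics

/-- For even `n`, let `Ξ₀` be an `n × n` matrix of iid uniform `±1` signs conditioned to
have all row and column sums equal to `0`.  Then with probability `1 - o(1)`,
`ker(Ξ₀) = ⟨𝟙⟩`, the span of the all-ones vector. -/
theorem kernel_of_zero_sum_sign_matrix :
    ∀ ε : ℝ, 0 < ε → ∃ N : ℕ, ∀ n, N ≤ n → Even n →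
      1 - ε ≤ cprob (zeroSumSigns n) (fun A =>
        LinearMap.ker (Matrix.mulVecLin (sgn2r A)) =
          Submodule.span ℝ {fun _ => (1 : ℝ)}) := by
  intro ε hε
  set m : ℕ := ⌈(44000 / ε) ^ 2⌉₊ + 1 with hm
  have hm1 : 1 ≤ m := by omega
  have hmε : 8800 / √(m : ℝ) ≤ ε / 5 := by
    have h1 : 44000 / ε ≤ √(m : ℝ) := by
      apply Real.le_sqrt_of_sq_le
      rw [hm]; push_cast
      have := Nat.le_ceil ((44000 / ε) ^ 2)
      linarith
    have hs : 0 < √(m : ℝ) := Real.sqrt_pos.2 (by exact_mod_cast hm1)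
    rw [div_le_iff₀ hε] at h1
    rw [div_le_div_iff₀ hs (by norm_num)]
    linarith
  obtain ⟨N, hN⟩ := Filter.eventually_atTop.1
    ((eventually_card_not_isSpread_le m (δ := ε / 5) (by positivity)).and
      ((eventually_card_hasSparseKernel_le hm1 (δ := ε / 5) (by positivity)).and
        (Filter.eventually_ge_atTop 1100)))
  refine ⟨N, fun n hn heven => ?_⟩
  obtain ⟨h1, h2, hn1⟩ := hN n hn
  have hbad := card_ker_ne_span_le h1 h2
    (c := ε / 5 * (zeroSumSigns n).card) (by
    intro B hB
    have h := card_dense_kernel_mul_le hm1 B hB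
    have hn0 : (0 : ℝ) < n := by exact_mod_cast (show 0 < n by omega)
    have hk0 : (0 : ℝ) < (n / 1100 : ℕ) := by exact_mod_cast (show 0 < n / 1100 by omega)
    have hnk : (n : ℝ) ≤ 2200 * (n / 1100 : ℕ) := by
      exact_mod_cast (show n ≤ 2200 * (n / 1100) by omega)
    set k : ℝ := ((n / 1100 : ℕ) : ℝ)
    set z : ℝ := ((zeroSumSigns n).card : ℝ)
    have hz : 0 ≤ z := Nat.cast_nonneg _
    have h3 : 4 * (n : ℝ) ^ 2 / √m * z ≤ 8800 / √m * z * (n * k) := by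
      have : 4 * (n : ℝ) ^ 2 / √m * z = 4 / √m * z * n * n := by ring
      rw [this]
      have h4 : 8800 / √m * z * (n * k) = 4 / √m * z * n * (2200 * k) := by ring
      rw [h4]
      gcongr
    have h5 : (B.card : ℝ) ≤ 8800 / √m * z :=
      le_of_mul_le_mul_right (h.trans h3) (by positivity)
    exact h5.trans (mul_le_mul_of_nonneg_right hmε hz))
  have hpos : (0 : ℝ) < (zeroSumSigns n).card := by
    exact_mod_cast (zeroSumSigns_nonempty heven).card_pos
  have hsum := Finset.card_filter_add_card_filter_not (s := zeroSumSigns n)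
    (fun A => LinearMap.ker (Matrix.mulVecLin (sgn2r A)) =
      Submodule.span ℝ {fun _ => (1 : ℝ)})
  have hsum' : (((zeroSumSigns n).filter fun A => LinearMap.ker (Matrix.mulVecLin (sgn2r A)) =
      Submodule.span ℝ {fun _ => (1 : ℝ)}).card : ℝ) +
      ((zeroSumSigns n).filter fun A => LinearMap.ker (Matrix.mulVecLin (sgn2r A)) ≠
      Submodule.span ℝ {fun _ => (1 : ℝ)}).card = (zeroSumSigns n).card := by
    exact_mod_cast hsum
  rw [cprob, le_div_iff₀ hpos]
  have hgood : (1 - ε) * (zeroSumSigns n).card ≤ (((zeroSumSigns n).filter fun A =>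
      LinearMap.ker (Matrix.mulVecLin (sgn2r A)) =
        Submodule.span ℝ {fun _ => (1 : ℝ)}).card : ℝ) := by linarith
  refine hgood.trans_eq ?_
  congr!

end
end
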